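/- arXiv:2402.13078 — 2 statements merged into one kernel-verified Lean document; each statement's English description precedes it below -/
import Mathlib

section
/- Let Ω ⊆ ℝ^N be open and C ⊆ Ω. Then C is GBV-polar in Ω if and only if there exists a sequence {U_k} of open sets, each containing C and having locally finite perimeter in Ω, such that λ^N(U_k) → 0. -/
open MeasureTheory Metric Filter Set
open scoped ENNReal Topology symmDiff

noncomputable section

abbrev Euc (N : ℕ) : Type := EuclideanSpace ℝ (Fin N)

variable {N : ℕ}

/-- The divergence of a vector field `φ : ℝ^N → ℝ^N`. -/
def diverg (φ : Euc N → Euc N) (x : Euc N) : ℝ :=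
  ∑ i : Fin N, fderiv ℝ φ x (EuclideanSpace.single i 1) i

/-- The admissible test vector fields for the variation in `Ω`:
`C^1`, compactly supported in `Ω`, with `‖φ‖ ≤ 1`. -/
def TestVF (Ω : Set (Euc N)) : Set (Euc N → Euc N) :=
  {φ | ContDiff ℝ 1 φ ∧ HasCompactSupport φ ∧ tsupport φ ⊆ Ω ∧ ∀ x, ‖φ x‖ ≤ 1}

/-- The total variation `V(u, Ω)`. -/
def variation (u : Euc N → ℝ) (Ω : Set (Euc N)) : ℝ≥0∞ :=
  ⨆ φ ∈ TestVF Ω, ENNReal.ofReal (∫ x in Ω, u x * diverg φ x)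

/-- The perimeter `P(A, Ω)` of `A` in `Ω`. -/
def perimeter (A Ω : Set (Euc N)) : ℝ≥0∞ :=
  ⨆ φ ∈ TestVF Ω, ENNReal.ofReal (∫ x in A, diverg φ x)

/-- `u ∈ BV(Ω)`. -/
def MemBV (u : Euc N → ℝ) (Ω : Set (Euc N)) : Prop :=
  IntegrableOn u Ω volume ∧ variation u Ω < ⊤

/-- `u ∈ BV_loc(Ω)`. -/
def MemBVloc (u : Euc N → ℝ) (Ω : Set (Euc N)) : Prop :=
  ∀ Ω' : Set (Euc N), IsOpen Ω' → IsCompact (closure Ω') → closure Ω' ⊆ Ω → MemBV u Ω'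

/-- `u ∈ GBV(Ω)`: measurable, and every truncation `(-m) ∨ u ∧ m` is in `BV_loc(Ω)`. -/
def MemGBV (u : Euc N → ℝ) (Ω : Set (Euc N)) : Prop :=
  AEMeasurable u (volume.restrict Ω) ∧
    ∀ m : ℝ, 0 < m → MemBVloc (fun x => max (-m) (min (u x) m)) Ω

/-- `A` has locally finite perimeter in `Ω`. -/
def HasLocFinPerimeter (A Ω : Set (Euc N)) : Prop :=
  ∀ Ω' : Set (Euc N), IsOpen Ω' → IsCompact (closure Ω') → closure Ω' ⊆ Ω →
    perimeter A Ω' < ⊤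

/-- `A` has density `t` at `x`. -/
def HasDensity (A : Set (Euc N)) (x : Euc N) (t : ℝ) : Prop :=
  Tendsto (fun ρ : ℝ => volume (A ∩ ball x ρ) / volume (ball x ρ)) (𝓝[>] 0)
    (𝓝 (ENNReal.ofReal t))

/-- The approximate upper limit `u⁺(x)` of `u` at `x` (relative to `Ω`), with `inf ∅ = ⊤`. -/
def approxUpper (u : Euc N → ℝ) (Ω : Set (Euc N)) (x : Euc N) : EReal :=
  sInf {t : EReal | ∃ s : ℝ, t = (s : EReal) ∧ HasDensity {y | y ∈ Ω ∧ s < u y} x 0}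

/-- The approximate lower limit `u⁻(x)` of `u` at `x` (relative to `Ω`), with `sup ∅ = ⊥`. -/
def approxLower (u : Euc N → ℝ) (Ω : Set (Euc N)) (x : Euc N) : EReal :=
  sSup {t : EReal | ∃ s : ℝ, t = (s : EReal) ∧ HasDensity {y | y ∈ Ω ∧ u y < s} x 0}

/-- The approximate limit `ũ(x)` exists (i.e. `u⁺(x) = u⁻(x)`) and is `+∞`. -/
def HasApproxLimitTop (u : Euc N → ℝ) (Ω : Set (Euc N)) (x : Euc N) : Prop :=
  approxUpper u Ω x = ⊤ ∧ approxLower u Ω x = ⊤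

/-- The approximate limit `ũ(x)` exists and `|ũ(x)| = +∞`. -/
def HasInfApproxLimit (u : Euc N → ℝ) (Ω : Set (Euc N)) (x : Euc N) : Prop :=
  (approxUpper u Ω x = ⊤ ∧ approxLower u Ω x = ⊤) ∨
    (approxUpper u Ω x = ⊥ ∧ approxLower u Ω x = ⊥)

/-- `C` is `L⁰`-polar in `Ω`. -/
def L0Polar (C Ω : Set (Euc N)) : Prop :=
  ∃ u : Euc N → ℝ, AEMeasurable u (volume.restrict Ω) ∧
    C ⊆ {x | x ∈ Ω ∧ HasInfApproxLimit u Ω x}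

/-- `C` is `BV`-polar in `Ω`. -/
def BVPolar (C Ω : Set (Euc N)) : Prop :=
  ∃ u : Euc N → ℝ, MemBV u Ω ∧ C ⊆ {x | x ∈ Ω ∧ HasInfApproxLimit u Ω x}

/-- `C` is `GBV`-polar in `Ω`. -/
def GBVPolar (C Ω : Set (Euc N)) : Prop :=
  ∃ u : Euc N → ℝ, MemGBV u Ω ∧ C ⊆ {x | x ∈ Ω ∧ HasInfApproxLimit u Ω x}

/-- The set `A^{(1)}` of points of `Ω` where `A` has density `1`. -/
def densityOne (A Ω : Set (Euc N)) : Set (Euc N) :=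
  {x | x ∈ Ω ∧ HasDensity A x 1}


/-! ### Difference quotients -/

/-- The `L¹`-modulus of continuity of `f` on `G` in direction `h`. -/
def dq (f : Euc N → ℝ) (h : Euc N) (G : Set (Euc N)) : ℝ≥0∞ :=
  ∫⁻ x in G, ‖f (x + h) - f x‖ₑ

lemma integrable_bdd_mul {f : Euc N → ℝ} (hf : Measurable f) {M : ℝ} (hM : ∀ x, |f x| ≤ M)
    {g : Euc N → ℝ} (hg : Integrable g) : Integrable (fun x => f x * g x) :=
  hg.bdd_mul hf.aestronglyMeasurable (Eventually.of_forall (fun x => by simpa using hM x))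

lemma hasDerivAt_shift {f : Euc N → ℝ} (hf : Measurable f) {M : ℝ} (hM : ∀ x, |f x| ≤ M)
    {ψ : Euc N → ℝ} (hψ : ContDiff ℝ 1 ψ) (hc : HasCompactSupport ψ) (h : Euc N) (t : ℝ) :
    HasDerivAt (fun t : ℝ => ∫ x, f x * ψ (x - t • h))
      (-∫ x, f x * fderiv ℝ ψ (x - t • h) h) t := by
  have hcd : Continuous (fderiv ℝ ψ) := hψ.continuous_fderiv one_ne_zero
  obtain ⟨B, hB⟩ := (hc.fderiv (𝕜 := ℝ)).exists_bound_of_continuous hcd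
  have hB0 : 0 ≤ B := (norm_nonneg _).trans (hB 0)
  have hM0 : 0 ≤ M := (abs_nonneg _).trans (hM 0)
  -- compact set containing all the relevant supports
  set K : Set (Euc N) := (fun p : Euc N × ℝ => p.1 + p.2 • h) ''
    (tsupport ψ ×ˢ Icc (t - 1) (t + 1)) with hK
  have hKc : IsCompact K :=
    (hc.isCompact.prod isCompact_Icc).image (by fun_prop)
  have key := hasDerivAt_integral_of_dominated_loc_of_deriv_le (μ := (volume : Measure (Euc N)))
    (F := fun (t : ℝ) x => f x * ψ (x - t • h))
    (F' := fun t x => -(f x * fderiv ℝ ψ (x - t • h) h)) (x₀ := t)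
    (s := Icc (t - 1) (t + 1)) (bound := K.indicator (fun _ => M * (B * ‖h‖)))
    (Icc_mem_nhds (by linarith) (by linarith)) ?_ ?_ ?_ ?_ ?_ ?_
  · rw [integral_neg] at key
    exact key.2
  · refine Eventually.of_forall fun s => ?_
    exact hf.aestronglyMeasurable.mul
      (hψ.continuous.comp (by fun_prop : Continuous fun x : Euc N => x - s • h)).aestronglyMeasurable
  · refine integrable_bdd_mul hf hM ?_
    exact (hψ.continuous.integrable_of_hasCompactSupport hc).comp_sub_right (t • h)
  · refine (hf.aestronglyMeasurable.mul ?_).neg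
    have : Continuous fun x : Euc N => fderiv ℝ ψ (x - t • h) h := by fun_prop
    exact this.aestronglyMeasurable
  · refine Eventually.of_forall fun x s hs => ?_
    by_cases hx : x ∈ K
    · rw [indicator_of_mem hx, norm_neg, norm_mul]
      have h1 : ‖fderiv ℝ ψ (x - s • h) h‖ ≤ B * ‖h‖ :=
        (ContinuousLinearMap.le_opNorm _ _).trans (by gcongr; exact hB _)
      exact mul_le_mul (hM x) h1 (norm_nonneg _) hM0
    · have : x - s • h ∉ tsupport ψ := fun hx' => hx ⟨(x - s • h, s), ⟨hx', hs⟩, by simp⟩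
      have h0 : fderiv ℝ ψ (x - s • h) = 0 :=
        image_eq_zero_of_notMem_tsupport (fun h' => this (tsupport_fderiv_subset ℝ h'))
      rw [h0, indicator_of_notMem hx]; simp
  · exact (integrable_indicator_iff hKc.measurableSet).2
      (integrableOn_const hKc.measure_lt_top.ne)
  · refine Eventually.of_forall fun x s _ => ?_
    have h1 : HasDerivAt (fun s : ℝ => x - s • h) (-h) s := by
      simpa using ((hasDerivAt_id s).smul_const h).const_sub x
    have h2 := ((hψ.differentiable one_ne_zero) (x - s • h)).hasFDerivAt.comp_hasDerivAt s h1
    have h3 := h2.const_mul (f x)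
    simpa using h3

lemma integral_shift (f : Euc N → ℝ) (ψ : Euc N → ℝ) (h : Euc N) :
    ∫ x, f x * ψ (x - h) = ∫ x, f (x + h) * ψ x := by
  rw [← integral_add_right_eq_self (fun x => f x * ψ (x - h)) h]
  simp

lemma diverg_eq_zero {φ : Euc N → Euc N} {x : Euc N} (hx : x ∉ tsupport φ) : diverg φ x = 0 := by
  have h0 : fderiv ℝ φ x = 0 :=
    image_eq_zero_of_notMem_tsupport (fun h' => hx (tsupport_fderiv_subset ℝ h'))
  simp [diverg, h0]

lemma setIntegral_diverg {f : Euc N → ℝ} {φ : Euc N → Euc N} {W : Set (Euc N)}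
    (hφ : φ ∈ TestVF W) : ∫ x in W, f x * diverg φ x = ∫ x, f x * diverg φ x := by
  apply setIntegral_eq_integral_of_forall_compl_eq_zero
  intro x hx
  rw [diverg_eq_zero (fun h => hx (hφ.2.2.1 h)), mul_zero]

lemma perimeter_eq {A : Set (Euc N)} (hA : MeasurableSet A) (W : Set (Euc N)) :
    perimeter A W = variation (A.indicator 1) W := by
  unfold perimeter variation
  refine iSup_congr fun φ => iSup_congr fun hφ => ?_
  rw [setIntegral_diverg hφ, ← integral_indicator hA]
  congr 2
  ext x
  by_cases hx : x ∈ A <;> simp [hx]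

lemma coord_contDiff {φ : Euc N → Euc N} (hφ : ContDiff ℝ 1 φ) (i : Fin N) :
    ContDiff ℝ 1 (fun x => φ x i) := by fun_prop

lemma fderiv_coord {φ : Euc N → Euc N} (hφ : ContDiff ℝ 1 φ) (i : Fin N) (x v : Euc N) :
    fderiv ℝ (fun x => φ x i) x v = fderiv ℝ φ x v i := by
  have h1 := ((hφ.differentiable one_ne_zero) x).hasFDerivAt
  have h2 := ((EuclideanSpace.proj (𝕜 := ℝ) i).hasFDerivAt (x := φ x)).comp x h1
  have h3 : HasFDerivAt (fun x => φ x i) ((EuclideanSpace.proj (𝕜 := ℝ) i).comp (fderiv ℝ φ x)) x := h2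
  rw [h3.fderiv]; simp

lemma coord_hasCompactSupport {φ : Euc N → Euc N} (hφ : HasCompactSupport φ) (i : Fin N) :
    HasCompactSupport (fun x => φ x i) :=
  hφ.comp_left (g := fun v : Euc N => v i) (by simp)

lemma integral_diverg {f : Euc N → ℝ} (hf : Measurable f) {M : ℝ} (hM : ∀ x, |f x| ≤ M)
    {φ : Euc N → Euc N} (hφ : ContDiff ℝ 1 φ) (hc : HasCompactSupport φ) :
    ∫ x, f x * diverg φ x = ∑ i : Fin N, ∫ x, f x * fderiv ℝ (fun x => φ x i) x
      (EuclideanSpace.single i 1) := by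
  rw [← integral_finsetSum]
  · congr 1; ext x
    rw [diverg, Finset.mul_sum]
    exact Finset.sum_congr rfl fun i _ => by rw [fderiv_coord hφ]
  · intro i _
    refine integrable_bdd_mul hf hM ?_
    have hψ := coord_contDiff hφ i
    have hcd : Continuous (fderiv ℝ (fun x => φ x i)) := hψ.continuous_fderiv one_ne_zero
    refine Continuous.integrable_of_hasCompactSupport (by fun_prop) ?_
    exact ((coord_hasCompactSupport hc i).fderiv (𝕜 := ℝ)).comp_left
      (g := fun L : Euc N →L[ℝ] ℝ => L (EuclideanSpace.single i 1)) (by simp)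

/-- The variation is controlled by the difference quotients along the coordinate directions. -/
lemma variation_le_liminf {f : Euc N → ℝ} (hf : Measurable f) {M : ℝ} (hM : ∀ x, |f x| ≤ M)
    {W : Set (Euc N)} :
    variation f W ≤ liminf (fun n : ℕ => ∑ i : Fin N,
      ((n : ℝ≥0∞) + 1) * dq f (((n : ℝ) + 1)⁻¹ • EuclideanSpace.single i (1 : ℝ)) W) atTop := by
  refine iSup₂_le fun φ hφ => ?_
  rw [setIntegral_diverg hφ, integral_diverg hf hM hφ.1 hφ.2.1]
  set e : Fin N → Euc N := fun i => EuclideanSpace.single i (1 : ℝ) with he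
  set F : Fin N → ℝ → ℝ := fun i t => ∫ x, f x * φ (x - t • e i) i with hF
  have hder : ∀ i, HasDerivAt (F i) (-∫ x, f x * fderiv ℝ (fun x => φ x i) x (e i)) 0 := by
    intro i
    have := hasDerivAt_shift hf hM (coord_contDiff hφ.1 i) (coord_hasCompactSupport hφ.2.1 i) (e i) 0
    simpa using this
  have hseq : Tendsto (fun n : ℕ => ((n : ℝ) + 1)⁻¹) atTop (𝓝[≠] 0) := by
    rw [tendsto_nhdsWithin_iff]
    refine ⟨by simpa using tendsto_one_div_add_atTop_nhds_zero_nat (𝕜 := ℝ), ?_⟩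
    exact Eventually.of_forall fun n => by simp; positivity
  have hlim : ∀ i, Tendsto (fun n : ℕ => ((n : ℝ) + 1) * (F i 0 - F i ((n : ℝ) + 1)⁻¹)) atTop
      (𝓝 (∫ x, f x * fderiv ℝ (fun x => φ x i) x (e i))) := by
    intro i
    have h1 := ((hder i).tendsto_slope_zero.comp hseq).neg
    simp only [neg_neg] at h1
    refine h1.congr fun n => ?_
    simp
    ring
  have hlim2 := ENNReal.tendsto_ofReal (tendsto_finsetSum Finset.univ (fun i _ => hlim i))
  rw [← hlim2.liminf_eq]
  refine liminf_le_liminf (Eventually.of_forall fun n => ?_)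
  refine (Finset.le_sum_of_subadditive ENNReal.ofReal ENNReal.ofReal_zero.le
    (fun a b => ENNReal.ofReal_add_le) Finset.univ _).trans (Finset.sum_le_sum fun i _ => ?_)
  have hn : (0 : ℝ) ≤ (n : ℝ) + 1 := by positivity
  rw [ENNReal.ofReal_mul hn]
  have hn' : ENNReal.ofReal ((n : ℝ) + 1) = (n : ℝ≥0∞) + 1 := by
    rw [ENNReal.ofReal_add (by positivity) zero_le_one]; simp
  rw [hn']
  gcongr
  set h : Euc N := ((n : ℝ) + 1)⁻¹ • e i
  have hψc := coord_hasCompactSupport hφ.2.1 i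
  have hψd := (coord_contDiff hφ.1 i).continuous
  have hψi : Integrable (fun x => φ x i) := hψd.integrable_of_hasCompactSupport hψc
  have e1 : F i 0 - F i ((n : ℝ) + 1)⁻¹ = ∫ x, (f x - f (x + h)) * φ x i := by
    have : F i ((n : ℝ) + 1)⁻¹ = ∫ x, f (x + h) * φ x i :=
      integral_shift f (fun x => φ x i) h
    rw [this]
    have h0 : F i 0 = ∫ x, f x * φ x i := by simp [hF]
    rw [h0, ← integral_sub]
    · simp_rw [sub_mul]
    · exact integrable_bdd_mul hf hM hψi
    · exact integrable_bdd_mul (f := fun x => f (x + h)) (hf.comp (measurable_add_const h))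
        (fun x => hM _) hψi
  rw [e1]
  calc ENNReal.ofReal (∫ x, (f x - f (x + h)) * φ x i)
      ≤ ∫⁻ x, ‖(f x - f (x + h)) * φ x i‖ₑ := by
        refine (ENNReal.ofReal_le_ofReal (le_abs_self _)).trans ?_
        rw [← Real.enorm_eq_ofReal_abs]
        exact enorm_integral_le_lintegral_enorm _
    _ = ∫⁻ x in W, ‖(f x - f (x + h)) * φ x i‖ₑ := by
        symm
        apply setLIntegral_eq_of_support_subset
        intro x hx
        by_contra hxW
        have : φ x = 0 := image_eq_zero_of_notMem_tsupport (fun h' => hxW (hφ.2.2.1 h'))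
        simp [this] at hx
    _ ≤ dq f h W := by
        refine lintegral_mono fun x => ?_
        rw [enorm_mul, ← enorm_neg, neg_sub]
        have : ‖φ x i‖ₑ ≤ 1 := by
          have h1 : ‖φ x i‖ ≤ 1 := (PiLp.norm_apply_le (φ x) i).trans (hφ.2.2.2 x)
          rw [← ofReal_norm]
          simpa using ENNReal.ofReal_le_ofReal h1
        calc _ ≤ ‖f (x + h) - f x‖ₑ * 1 := by gcongr
          _ = _ := mul_one _

/-! ### Duality and the translation estimate -/

lemma exists_cutoff {K O : Set (Euc N)} (hK : IsCompact K) (hO : IsOpen O) (hKO : K ⊆ O) :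
    ∃ ψ : Euc N → ℝ, ContDiff ℝ 1 ψ ∧ HasCompactSupport ψ ∧ tsupport ψ ⊆ O ∧
      (∀ x ∈ K, ψ x = 1) ∧ (∀ x, 0 ≤ ψ x ∧ ψ x ≤ 1) := by
  obtain ⟨L, hL, hKL, hLO⟩ := exists_compact_between hK hO hKO
  obtain ⟨f, hf1, hf0, hf⟩ := exists_contMDiffMap_one_nhds_of_subset_interior
    (n := 1) (modelWithCornersSelf ℝ (Euc N)) hK.isClosed hKL
  have hs : tsupport (f : Euc N → ℝ) ⊆ L := by
    refine closure_minimal ?_ hL.isClosed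
    intro x hx
    by_contra h
    exact hx (hf0 x h)
  refine ⟨f, f.contMDiff.contDiff, hL.of_isClosed_subset (isClosed_tsupport _) hs,
    hs.trans hLO, fun x hx => hf1.self_of_nhdsSet x hx, fun x => hf x⟩

lemma lintegral_le_of_dual {g : Euc N → ℝ} (hg : Measurable g) {M : ℝ} (hM : ∀ x, |g x| ≤ M)
    {G : Set (Euc N)} (hG : IsOpen G) (hGv : volume G ≠ ⊤) {C : ℝ}
    (hC : ∀ ψ : Euc N → ℝ, ContDiff ℝ 1 ψ → HasCompactSupport ψ → tsupport ψ ⊆ G →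
      (∀ x, |ψ x| ≤ 1) → ∫ x, g x * ψ x ≤ C) :
    ∫⁻ x in G, ‖g x‖ₑ ≤ ENNReal.ofReal C := by
  have hM0 : 0 ≤ M := (abs_nonneg _).trans (hM 0)
  have hgi : IntegrableOn g G := by
    refine Measure.integrableOn_of_bounded hGv hg.aestronglyMeasurable (M := M) ?_
    exact Eventually.of_forall fun x => by simpa using hM x
  rw [← ofReal_integral_norm_eq_lintegral_enorm hgi]
  refine ENNReal.ofReal_le_ofReal ?_
  refine le_of_forall_pos_le_add fun η hη => ?_
  obtain ⟨ε, hε, hεη⟩ : ∃ ε : ℝ, 0 < ε ∧ 2 * M * (2 * ε) ≤ η := by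
    refine ⟨η / (4 * (M + 1)), by positivity, ?_⟩
    rw [show 2 * M * (2 * (η / (4 * (M + 1)))) = η * (M / (M + 1)) by field_simp; ring]
    have : M / (M + 1) ≤ 1 := by rw [div_le_one (by positivity)]; linarith
    nlinarith
  set P : Set (Euc N) := G ∩ {x | 0 < g x} with hP
  set Q : Set (Euc N) := G ∩ {x | g x < 0} with hQ
  have hPm : MeasurableSet P := hG.measurableSet.inter (measurableSet_lt measurable_const hg)
  have hQm : MeasurableSet Q := hG.measurableSet.inter (measurableSet_lt hg measurable_const)
  have hε' : ENNReal.ofReal ε ≠ 0 := by simpa using hε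
  obtain ⟨K, hKP, hKc, hKv⟩ := hPm.exists_isCompact_sdiff_lt
    (measure_ne_top_of_subset inter_subset_left hGv) hε'
  obtain ⟨L, hLQ, hLc, hLv⟩ := hQm.exists_isCompact_sdiff_lt
    (measure_ne_top_of_subset inter_subset_left hGv) hε'
  have hKL : ∀ x ∈ K, x ∉ L := fun x hx hx' => by
    have h1 := (hKP hx).2; have h2 := (hLQ hx').2
    simp only [mem_ofPred_eq] at h1 h2; linarith
  obtain ⟨ψ₁, c₁, s₁, t₁, o₁, b₁⟩ := exists_cutoff hKc (hG.sdiff hLc.isClosed)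
    (fun x hx => ⟨(hKP hx).1, hKL x hx⟩)
  obtain ⟨ψ₂, c₂, s₂, t₂, o₂, b₂⟩ := exists_cutoff hLc (hG.sdiff hKc.isClosed)
    (fun x hx => ⟨(hLQ hx).1, fun h => hKL x h hx⟩)
  have hψ := hC (fun x => ψ₁ x - ψ₂ x) (c₁.sub c₂) (s₁.sub s₂)
    ((tsupport_sub _ _).trans (union_subset (t₁.trans sdiff_subset) (t₂.trans sdiff_subset)))
    (fun x => by rw [abs_le]; constructor <;> linarith [(b₁ x).1, (b₁ x).2, (b₂ x).1, (b₂ x).2])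
  set ψ : Euc N → ℝ := fun x => ψ₁ x - ψ₂ x with hψdef
  have hψb : ∀ x, |ψ x| ≤ 1 := fun x => by
    simp only [hψdef]
    rw [abs_le]; constructor <;> linarith [(b₁ x).1, (b₁ x).2, (b₂ x).1, (b₂ x).2]
  have hψc : Continuous ψ := c₁.continuous.sub c₂.continuous
  have hψs : HasCompactSupport ψ := s₁.sub s₂
  have hψi : Integrable (fun x => g x * ψ x) :=
    integrable_bdd_mul hg hM (hψc.integrable_of_hasCompactSupport hψs)
  have hset : ∫ x in G, g x * ψ x = ∫ x, g x * ψ x := by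
    apply setIntegral_eq_integral_of_forall_compl_eq_zero
    intro x hx
    have h1 : ψ₁ x = 0 := image_eq_zero_of_notMem_tsupport fun h => hx (t₁ h).1
    have h2 : ψ₂ x = 0 := image_eq_zero_of_notMem_tsupport fun h => hx (t₂ h).1
    simp [hψdef, h1, h2]
  set R : Set (Euc N) := (P \ K) ∪ (Q \ L) with hR
  have hRm : MeasurableSet R :=
    (hPm.diff hKc.measurableSet).union (hQm.diff hLc.measurableSet)
  have hRv : volume R ≤ ENNReal.ofReal (2 * ε) := by
    refine (measure_union_le _ _).trans ?_
    rw [two_mul, ENNReal.ofReal_add hε.le hε.le]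
    exact add_le_add hKv.le hLv.le
  have hRG : R ⊆ G := union_subset (sdiff_subset.trans inter_subset_left)
    (sdiff_subset.trans inter_subset_left)
  have hRfin : volume R ≠ ⊤ := ne_top_of_le_ne_top ENNReal.ofReal_ne_top hRv
  have hpt : ∀ x ∈ G, ‖g x‖ ≤ g x * ψ x + R.indicator (fun _ => 2 * M) x := by
    intro x hx
    by_cases hxR : x ∈ R
    · rw [indicator_of_mem hxR, Real.norm_eq_abs]
      have h1 : |g x * ψ x| ≤ M * 1 := by
        rw [abs_mul]; exact mul_le_mul (hM x) (hψb x) (abs_nonneg _) hM0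
      have := (abs_le.1 h1).1
      linarith [hM x]
    · rw [indicator_of_notMem hxR, add_zero, Real.norm_eq_abs]
      rcases lt_trichotomy (g x) 0 with h | h | h
      · have hxL : x ∈ L := by
          by_contra hxL; exact hxR (Or.inr ⟨⟨hx, h⟩, hxL⟩)
        have h1 : ψ₁ x = 0 := image_eq_zero_of_notMem_tsupport fun h => (t₁ h).2 hxL
        simp [hψdef, h1, o₂ x hxL, abs_of_neg h]
      · simp [h]
      · have hxK : x ∈ K := by
          by_contra hxK; exact hxR (Or.inl ⟨⟨hx, h⟩, hxK⟩)
        have h2 : ψ₂ x = 0 := image_eq_zero_of_notMem_tsupport fun h => (t₂ h).2 hxK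
        simp [hψdef, h2, o₁ x hxK, abs_of_pos h]
  have hRi : Integrable (R.indicator (fun _ => 2 * M)) :=
    (integrable_indicator_iff hRm).2 (integrableOn_const hRfin)
  calc ∫ x in G, ‖g x‖ ≤ ∫ x in G, (g x * ψ x + R.indicator (fun _ => 2 * M) x) :=
        setIntegral_mono_on hgi.norm (hψi.integrableOn.add hRi.integrableOn) hG.measurableSet hpt
    _ = (∫ x, g x * ψ x) + volume.real R * (2 * M) := by
        rw [integral_add hψi.integrableOn hRi.integrableOn, hset, setIntegral_indicator hRm,
          inter_eq_right.2 hRG, setIntegral_const, smul_eq_mul]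
    _ ≤ C + 2 * ε * (2 * M) := by
        gcongr
        exact ENNReal.toReal_le_of_le_ofReal (by positivity) hRv
    _ ≤ C + η := by linarith

lemma diverg_smul {ψ : Euc N → ℝ} (hψ : ContDiff ℝ 1 ψ) (c x : Euc N) :
    diverg (fun y => ψ y • c) x = fderiv ℝ ψ x c := by
  have h1 := (((hψ.differentiable one_ne_zero) x).hasFDerivAt.smul_const c).fderiv
  unfold diverg
  rw [h1]
  conv_rhs => rw [← (EuclideanSpace.basisFun (Fin N) ℝ).sum_repr c]
  simp [map_sum, mul_comm]

lemma neg_mem_testVF {φ : Euc N → Euc N} {W : Set (Euc N)} (hφ : φ ∈ TestVF W) :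
    (fun x => - φ x) ∈ TestVF W := by
  refine ⟨hφ.1.neg, hφ.2.1.neg, ?_, fun x => by rw [norm_neg]; exact hφ.2.2.2 x⟩
  have : tsupport (fun x => - φ x) = tsupport φ := by
    simp [tsupport, Function.support_fun_neg]
  rw [this]; exact hφ.2.2.1

lemma diverg_neg (φ : Euc N → Euc N) (x : Euc N) : diverg (fun x => - φ x) x = - diverg φ x := by
  simp [diverg, fderiv_fun_neg]

lemma abs_integral_le_variation {f : Euc N → ℝ} {W : Set (Euc N)} (hV : variation f W ≠ ⊤)
    {φ : Euc N → Euc N} (hφ : φ ∈ TestVF W) :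
    |∫ x, f x * diverg φ x| ≤ (variation f W).toReal := by
  have key : ∀ φ ∈ TestVF W, ∫ x, f x * diverg φ x ≤ (variation f W).toReal := by
    intro φ hφ
    have h1 : ENNReal.ofReal (∫ x in W, f x * diverg φ x) ≤ variation f W :=
      le_iSup₂ (f := fun φ (_ : φ ∈ TestVF W) => ENNReal.ofReal (∫ x in W, f x * diverg φ x)) φ hφ
    rw [setIntegral_diverg hφ] at h1
    exact (ENNReal.ofReal_le_iff_le_toReal hV).1 h1
  rw [abs_le]
  refine ⟨?_, key φ hφ⟩
  have := key _ (neg_mem_testVF hφ)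
  simp only [diverg_neg, mul_neg, integral_neg] at this
  linarith

/-- Translation estimate for functions of bounded variation. -/
lemma dq_le_variation {f : Euc N → ℝ} (hf : Measurable f) {M : ℝ} (hM : ∀ x, |f x| ≤ M)
    {W G : Set (Euc N)} (hG : IsOpen G) (hGv : volume G ≠ ⊤) (h : Euc N)
    (hGW : ∀ x ∈ G, ∀ t ∈ Icc (0 : ℝ) 1, x + t • h ∈ W) :
    dq f h G ≤ ‖h‖ₑ * variation f W := by
  by_cases hV : variation f W = ⊤
  · by_cases hh : h = 0
    · simp [dq, hh]
    · rw [hV, ENNReal.mul_top (by simpa using hh)]; exact le_top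
  by_cases hh : h = 0
  · simp [dq, hh]
  have hh0 : 0 < ‖h‖ := norm_pos_iff.2 hh
  have hfinal : ∫⁻ x in G, ‖f (x + h) - f x‖ₑ ≤ ENNReal.ofReal (‖h‖ * (variation f W).toReal) := by
    refine lintegral_le_of_dual (g := fun x => f (x + h) - f x) (M := M + M)
      ((hf.comp (measurable_add_const h)).sub hf)
      (fun x => (abs_sub _ _).trans (add_le_add (hM _) (hM _))) hG hGv ?_
    intro ψ hψ hc hs hb
    have hψi : Integrable ψ := hψ.continuous.integrable_of_hasCompactSupport hc
    have e1 : ∫ x, (f (x + h) - f x) * ψ x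
        = (∫ x, f x * ψ (x - (1 : ℝ) • h)) - ∫ x, f x * ψ (x - (0 : ℝ) • h) := by
      rw [one_smul, integral_shift f ψ h]
      simp only [zero_smul, sub_zero]
      rw [← integral_sub]
      · simp_rw [sub_mul]
      · exact integrable_bdd_mul (f := fun x => f (x + h)) (hf.comp (measurable_add_const h))
          (fun x => hM _) hψi
      · exact integrable_bdd_mul hf hM hψi
    rw [e1]
    refine (le_abs_self _).trans ?_
    refine norm_image_sub_le_of_norm_deriv_le_segment_01'
      (f := fun t : ℝ => ∫ x, f x * ψ (x - t • h))
      (fun t _ => (hasDerivAt_shift hf hM hψ hc h t).hasDerivWithinAt) ?_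
    intro t ht
    have hψt : ContDiff ℝ 1 (fun x => ψ (x - t • h)) := hψ.comp (by fun_prop)
    set φ : Euc N → Euc N := fun x => ψ (x - t • h) • (‖h‖⁻¹ • h) with hφ
    have hsup : tsupport φ ⊆ (fun x => x + t • h) '' tsupport ψ := by
      refine closure_minimal ?_ ((hc.isCompact.image (by fun_prop)).isClosed)
      intro x hx
      refine ⟨x - t • h, subset_tsupport _ ?_, by simp⟩
      intro h0
      exact hx (by simp [hφ, h0])
    have hφT : φ ∈ TestVF W := by
      refine ⟨hψt.smul contDiff_const, ?_, ?_, ?_⟩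
      · exact (hc.isCompact.image (by fun_prop)).of_isClosed_subset (isClosed_tsupport _) hsup
      · intro x hx
        obtain ⟨y, hy, rfl⟩ := hsup hx
        exact hGW y (hs hy) t ⟨ht.1, ht.2.le⟩
      · intro x
        simp only [hφ, norm_smul, norm_inv, norm_norm]
        rw [inv_mul_cancel₀ hh0.ne', mul_one]
        exact hb _
    have hdiv : ∀ x, diverg φ x = ‖h‖⁻¹ * fderiv ℝ ψ (x - t • h) h := by
      intro x
      rw [hφ, diverg_smul hψt, fderiv_comp_sub, map_smul, smul_eq_mul]
    have hle := abs_integral_le_variation hV hφT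
    have e2 : ∫ x, f x * diverg φ x = ‖h‖⁻¹ * ∫ x, f x * fderiv ℝ ψ (x - t • h) h := by
      rw [← integral_const_mul]
      congr 1; ext x; rw [hdiv]; ring
    rw [e2, abs_mul, abs_of_pos (inv_pos.2 hh0)] at hle
    rw [norm_neg, Real.norm_eq_abs]
    rwa [inv_mul_le_iff₀ hh0] at hle
  refine hfinal.trans (le_of_eq ?_)
  rw [ENNReal.ofReal_mul hh0.le, ofReal_norm, ENNReal.ofReal_toReal hV]

/-! ### Superadditivity, Poincare inequality, balls -/

lemma variation_mono {f : Euc N → ℝ} {W W' : Set (Euc N)} (h : W ⊆ W') :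
    variation f W ≤ variation f W' := by
  refine iSup₂_le fun φ hφ => ?_
  have hφ' : φ ∈ TestVF W' := ⟨hφ.1, hφ.2.1, hφ.2.2.1.trans h, hφ.2.2.2⟩
  rw [setIntegral_diverg hφ, ← setIntegral_diverg hφ']
  exact le_iSup₂ (f := fun φ (_ : φ ∈ TestVF W') =>
    ENNReal.ofReal (∫ x in W', f x * diverg φ x)) φ hφ'

lemma zero_mem_testVF (W : Set (Euc N)) : (fun _ => 0) ∈ TestVF W := by
  refine ⟨contDiff_const, ?_, ?_, fun x => by simp⟩
  · exact HasCompactSupport.zero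
  · simp [tsupport]

lemma diverg_add {φ ψ : Euc N → Euc N} (hφ : ContDiff ℝ 1 φ) (hψ : ContDiff ℝ 1 ψ) (x : Euc N) :
    diverg (fun x => φ x + ψ x) x = diverg φ x + diverg ψ x := by
  unfold diverg
  rw [← Finset.sum_add_distrib]
  refine Finset.sum_congr rfl fun i _ => ?_
  rw [fderiv_fun_add ((hφ.differentiable one_ne_zero) x) ((hψ.differentiable one_ne_zero) x)]
  simp

lemma integrable_diverg {φ : Euc N → Euc N} (hφ : ContDiff ℝ 1 φ) (hc : HasCompactSupport φ) :
    Integrable (diverg φ) := by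
  have hcd : Continuous (fderiv ℝ φ) := hφ.continuous_fderiv one_ne_zero
  refine Continuous.integrable_of_hasCompactSupport ?_ ?_
  · unfold diverg; fun_prop
  · exact hc.of_isClosed_subset (isClosed_tsupport _)
      (closure_minimal (fun x hx => by
        by_contra h; exact hx (diverg_eq_zero h)) (isClosed_tsupport _))

lemma variation_add_le {f : Euc N → ℝ} (hf : Measurable f) {M : ℝ} (hM : ∀ x, |f x| ≤ M)
    {A B : Set (Euc N)} (hAB : Disjoint A B) :
    variation f A + variation f B ≤ variation f (A ∪ B) := by
  have hpos : ∀ W : Set (Euc N), ∀ φ ∈ TestVF W, ∃ φ' ∈ TestVF W,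
      ENNReal.ofReal (∫ x in W, f x * diverg φ x) = ENNReal.ofReal (∫ x, f x * diverg φ' x) ∧
      0 ≤ ∫ x, f x * diverg φ' x := by
    intro W φ hφ
    rcases le_total 0 (∫ x in W, f x * diverg φ x) with h | h
    · exact ⟨φ, hφ, by rw [setIntegral_diverg hφ], by rwa [setIntegral_diverg hφ] at h⟩
    · refine ⟨fun _ => 0, zero_mem_testVF W, ?_, ?_⟩
      · rw [ENNReal.ofReal_of_nonpos h]; simp [diverg]
      · simp [diverg]
  refine ENNReal.biSup_add_biSup_le' ⟨_, zero_mem_testVF A⟩ ⟨_, zero_mem_testVF B⟩ ?_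
  intro φ hφ ψ hψ
  obtain ⟨φ', hφ', e1, p1⟩ := hpos A φ hφ
  obtain ⟨ψ', hψ', e2, p2⟩ := hpos B ψ hψ
  have hsum : (fun x => φ' x + ψ' x) ∈ TestVF (A ∪ B) := by
    refine ⟨hφ'.1.add hψ'.1, hφ'.2.1.add hψ'.2.1, ?_, ?_⟩
    · exact (tsupport_add _ _).trans (union_subset_union hφ'.2.2.1 hψ'.2.2.1)
    · intro x
      by_cases hx : x ∈ tsupport φ'
      · have : ψ' x = 0 := image_eq_zero_of_notMem_tsupport fun h =>
          disjoint_left.1 hAB (hφ'.2.2.1 hx) (hψ'.2.2.1 h)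
        simpa [this] using hφ'.2.2.2 x
      · have : φ' x = 0 := image_eq_zero_of_notMem_tsupport hx
        simpa [this] using hψ'.2.2.2 x
  rw [e1, e2, ← ENNReal.ofReal_add p1 p2]
  have e3 : (∫ x, f x * diverg φ' x) + ∫ x, f x * diverg ψ' x
      = ∫ x in A ∪ B, f x * diverg (fun x => φ' x + ψ' x) x := by
    rw [setIntegral_diverg hsum, ← integral_add
      (integrable_bdd_mul hf hM (integrable_diverg hφ'.1 hφ'.2.1))
      (integrable_bdd_mul hf hM (integrable_diverg hψ'.1 hψ'.2.1))]
    congr 1; ext x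
    rw [diverg_add hφ'.1 hψ'.1]; ring
  rw [e3]
  exact le_iSup₂ (f := fun φ (_ : φ ∈ TestVF (A ∪ B)) =>
    ENNReal.ofReal (∫ x in A ∪ B, f x * diverg φ x)) _ hsum

lemma sum_variation_le {f : Euc N → ℝ} (hf : Measurable f) {M : ℝ} (hM : ∀ x, |f x| ≤ M)
    {ι : Type*} (s : Finset ι) (B : ι → Set (Euc N))
    (hB : (s : Set ι).PairwiseDisjoint B) :
    ∑ i ∈ s, variation f (B i) ≤ variation f (⋃ i ∈ s, B i) := by
  classical
  induction s using Finset.induction_on with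
  | empty => simp
  | insert a s ha ih =>
    rw [Finset.sum_insert ha, Finset.set_biUnion_insert]
    refine le_trans ?_ (variation_add_le hf hM ?_)
    · gcongr
      exact ih (hB.subset (by simp))
    · rw [disjoint_iUnion₂_right]
      intro i hi
      exact hB (by simp) (by simp [hi]) (fun h => ha (h ▸ hi))

lemma indicator_abs_le (A : Set (Euc N)) (x : Euc N) : |A.indicator (1 : Euc N → ℝ) x| ≤ 1 := by
  by_cases h : x ∈ A <;> simp [h]

lemma measurable_ind {A : Set (Euc N)} (hA : MeasurableSet A) :
    Measurable (A.indicator (1 : Euc N → ℝ)) := measurable_one.indicator hA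

lemma enorm_ind_sub (A : Set (Euc N)) (x y : Euc N) [Decidable (x ∈ A ↔ y ∈ A)] :
    ‖A.indicator (1 : Euc N → ℝ) x - A.indicator (1 : Euc N → ℝ) y‖ₑ
      = if (x ∈ A ↔ y ∈ A) then 0 else 1 := by
  by_cases h : x ∈ A <;> by_cases h' : y ∈ A <;> simp [h, h']

lemma mem_ball_of_mem {x y h : Euc N} {r : ℝ} (h1 : y ∈ ball x r) (h2 : y + h ∈ ball x r) :
    h ∈ ball (0 : Euc N) (2 * r) := by
  rw [mem_ball_iff_norm] at h1 h2
  rw [mem_ball_zero_iff]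
  have e : h = (y + h - x) - (y - x) := by abel
  calc ‖h‖ = ‖(y + h - x) - (y - x)‖ := congrArg norm e
    _ ≤ ‖y + h - x‖ + ‖y - x‖ := norm_sub_le _ _
    _ < 2 * r := by linarith

lemma poincare {E : Set (Euc N)} (hE : MeasurableSet E) (x : Euc N) (r : ℝ) (_hr : 0 < r) :
    volume (ball x r ∩ E) * volume (ball x r \ E) ≤
      volume (ball (0 : Euc N) (2 * r)) * (ENNReal.ofReal (2 * r) * perimeter E (ball x r)) := by
  rw [perimeter_eq hE]
  set f : Euc N → ℝ := E.indicator 1 with hfdef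
  have hf : Measurable f := measurable_ind hE
  set B := ball x r with hB
  have hBm : MeasurableSet B := measurableSet_ball
  set k : Euc N → Euc N → ℝ≥0∞ := fun y h =>
    B.indicator 1 y * (B.indicator 1 (y + h) * ‖f (y + h) - f y‖ₑ) with hk
  have hkm : Measurable (Function.uncurry k) := by
    have i1 : Measurable (B.indicator (1 : Euc N → ℝ≥0∞)) := measurable_one.indicator hBm
    simp only [hk, Function.uncurry_def]
    fun_prop
  have lower : volume (B ∩ E) * volume (B \ E) ≤ ∫⁻ y, ∫⁻ h, k y h := by
    calc volume (B ∩ E) * volume (B \ E) = ∫⁻ y in B \ E, volume (B ∩ E) := by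
          rw [setLIntegral_const]
      _ ≤ ∫⁻ y in B \ E, ∫⁻ h, k y h := by
          refine setLIntegral_mono' (hBm.diff hE) fun y hy => ?_
          calc volume (B ∩ E) = ∫⁻ z, (B ∩ E).indicator 1 z := by
                rw [lintegral_indicator_one (hBm.inter hE)]
            _ = ∫⁻ h, (B ∩ E).indicator 1 (y + h) := by
                rw [lintegral_add_left_eq_self (fun z => (B ∩ E).indicator (1 : Euc N → ℝ≥0∞) z) y]
            _ ≤ ∫⁻ h, k y h := by
                refine lintegral_mono fun h => ?_
                by_cases hz : y + h ∈ B ∩ E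
                · simp [hk, hfdef, hz, hz.1, hz.2, hy.1, hy.2]
                · simp [hz]
      _ ≤ ∫⁻ y, ∫⁻ h, k y h := setLIntegral_le_lintegral _ _
  refine lower.trans ?_
  rw [lintegral_lintegral_swap hkm.aemeasurable]
  calc ∫⁻ h, ∫⁻ y, k y h
      ≤ ∫⁻ h, (ball (0 : Euc N) (2 * r)).indicator
          (fun _ => ENNReal.ofReal (2 * r) * variation f B) h := by
        refine lintegral_mono fun h => ?_
        set G : Set (Euc N) := B ∩ (fun y => y + h) ⁻¹' B with hG
        have hGo : IsOpen G := isOpen_ball.inter (isOpen_ball.preimage (by fun_prop))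
        have e : ∫⁻ y, k y h = dq f h G := by
          rw [dq, ← lintegral_indicator hGo.measurableSet]
          congr 1; ext y
          by_cases h1 : y ∈ B <;> by_cases h2 : y + h ∈ B <;> simp [hk, hG, h1, h2]
        rw [e]
        by_cases hh : h ∈ ball (0 : Euc N) (2 * r)
        · rw [indicator_of_mem hh]
          refine (dq_le_variation hf (indicator_abs_le E) (W := B) hGo ?_ h ?_).trans ?_
          · exact measure_ne_top_of_subset inter_subset_left measure_ball_lt_top.ne
          · intro y hy t ht
            have := (convex_ball x r) hy.1 hy.2 (by linarith [ht.2] : 0 ≤ 1 - t) ht.1 (by ring)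
            convert this using 1
            module
          · gcongr
            rw [← ofReal_norm]
            exact ENNReal.ofReal_le_ofReal (by simpa using (mem_ball_zero_iff.1 hh).le)
        · have : G = ∅ := by
            rw [eq_empty_iff_forall_notMem]
            intro y hy
            apply hh
            exact mem_ball_of_mem hy.1 hy.2
          simp [this, dq]
    _ = _ := by
        rw [lintegral_indicator measurableSet_ball, setLIntegral_const, mul_comm]

lemma dq_ind {A : Set (Euc N)} (hA : MeasurableSet A) (h : Euc N) (G : Set (Euc N)) :
    dq (A.indicator 1) h G = volume ({x | ¬ (x + h ∈ A ↔ x ∈ A)} ∩ G) := by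
  classical
  have hA' : MeasurableSet {x | x + h ∈ A} := measurable_add_const h hA
  have hm : MeasurableSet {x | ¬ (x + h ∈ A ↔ x ∈ A)} :=
    (MeasurableSet.iff hA' hA).compl
  rw [← Measure.restrict_apply hm, ← lintegral_indicator_one hm, dq]
  congr 1; ext x
  rw [enorm_ind_sub]
  by_cases hx : (x + h ∈ A ↔ x ∈ A) <;> simp [hx]

lemma pow_aux (n : ℕ) {τ : ℝ} (h0 : 0 ≤ τ) (h1 : τ ≤ 1) : (1 + τ) ^ n ≤ 1 + (2 ^ n - 1) * τ := by
  induction n with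
  | zero => simp
  | succ n ih =>
    have h2 : (1 : ℝ) ≤ 2 ^ n := one_le_pow₀ (by norm_num)
    calc (1 + τ) ^ (n + 1) = (1 + τ) ^ n * (1 + τ) := pow_succ _ _
      _ ≤ (1 + (2 ^ n - 1) * τ) * (1 + τ) := by gcongr
      _ ≤ 1 + (2 ^ (n + 1) - 1) * τ := by
        rw [pow_succ]
        nlinarith [mul_nonneg (sub_nonneg.2 h2) (mul_nonneg h0 (sub_nonneg.2 h1))]

lemma ball_shell (x : Euc N) {ρ s : ℝ} (hρ : 0 < ρ) (hs : 0 ≤ s) (hsρ : s ≤ ρ) :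
    volume (ball x (ρ + s) \ ball x ρ) ≤
      2 ^ N * (ENNReal.ofReal s * (volume (ball x ρ) / ENNReal.ofReal ρ)) := by
  rw [measure_sdiff (ball_subset_ball (by linarith)) measurableSet_ball.nullMeasurableSet
    measure_ball_lt_top.ne]
  rw [Measure.addHaar_ball_of_pos _ x hρ, Measure.addHaar_ball_of_pos _ x (by linarith : 0 < ρ + s)]
  set ω := volume (ball (0 : Euc N) 1)
  have hω : ω ≠ ⊤ := measure_ball_lt_top.ne
  simp only [finrank_euclideanSpace, Fintype.card_fin]
  rw [← ENNReal.sub_mul (fun _ _ => hω), ← ENNReal.ofReal_sub _ (by positivity)]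
  have e : 2 ^ N * (ENNReal.ofReal s * (ENNReal.ofReal (ρ ^ N) * ω / ENNReal.ofReal ρ))
      = ENNReal.ofReal (2 ^ N * (s / ρ) * ρ ^ N) * ω := by
    rw [ENNReal.ofReal_mul (by positivity), ENNReal.ofReal_mul (by positivity),
      ENNReal.ofReal_div_of_pos hρ, ENNReal.ofReal_pow (p := 2) (by norm_num)]
    simp only [ENNReal.ofReal_ofNat, div_eq_mul_inv]
    ring
  rw [e]
  gcongr
  have h1 := pow_aux N (div_nonneg hs hρ.le) ((div_le_one hρ).2 hsρ)
  have h2 : (ρ + s) ^ N = (1 + s / ρ) ^ N * ρ ^ N := by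
    rw [← mul_pow]; congr 1; field_simp
  rw [h2]
  have h3 : 0 ≤ s / ρ := div_nonneg hs hρ.le
  have h4 : (0 : ℝ) ≤ ρ ^ N := by positivity
  nlinarith [mul_nonneg h3 h4, mul_le_mul_of_nonneg_right h1 h4]

lemma dq_ball (x : Euc N) {ρ : ℝ} (hρ : 0 < ρ) (h : Euc N) :
    dq ((ball x ρ).indicator 1) h univ ≤
      2 * 2 ^ N * (volume (ball x ρ) / ENNReal.ofReal ρ) * ‖h‖ₑ := by
  rw [dq_ind measurableSet_ball, inter_univ]
  obtain ⟨R, hR1, hR2⟩ : ∃ R : Set (Euc N), ({y | ¬ (y + h ∈ ball x ρ ↔ y ∈ ball x ρ)} ⊆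
      R ∪ (fun y => y + h) ⁻¹' R) ∧
      volume R ≤ 2 ^ N * (‖h‖ₑ * (volume (ball x ρ) / ENNReal.ofReal ρ)) := by
    rcases le_total ‖h‖ ρ with hle | hle
    · refine ⟨ball x (ρ + ‖h‖) \ ball x ρ, ?_, ?_⟩
      · intro y hy
        by_cases h1 : y ∈ ball x ρ
        · right
          have h2 : y + h ∉ ball x ρ := fun h2 => hy (by simp only [h1, h2])
          refine ⟨?_, h2⟩
          rw [mem_ball_iff_norm] at h1 ⊢
          calc ‖y + h - x‖ = ‖(y - x) + h‖ := by congr 1; abel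
            _ ≤ ‖y - x‖ + ‖h‖ := norm_add_le _ _
            _ < ρ + ‖h‖ := by linarith
        · left
          have h2 : y + h ∈ ball x ρ := by
            by_contra h2; exact hy (by simp only [h1, h2])
          refine ⟨?_, h1⟩
          rw [mem_ball_iff_norm] at h2 ⊢
          calc ‖y - x‖ = ‖(y + h - x) - h‖ := by congr 1; abel
            _ ≤ ‖y + h - x‖ + ‖h‖ := norm_sub_le _ _
            _ < ρ + ‖h‖ := by linarith
      · have := ball_shell x hρ (norm_nonneg h) hle
        rwa [ofReal_norm] at this
    · refine ⟨ball x ρ, ?_, ?_⟩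
      · intro y hy
        by_cases h1 : y ∈ ball x ρ
        · exact Or.inl h1
        · right
          by_contra h2; exact hy (by simp only [h1, show y + h ∉ ball x ρ from h2])
      · calc volume (ball x ρ) = 1 * (ENNReal.ofReal ρ * (volume (ball x ρ) / ENNReal.ofReal ρ)) := by
              rw [one_mul, ENNReal.mul_div_cancel (by simpa using hρ) ENNReal.ofReal_ne_top]
          _ ≤ _ := by
              gcongr
              · exact one_le_pow₀ (by norm_num)
              · rw [← ofReal_norm]; exact ENNReal.ofReal_le_ofReal hle
  calc _ ≤ volume (R ∪ (fun y => y + h) ⁻¹' R) := measure_mono hR1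
    _ ≤ volume R + volume ((fun y => y + h) ⁻¹' R) := measure_union_le _ _
    _ = 2 * volume R := by rw [measure_preimage_add_right, two_mul]
    _ ≤ 2 * (2 ^ N * (‖h‖ₑ * (volume (ball x ρ) / ENNReal.ofReal ρ))) := by gcongr
    _ = _ := by ring

/-! ### Local estimates and the first implication -/

lemma exists_open_between {Ω Ω' : Set (Euc N)} (hΩ : IsOpen Ω) (hc : IsCompact (closure Ω'))
    (hs : closure Ω' ⊆ Ω) :
    ∃ W : Set (Euc N), IsOpen W ∧ IsCompact (closure W) ∧ closure W ⊆ Ω ∧ closure Ω' ⊆ W ∧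
      ∃ δ > 0, ∀ h : Euc N, ‖h‖ < δ → ∀ x ∈ Ω', ∀ t ∈ Icc (0 : ℝ) 1, x + t • h ∈ W := by
  obtain ⟨L, hL, hKL, hLO⟩ := exists_compact_between hc hΩ hs
  have hcl : closure (interior L) ⊆ L := closure_minimal interior_subset hL.isClosed
  obtain ⟨δ, hδ, hδs⟩ := hc.exists_thickening_subset_open isOpen_interior hKL
  refine ⟨interior L, isOpen_interior, hL.of_isClosed_subset isClosed_closure hcl,
    hcl.trans hLO, hKL, δ, hδ, ?_⟩
  intro h hh x hx t ht
  refine hδs (mem_thickening_iff.2 ⟨x, subset_closure hx, ?_⟩)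
  rw [dist_eq_norm, add_sub_cancel_left, norm_smul, Real.norm_eq_abs, abs_of_nonneg ht.1]
  nlinarith [ht.2, norm_nonneg h]

lemma volume_ne_top_of_closure {Ω' : Set (Euc N)} (hc : IsCompact (closure Ω')) :
    volume Ω' ≠ ⊤ :=
  measure_ne_top_of_subset subset_closure hc.measure_lt_top.ne

lemma exists_dq_le {f : Euc N → ℝ} (hf : Measurable f) {M : ℝ} (hM : ∀ x, |f x| ≤ M)
    {Ω Ω' : Set (Euc N)} (hΩ : IsOpen Ω)
    (hV : ∀ W : Set (Euc N), IsOpen W → IsCompact (closure W) → closure W ⊆ Ω → variation f W < ⊤)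
    (ho : IsOpen Ω') (hc : IsCompact (closure Ω')) (hs : closure Ω' ⊆ Ω) :
    ∃ δ > 0, ∃ c : ℝ≥0∞, c ≠ ⊤ ∧ ∀ h : Euc N, ‖h‖ < δ → dq f h Ω' ≤ c * ‖h‖ₑ := by
  obtain ⟨W, hW, hWc, hWs, -, δ, hδ, hδs⟩ := exists_open_between hΩ hc hs
  refine ⟨δ, hδ, variation f W, (hV W hW hWc hWs).ne, fun h hh => ?_⟩
  rw [mul_comm]
  exact dq_le_variation hf hM ho (volume_ne_top_of_closure hc) h (hδs h hh)

lemma mul_enorm_single (n : ℕ) (i : Fin N) :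
    ((n : ℝ≥0∞) + 1) * ‖((n : ℝ) + 1)⁻¹ • (EuclideanSpace.single i (1 : ℝ) : Euc N)‖ₑ = 1 := by
  have hn : (0 : ℝ) < (n : ℝ) + 1 := by positivity
  rw [← ofReal_norm, norm_smul]
  simp only [EuclideanSpace.norm_single, norm_one, mul_one]
  rw [norm_inv, Real.norm_of_nonneg hn.le, ENNReal.ofReal_inv_of_pos hn]
  have : ENNReal.ofReal ((n : ℝ) + 1) = (n : ℝ≥0∞) + 1 := by
    rw [ENNReal.ofReal_add (by positivity) zero_le_one]; simp
  rw [this]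
  exact ENNReal.mul_inv_cancel (by simp) (by simp)

lemma eventually_norm_lt {δ : ℝ} (hδ : 0 < δ) :
    ∀ᶠ n : ℕ in atTop, ∀ i : Fin N,
      ‖((n : ℝ) + 1)⁻¹ • (EuclideanSpace.single i (1 : ℝ) : Euc N)‖ < δ := by
  have h := (tendsto_one_div_add_atTop_nhds_zero_nat (𝕜 := ℝ)).eventually (gt_mem_nhds hδ)
  filter_upwards [h] with n hn i
  have hn0 : (0 : ℝ) < (n : ℝ) + 1 := by positivity
  rw [norm_smul]
  simp only [EuclideanSpace.norm_single, norm_one, mul_one]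
  rw [norm_inv, Real.norm_of_nonneg hn0.le]
  simpa using hn

lemma variation_lt_top_of_dq {f : Euc N → ℝ} (hf : Measurable f) {M : ℝ} (hM : ∀ x, |f x| ≤ M)
    {W : Set (Euc N)} {δ : ℝ} (hδ : 0 < δ) {c : ℝ≥0∞} (hc : c ≠ ⊤)
    (h : ∀ h : Euc N, ‖h‖ < δ → dq f h W ≤ c * ‖h‖ₑ) : variation f W < ⊤ := by
  refine (variation_le_liminf hf hM).trans_lt ?_
  refine lt_of_le_of_lt (b := (N : ℝ≥0∞) * c) ?_ (ENNReal.mul_lt_top (by simp) hc.lt_top)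
  refine liminf_le_of_frequently_le' (Eventually.frequently ?_)
  filter_upwards [eventually_norm_lt hδ] with n hn
  calc _ ≤ ∑ i : Fin N, c := by
        refine Finset.sum_le_sum fun i _ => ?_
        calc _ ≤ ((n : ℝ≥0∞) + 1) *
              (c * ‖((n : ℝ) + 1)⁻¹ • (EuclideanSpace.single i (1 : ℝ) : Euc N)‖ₑ) := by
              gcongr
              exact h _ (hn i)
          _ = c * (((n : ℝ≥0∞) + 1) *
              ‖((n : ℝ) + 1)⁻¹ • (EuclideanSpace.single i (1 : ℝ) : Euc N)‖ₑ) := by ring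
          _ = c := by rw [mul_enorm_single, mul_one]
    _ = _ := by simp

lemma hasDensity_zero_of_null {A : Set (Euc N)} {x : Euc N} {ρ₀ : ℝ} (hρ₀ : 0 < ρ₀)
    (h : volume (A ∩ ball x ρ₀) = 0) : HasDensity A x 0 := by
  unfold HasDensity
  rw [ENNReal.ofReal_zero]
  refine tendsto_const_nhds.congr' ?_
  filter_upwards [Ioo_mem_nhdsGT hρ₀] with ρ hρ
  have : volume (A ∩ ball x ρ) = 0 :=
    measure_mono_null (inter_subset_inter_right _ (ball_subset_ball hρ.2.le)) h
  simp [this]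

/-- If a set and its complement (near `x`) both had density zero we would have a contradiction. -/
lemma not_hasDensity_zero {A B : Set (Euc N)} {x : Euc N} {ρ₀ : ℝ} (hρ₀ : 0 < ρ₀)
    (hAB : ball x ρ₀ ⊆ A ∪ B) (hA : HasDensity A x 0) (hB : HasDensity B x 0) : False := by
  unfold HasDensity at hA hB
  rw [ENNReal.ofReal_zero] at hA hB
  have h := hA.add hB
  rw [add_zero] at h
  have h1 : ∀ᶠ ρ : ℝ in 𝓝[>] 0, (1 : ℝ≥0∞) ≤
      volume (A ∩ ball x ρ) / volume (ball x ρ) + volume (B ∩ ball x ρ) / volume (ball x ρ) := by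
    filter_upwards [Ioo_mem_nhdsGT hρ₀] with ρ hρ
    rw [← ENNReal.add_div]
    have hpos : volume (ball x ρ) ≠ 0 := (measure_ball_pos _ _ hρ.1).ne'
    rw [ENNReal.le_div_iff_mul_le (Or.inl hpos) (Or.inl measure_ball_lt_top.ne), one_mul]
    refine le_trans (measure_mono ?_) (measure_union_le _ _)
    intro y hy
    rcases hAB (ball_subset_ball hρ.2.le hy) with h | h
    · exact Or.inl ⟨h, hy⟩
    · exact Or.inr ⟨h, hy⟩
  have := ge_of_tendsto h h1
  simp at this

lemma gbvPolar_of_open {Ω : Set (Euc N)} (hΩ : IsOpen Ω) {C : Set (Euc N)} (hC : C ⊆ Ω)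
    {U : ℕ → Set (Euc N)}
    (hU : ∀ k, IsOpen (U k) ∧ U k ⊆ Ω ∧ C ⊆ U k ∧ HasLocFinPerimeter (U k) Ω)
    (hlim : Tendsto (fun k => volume (U k)) atTop (𝓝 0)) : GBVPolar C Ω := by
  classical
  set Z : Set (Euc N) := ⋂ k, U k with hZ
  have hUm : ∀ k, MeasurableSet (U k) := fun k => (hU k).1.measurableSet
  have hZm : MeasurableSet Z := MeasurableSet.iInter hUm
  have hZ0 : volume Z = 0 := by
    have : volume Z ≤ 0 := ge_of_tendsto' hlim fun k => measure_mono (iInter_subset _ k)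
    simpa using this
  have hp : ∀ x, ∃ k, x ∉ U k ∨ x ∈ Z := by
    intro x
    by_cases hx : x ∈ Z
    · exact ⟨0, Or.inr hx⟩
    · rw [hZ, mem_iInter, not_forall] at hx
      obtain ⟨k, hk⟩ := hx
      exact ⟨k, Or.inl hk⟩
  set v : Euc N → ℕ := fun x => Nat.find (hp x) with hv
  have hvm : Measurable v :=
    measurable_find hp (fun k => (hUm k).compl.union hZm)
  set u : Euc N → ℝ := fun x => (v x : ℝ) with hu
  have hum : Measurable u := measurable_from_nat.comp hvm
  have hvge : ∀ x ∉ Z, ∀ k, (∀ j < k, x ∈ U j) → k ≤ v x := by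
    intro x hx k hk
    by_contra hlt
    push Not at hlt
    rcases Nat.find_spec (hp x) with h | h
    · exact h (hk _ hlt)
    · exact hx h
  have hveq : ∀ x ∉ Z, ∀ y ∉ Z, ∀ M : ℕ, (∀ j < M, (x ∈ U j ↔ y ∈ U j)) → v x < M → v y = v x := by
    intro x hx y hy M hM hlt
    have h1 : ∀ j < v x, x ∈ U j := fun j hj => by
      have := Nat.find_min (hp x) hj
      by_contra h; exact this (Or.inl h)
    have h2 : x ∉ U (v x) := (Nat.find_spec (hp x)).resolve_right hx
    apply le_antisymm
    · exact Nat.find_min' (hp y) (Or.inl fun h => h2 ((hM _ hlt).2 h))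
    · exact hvge y hy _ fun j hj => (hM j (hj.trans hlt)).1 (h1 j hj)
  refine ⟨u, ⟨hum.aemeasurable, ?_⟩, ?_⟩
  · intro m hm Ω' ho hc hs
    set T : Euc N → ℝ := fun x => max (-m) (min (u x) m) with hT
    have hTm : Measurable T := measurable_const.max (hum.min measurable_const)
    have hTb : ∀ x, |T x| ≤ m := fun x => abs_le.2 ⟨le_max_left _ _,
      max_le (by linarith) (min_le_right _ _)⟩
    refine ⟨Measure.integrableOn_of_bounded (volume_ne_top_of_closure hc)
      hTm.aestronglyMeasurable (M := m) (Eventually.of_forall fun x => by simpa using hTb x), ?_⟩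
    have hloc := fun k => exists_dq_le (measurable_ind (hUm k)) (indicator_abs_le (U k)) hΩ
      (fun W h1 h2 h3 => by rw [← perimeter_eq (hUm k)]; exact (hU k).2.2.2 W h1 h2 h3) ho hc hs
    choose δ hδ c hcf hdq using hloc
    obtain ⟨M, hM⟩ := exists_nat_ge m
    obtain ⟨δ₀, hδ₀, hδle⟩ : ∃ δ₀ > 0, ∀ j < M, δ₀ ≤ δ j := by
      clear hM
      induction M with
      | zero => exact ⟨1, one_pos, by simp⟩
      | succ M ih =>
        obtain ⟨d, hd, hdl⟩ := ih
        refine ⟨min d (δ M), lt_min hd (hδ M), fun j hj => ?_⟩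
        rcases Nat.lt_succ_iff_lt_or_eq.1 hj with h | h
        · exact (min_le_left _ _).trans (hdl j h)
        · rw [h]; exact min_le_right _ _
    refine variation_lt_top_of_dq hTm hTb hδ₀
      (c := ENNReal.ofReal (2 * m) * ∑ j ∈ Finset.range M, c j) ?_ ?_
    · exact ENNReal.mul_ne_top ENNReal.ofReal_ne_top (ENNReal.sum_ne_top.2 fun j _ => hcf j)
    · intro h hh
      have hae1 : ∀ᵐ x : Euc N, x ∉ Z := measure_eq_zero_iff_ae_notMem.1 hZ0
      have hae2 : ∀ᵐ x : Euc N, x + h ∉ Z := by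
        have h0 : volume ((fun x => x + h) ⁻¹' Z) = 0 := by
          rw [measure_preimage_add_right]; exact hZ0
        exact measure_eq_zero_iff_ae_notMem.1 h0
      have hpt : ∀ᵐ x : Euc N, ‖T (x + h) - T x‖ₑ ≤ ENNReal.ofReal (2 * m) *
          ∑ j ∈ Finset.range M, ‖(U j).indicator (1 : Euc N → ℝ) (x + h)
            - (U j).indicator (1 : Euc N → ℝ) x‖ₑ := by
        filter_upwards [hae1, hae2] with x hx hxh
        by_cases hag : ∀ j < M, (x + h ∈ U j ↔ x ∈ U j)
        · have : T (x + h) = T x := by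
            by_cases h1 : v (x + h) < M
            · simp only [hT, hu, hveq _ hxh _ hx M hag h1]
            · by_cases h2 : v x < M
              · simp only [hT, hu, hveq _ hx _ hxh M (fun j hj => (hag j hj).symm) h2]
              · push Not at h1 h2
                have h1' : m ≤ u (x + h) := hM.trans (Nat.cast_le.2 h1)
                have h2' : m ≤ u x := hM.trans (Nat.cast_le.2 h2)
                simp only [hT, min_eq_right h1', min_eq_right h2']
          simp [this]
        · push Not at hag
          obtain ⟨j, hj, hne⟩ := hag
          have hne' : ¬ (x + h ∈ U j ↔ x ∈ U j) := by tauto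
          calc ‖T (x + h) - T x‖ₑ ≤ ENNReal.ofReal (2 * m) := by
                rw [← ofReal_norm]
                refine ENNReal.ofReal_le_ofReal ?_
                have := (abs_sub (T (x + h)) (T x)).trans (add_le_add (hTb (x + h)) (hTb x))
                rw [Real.norm_eq_abs]; linarith
            _ = ENNReal.ofReal (2 * m) * ‖(U j).indicator (1 : Euc N → ℝ) (x + h)
                  - (U j).indicator (1 : Euc N → ℝ) x‖ₑ := by
                rw [enorm_ind_sub, if_neg hne', mul_one]
            _ ≤ _ := by
                gcongr
                exact Finset.single_le_sum
                  (f := fun j => ‖(U j).indicator (1 : Euc N → ℝ) (x + h)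
                    - (U j).indicator (1 : Euc N → ℝ) x‖ₑ) (fun _ _ => zero_le)
                  (Finset.mem_range.2 hj)
      have hmeas : ∀ j, Measurable fun x => ‖(U j).indicator (1 : Euc N → ℝ) (x + h)
                    - (U j).indicator (1 : Euc N → ℝ) x‖ₑ := fun j =>
        (((measurable_ind (hUm j)).comp (measurable_add_const h)).sub (measurable_ind (hUm j))).enorm
      calc dq T h Ω' ≤ ∫⁻ x in Ω', ENNReal.ofReal (2 * m) *
          ∑ j ∈ Finset.range M, ‖(U j).indicator (1 : Euc N → ℝ) (x + h)
            - (U j).indicator (1 : Euc N → ℝ) x‖ₑ :=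
            lintegral_mono_ae (ae_restrict_of_ae hpt)
        _ = ENNReal.ofReal (2 * m) * ∑ j ∈ Finset.range M, dq ((U j).indicator 1) h Ω' := by
            rw [lintegral_const_mul _ (Finset.measurable_fun_sum _ fun j _ => hmeas j),
              lintegral_finsetSum _ fun j _ => hmeas j]
            rfl
        _ ≤ ENNReal.ofReal (2 * m) * ∑ j ∈ Finset.range M, c j * ‖h‖ₑ := by
            gcongr with j hj
            exact hdq j h (hh.trans_le (hδle j (Finset.mem_range.1 hj)))
        _ = _ := by rw [← Finset.sum_mul, mul_assoc]
  · intro x hx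
    refine ⟨hC hx, Or.inl ?_⟩
    have hnull : ∀ s : ℝ, ∃ ρ > 0, ball x ρ ⊆ Ω ∧ volume ({y | y ∈ Ω ∧ u y < s} ∩ ball x ρ) = 0 := by
      intro s
      obtain ⟨k, hk⟩ := exists_nat_ge s
      have hopen : IsOpen (Ω ∩ ⋂ j ∈ Finset.range k, U j) :=
        hΩ.inter (isOpen_biInter_finset fun j _ => (hU j).1)
      have hmem : x ∈ Ω ∩ ⋂ j ∈ Finset.range k, U j :=
        ⟨hC hx, mem_iInter₂.2 fun j _ => (hU j).2.2.1 hx⟩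
      obtain ⟨ρ, hρ, hb⟩ := Metric.isOpen_iff.1 hopen x hmem
      refine ⟨ρ, hρ, hb.trans inter_subset_left, measure_mono_null ?_ hZ0⟩
      intro y hy
      by_contra hyZ
      have h1 : k ≤ v y := hvge y hyZ k fun j hj =>
        mem_iInter₂.1 (hb hy.2).2 j (Finset.mem_range.2 hj)
      have h2 : s ≤ u y := hk.trans (Nat.cast_le.2 h1)
      exact absurd hy.1.2 (not_lt.2 h2)
    have hd : ∀ s : ℝ, HasDensity {y | y ∈ Ω ∧ u y < s} x 0 := by
      intro s
      obtain ⟨ρ, hρ, -, h0⟩ := hnull s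
      exact hasDensity_zero_of_null hρ h0
    constructor
    · unfold approxUpper
      rw [sInf_eq_top]
      rintro t ⟨s, -, hs⟩
      exfalso
      obtain ⟨ρ, hρ, hb, -⟩ := hnull s
      refine not_hasDensity_zero hρ ?_ hs (hd (s + 1))
      intro y hy
      by_cases h : s < u y
      · exact Or.inl ⟨hb hy, h⟩
      · exact Or.inr ⟨hb hy, by linarith⟩
    · unfold approxLower
      rw [EReal.eq_top_iff_forall_lt]
      intro s
      refine lt_of_lt_of_le (b := ((s + 1 : ℝ) : EReal)) ?_ (le_sSup ⟨s + 1, rfl, hd (s + 1)⟩)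
      exact_mod_cast lt_add_one s

/-! ### A weak form of the coarea formula -/

lemma coarea_aux {w : Euc N → ℝ} (hw : Measurable w) (h : Euc N) :
    Measurable (fun p : ℝ × Euc N => ‖{x | p.1 < |w x|}.indicator (1 : Euc N → ℝ) (p.2 + h)
      - {x | p.1 < |w x|}.indicator (1 : Euc N → ℝ) p.2‖ₑ) := by
  have h1 : Measurable (fun p : ℝ × Euc N => {x | p.1 < |w x|}.indicator (1 : Euc N → ℝ) p.2) := by
    have : MeasurableSet {p : ℝ × Euc N | p.1 < |w p.2|} :=
      measurableSet_lt measurable_fst (hw.comp measurable_snd).abs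
    have h0 : Measurable ({p : ℝ × Euc N | p.1 < |w p.2|}.indicator (fun _ => (1 : ℝ))) :=
      measurable_const.indicator this
    convert h0 using 1
    ext p
    by_cases hp : p.1 < |w p.2|
    · rw [indicator_of_mem (show p.2 ∈ {x | p.1 < |w x|} from hp),
        indicator_of_mem (show p ∈ {p : ℝ × Euc N | p.1 < |w p.2|} from hp)]
      rfl
    · rw [indicator_of_notMem (show p.2 ∉ {x | p.1 < |w x|} from hp),
        indicator_of_notMem (show p ∉ {p : ℝ × Euc N | p.1 < |w p.2|} from hp)]
  have h2 : Measurable (fun p : ℝ × Euc N => (p.1, p.2 + h)) :=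
    measurable_fst.prodMk (measurable_snd.add_const h)
  exact ((h1.comp h2).sub h1).enorm

lemma coarea_dq {w : Euc N → ℝ} (hw : Measurable w) (h : Euc N) (O : Set (Euc N)) (S : Set ℝ) :
    ∫⁻ t in S, dq ({x | t < |w x|}.indicator 1) h O ≤ dq w h O := by
  unfold dq
  rw [lintegral_lintegral_swap (coarea_aux hw h).aemeasurable]
  refine lintegral_mono fun x => ?_
  calc _ ≤ ∫⁻ t, ‖{x | t < |w x|}.indicator (1 : Euc N → ℝ) (x + h)
      - {x | t < |w x|}.indicator (1 : Euc N → ℝ) x‖ₑ := setLIntegral_le_lintegral _ _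
    _ ≤ ∫⁻ t, (Ico (min |w (x + h)| |w x|) (max |w (x + h)| |w x|)).indicator 1 t := by
        refine lintegral_mono fun t => ?_
        rw [enorm_ind_sub]
        split_ifs with hc
        · exact zero_le
        · rw [indicator_of_mem]
          · rfl
          · replace hc : ¬ (t < |w (x + h)| ↔ t < |w x|) := hc
            rw [mem_Ico, min_le_iff, lt_max_iff]
            rcases lt_or_ge t |w (x + h)| with h1 | h1 <;> rcases lt_or_ge t |w x| with h2 | h2
            · exact absurd (iff_of_true h1 h2) hc
            · exact ⟨Or.inr h2, Or.inl h1⟩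
            · exact ⟨Or.inl h1, Or.inr h2⟩
            · exact absurd (iff_of_false h1.not_gt h2.not_gt) hc
    _ = ENNReal.ofReal (max |w (x + h)| |w x| - min |w (x + h)| |w x|) := by
        rw [lintegral_indicator_one measurableSet_Ico, Real.volume_Ico]
    _ ≤ _ := by
        rw [← ofReal_norm]
        refine ENNReal.ofReal_le_ofReal ?_
        rw [max_sub_min_eq_abs, Real.norm_eq_abs, abs_sub_comm]
        exact abs_abs_sub_abs_le_abs_sub _ _

lemma coarea {v : Euc N → ℝ} (hv : Measurable v) {Ω O : Set (Euc N)} (hΩ : IsOpen Ω)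
    (hV : ∀ m : ℝ, 0 < m → ∀ W : Set (Euc N), IsOpen W → IsCompact (closure W) → closure W ⊆ Ω →
      variation (fun x => max (-m) (min (v x) m)) W < ⊤)
    (ho : IsOpen O) (hc : IsCompact (closure O)) (hs : closure O ⊆ Ω) {T : ℝ} (hT : 0 < T) :
    ∃ t, T < t ∧ perimeter {x | t < |v x|} O < ⊤ := by
  set m := T + 1 with hm
  have hm0 : 0 < m := by linarith
  set w : Euc N → ℝ := fun x => max (-m) (min (v x) m) with hwdef
  have hw : Measurable w := measurable_const.max (hv.min measurable_const)
  have hwb : ∀ x, |w x| ≤ m := fun x => abs_le.2 ⟨le_max_left _ _,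
      max_le (by linarith) (min_le_right _ _)⟩
  obtain ⟨δ, hδ, c, hcf, hdq⟩ := exists_dq_le hw hwb hΩ (hV m hm0) ho hc hs
  set e : ℕ → Fin N → Euc N := fun n i => ((n : ℝ) + 1)⁻¹ • EuclideanSpace.single i (1 : ℝ) with he
  set F : ℕ → ℝ → ℝ≥0∞ := fun n t => ∑ i : Fin N, ((n : ℝ≥0∞) + 1) *
    dq ({x | t < |w x|}.indicator 1) (e n i) O with hF
  have hdm : ∀ h, Measurable (fun t => dq ({x | t < |w x|}.indicator 1) h O) := fun h =>
    (coarea_aux hw h).lintegral_prod_right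
  have hFm : ∀ n, Measurable (F n) := fun n =>
    Finset.measurable_fun_sum _ fun i _ => (hdm _).const_mul _
  have hFint : ∫⁻ t in Ioo T m, liminf (fun n => F n t) atTop ≤ N * c := by
    refine (lintegral_liminf_le hFm).trans ?_
    refine liminf_le_of_frequently_le' (Eventually.frequently ?_)
    filter_upwards [eventually_norm_lt hδ] with n hn
    calc _ = ∑ i : Fin N, ((n : ℝ≥0∞) + 1) *
          ∫⁻ t in Ioo T m, dq ({x | t < |w x|}.indicator 1) (e n i) O := by
          simp only [hF]
          rw [lintegral_finsetSum _ fun i _ => (hdm _).const_mul _]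
          refine Finset.sum_congr rfl fun i _ => ?_
          rw [lintegral_const_mul _ (hdm _)]
      _ ≤ ∑ i : Fin N, c := by
          refine Finset.sum_le_sum fun i _ => ?_
          calc _ ≤ ((n : ℝ≥0∞) + 1) * (c * ‖e n i‖ₑ) := by
                gcongr
                exact (coarea_dq hw _ _ _).trans (hdq _ (hn i))
            _ = c * (((n : ℝ≥0∞) + 1) * ‖e n i‖ₑ) := by ring
            _ = c := by rw [he, mul_enorm_single, mul_one]
      _ = _ := by simp
  have hfin : ∀ᵐ t ∂(volume.restrict (Ioo T m)), liminf (fun n => F n t) atTop < ⊤ :=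
    ae_lt_top (Measurable.liminf hFm)
      (hFint.trans_lt (ENNReal.mul_lt_top (by simp) hcf.lt_top)).ne
  have hne : (ae (volume.restrict (Ioo T m))).NeBot := by
    rw [ae_neBot, Ne, Measure.restrict_eq_zero, Real.volume_Ioo]
    simp [hm]
  obtain ⟨t, ht, htm⟩ := (hfin.and (ae_restrict_mem measurableSet_Ioo)).exists
  refine ⟨t, htm.1, ?_⟩
  have hset : {x | t < |v x|} = {x | t < |w x|} := by
    ext x
    simp only [mem_ofPred_eq, hwdef, lt_abs]
    have h1 := htm.1
    have h2 := htm.2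
    constructor
    · rintro (h | h)
      · left; exact lt_max_of_lt_right (lt_min h h2)
      · right
        have : max (-m) (min (v x) m) < -t := max_lt (by linarith) (min_lt_of_left_lt (by linarith))
        linarith
    · rintro (h | h)
      · left
        rcases lt_max_iff.1 h with h | h
        · linarith
        · exact (lt_min_iff.1 h).1
      · right
        have : max (-m) (min (v x) m) < -t := by linarith
        rcases min_lt_iff.1 (max_lt_iff.1 this).2 with h | h <;> linarith
  have hEm : MeasurableSet {x | t < |w x|} := measurableSet_lt measurable_const hw.abs
  rw [hset, perimeter_eq hEm]
  exact (variation_le_liminf (measurable_ind hEm) (indicator_abs_le _)).trans_lt ht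

/-! ### The local covering argument -/

lemma volume_ball_smul (x : Euc N) {a r : ℝ} (ha : 0 < a) :
    volume (ball x (a * r)) = ENNReal.ofReal a ^ N * volume (ball x r) := by
  rw [Measure.addHaar_ball_mul_of_pos volume x ha r, Measure.addHaar_ball_center volume x r,
    finrank_euclideanSpace_fin, ENNReal.ofReal_pow ha.le]

lemma exists_radius {E : Set (Euc N)} {x : Euc N} {r₀ : ℝ} (hr₀ : 0 < r₀)
    (h0 : 2 * volume (ball x r₀ ∩ E) ≤ volume (ball x r₀))
    (hE : MeasurableSet E)
    (hd : ∃ k : ℕ, volume (ball x (r₀ / 2 ^ k)) ≤ 2 * volume (ball x (r₀ / 2 ^ k) ∩ E)) :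
    ∃ r, 0 < r ∧ r ≤ r₀ ∧ volume (ball x r) ≤ 2 ^ (N + 1) * volume (ball x r ∩ E) ∧
      volume (ball x r) ≤ 2 * volume (ball x r \ E) := by
  classical
  have hcomp : ∀ r : ℝ, 2 * volume (ball x r ∩ E) ≤ volume (ball x r) →
      volume (ball x r) ≤ 2 * volume (ball x r \ E) := by
    intro r h
    have hfin : volume (ball x r ∩ E) ≠ ⊤ :=
      measure_ne_top_of_subset inter_subset_left measure_ball_lt_top.ne
    have hsum := measure_inter_add_sdiff (μ := volume) (ball x r) hE
    rw [← hsum, two_mul] at h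
    have h' := (ENNReal.add_le_add_iff_left hfin).1 h
    rw [← hsum, two_mul]
    gcongr
  have hk := Nat.find_spec hd
  have hmin := fun m (hm : m < Nat.find hd) => Nat.find_min hd hm
  generalize Nat.find hd = k at hk hmin
  cases k with
  | zero =>
    simp only [pow_zero, div_one] at hk
    refine ⟨r₀, hr₀, le_rfl, hk.trans ?_, hcomp _ h0⟩
    gcongr
    calc (2 : ℝ≥0∞) = 2 ^ 1 := (pow_one _).symm
      _ ≤ _ := pow_le_pow_right₀ one_le_two (by omega)
  | succ k =>
    have hlt := hmin k (Nat.lt_succ_self k)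
    push Not at hlt
    have hr : r₀ / 2 ^ k = 2 * (r₀ / 2 ^ (k + 1)) := by
      rw [pow_succ]; field_simp
    have hle : r₀ / 2 ^ (k + 1) ≤ r₀ / 2 ^ k := by
      rw [hr]; linarith [show (0:ℝ) < r₀ / 2 ^ (k + 1) by positivity]
    refine ⟨r₀ / 2 ^ k, by positivity, div_le_self hr₀.le (one_le_pow₀ one_le_two), ?_,
      hcomp _ hlt.le⟩
    calc volume (ball x (r₀ / 2 ^ k)) = 2 ^ N * volume (ball x (r₀ / 2 ^ (k + 1))) := by
          rw [hr, volume_ball_smul x two_pos]; simp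
      _ ≤ 2 ^ N * (2 * volume (ball x (r₀ / 2 ^ (k + 1)) ∩ E)) := by gcongr
      _ ≤ 2 ^ N * (2 * volume (ball x (r₀ / 2 ^ k) ∩ E)) := by
          gcongr
      _ = _ := by rw [pow_succ, mul_assoc]

lemma isoperimetric {E : Set (Euc N)} (hE : MeasurableSet E) {x : Euc N} {r : ℝ} (hr : 0 < r)
    (h1 : volume (ball x r) ≤ 2 ^ (N + 1) * volume (ball x r ∩ E))
    (h2 : volume (ball x r) ≤ 2 * volume (ball x r \ E)) :
    volume (ball x r) / ENNReal.ofReal r ≤ 2 ^ (2 * N + 3) * perimeter E (ball x r) := by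
  have hp := poincare hE x r hr
  have hpos : volume (ball x r) ≠ 0 := (measure_ball_pos _ _ hr).ne'
  have hfin : volume (ball x r) ≠ ⊤ := measure_ball_lt_top.ne
  have hr0 : ENNReal.ofReal r ≠ 0 := by simpa using hr
  rw [ENNReal.div_le_iff hr0 ENNReal.ofReal_ne_top]
  have hb : volume (ball (0 : Euc N) (2 * r)) = 2 ^ N * volume (ball x r) := by
    rw [volume_ball_smul 0 two_pos, Measure.addHaar_ball_center volume x r]; simp
  have key : volume (ball x r) * volume (ball x r) ≤
      volume (ball x r) * (2 ^ (2 * N + 3) * perimeter E (ball x r) * ENNReal.ofReal r) := by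
    calc _ ≤ (2 ^ (N + 1) * volume (ball x r ∩ E)) * (2 * volume (ball x r \ E)) :=
          mul_le_mul' h1 h2
      _ = 2 ^ (N + 1) * 2 * (volume (ball x r ∩ E) * volume (ball x r \ E)) := by ring
      _ ≤ 2 ^ (N + 1) * 2 * (volume (ball (0 : Euc N) (2 * r)) *
            (ENNReal.ofReal (2 * r) * perimeter E (ball x r))) := by gcongr
      _ = _ := by
          rw [hb, ENNReal.ofReal_mul two_pos.le, ENNReal.ofReal_ofNat]; ring
  exact (ENNReal.mul_le_mul_iff_right hpos hfin).1 key

lemma sum_perimeter_le {E O : Set (Euc N)} (hE : MeasurableSet E) {ι : Type*} {B : ι → Set (Euc N)}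
    (hB : Pairwise (Function.onFun Disjoint B)) (hBO : ∀ i, B i ⊆ O) :
    ∑' i, perimeter E (B i) ≤ perimeter E O := by
  classical
  rw [ENNReal.tsum_eq_iSup_sum]
  refine iSup_le fun s => ?_
  simp only [perimeter_eq hE]
  exact (sum_variation_le (measurable_ind hE) (indicator_abs_le E) s B
    (hB.set_pairwise _)).trans (variation_mono (iUnion₂_subset fun i _ => hBO i))

lemma dq_iUnion_le {ι : Type*} [Countable ι] {B : ι → Set (Euc N)} (hB : ∀ i, MeasurableSet (B i))
    (h : Euc N) (G : Set (Euc N)) :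
    dq ((⋃ i, B i).indicator 1) h G ≤ ∑' i, dq ((B i).indicator 1) h G := by
  rw [dq_ind (MeasurableSet.iUnion hB)]
  simp only [dq_ind (hB _)]
  refine le_trans (measure_mono ?_) (measure_iUnion_le _)
  rintro x ⟨hx, hxG⟩
  rw [mem_iUnion]
  by_contra hcon
  rw [not_exists] at hcon
  refine hx ?_
  have : ∀ i, (x + h ∈ B i ↔ x ∈ B i) := by
    intro i
    by_contra hc
    exact hcon i ⟨hc, hxG⟩
  simp only [mem_iUnion, this]

lemma covering {E O S : Set (Euc N)} (hE : MeasurableSet E) {r : Euc N → ℝ} {r₀ : ℝ}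
    (hr : ∀ x ∈ S, 0 < r x ∧ r x ≤ r₀) (hO : ∀ x ∈ S, ball x (6 * r x) ⊆ O)
    (h1 : ∀ x ∈ S, volume (ball x (r x)) ≤ 2 ^ (N + 1) * volume (ball x (r x) ∩ E))
    (h2 : ∀ x ∈ S, volume (ball x (r x)) ≤ 2 * volume (ball x (r x) \ E))
    (hP : perimeter E O < ⊤) :
    ∃ U : Set (Euc N), IsOpen U ∧ U ⊆ O ∧ S ⊆ U ∧
      volume U ≤ 6 ^ N * 2 ^ (N + 1) * volume (E ∩ O) ∧
      ∃ c : ℝ≥0∞, c ≠ ⊤ ∧ ∀ h, dq (U.indicator 1) h univ ≤ c * ‖h‖ₑ := by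
  obtain ⟨J, hJS, hJd, hJc⟩ := Vitali.exists_disjoint_subfamily_covering_enlargement_closedBall
    S id r r₀ (fun a ha => (hr a ha).2) 5 (by norm_num)
  simp only [id] at hJd hJc
  have hJd' : Pairwise (Function.onFun Disjoint fun j : J => ball (j : Euc N) (r j)) := by
    intro i j hij
    exact (hJd i.2 j.2 (fun h => hij (Subtype.ext h))).mono ball_subset_closedBall
      ball_subset_closedBall
  have hcount : Countable J := by
    refine (Set.PairwiseDisjoint.countable_of_isOpen (s := fun j => ball j (r j)) (a := J) ?_
      (fun _ _ => isOpen_ball) ?_).to_subtype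
    · intro i hi j hj hij
      exact (hJd hi hj hij).mono ball_subset_closedBall ball_subset_closedBall
    · intro i hi
      exact nonempty_ball.2 (hr i (hJS hi)).1
  have hsub : ∀ j : J, ball (j : Euc N) (r j) ⊆ O := fun j =>
    (ball_subset_ball (by linarith [(hr j (hJS j.2)).1])).trans (hO j (hJS j.2))
  refine ⟨⋃ j : J, ball (j : Euc N) (6 * r j), isOpen_iUnion fun j => isOpen_ball,
    iUnion_subset fun j => hO j (hJS j.2), ?_, ?_,
    2 * 2 ^ N * (6 ^ N * (2 ^ (2 * N + 3) * perimeter E O)), ?_, ?_⟩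
  · intro x hx
    obtain ⟨b, hb, hsubb⟩ := hJc x hx
    refine mem_iUnion.2 ⟨⟨b, hb⟩, ?_⟩
    have hrb := (hr b (hJS hb)).1
    have : x ∈ closedBall b (5 * r b) := hsubb (mem_closedBall_self (hr x hx).1.le)
    exact closedBall_subset_ball (by linarith) this
  · calc _ ≤ ∑' j : J, volume (ball (j : Euc N) (6 * r j)) := measure_iUnion_le _
      _ ≤ ∑' j : J, 6 ^ N * 2 ^ (N + 1) * volume (ball (j : Euc N) (r j) ∩ E) := by
          refine ENNReal.tsum_le_tsum fun j => ?_
          rw [volume_ball_smul _ (by norm_num), mul_assoc]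
          simp only [ENNReal.ofReal_ofNat]
          gcongr
          exact h1 j (hJS j.2)
      _ = 6 ^ N * 2 ^ (N + 1) * volume (⋃ j : J, ball (j : Euc N) (r j) ∩ E) := by
          rw [ENNReal.tsum_mul_left, measure_iUnion]
          · intro i j hij
            exact (hJd' hij).mono inter_subset_left inter_subset_left
          · exact fun j => measurableSet_ball.inter hE
      _ ≤ _ := by
          gcongr
          exact iUnion_subset fun j => fun y hy => ⟨hy.2, hsub j hy.1⟩
  · exact ENNReal.mul_ne_top (by finiteness) (ENNReal.mul_ne_top (by finiteness)
      (ENNReal.mul_ne_top (by finiteness) hP.ne))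
  · intro h
    calc _ ≤ ∑' j : J, dq ((ball (j : Euc N) (6 * r j)).indicator 1) h univ :=
          dq_iUnion_le (fun _ => measurableSet_ball) _ _
      _ ≤ ∑' j : J, 2 * 2 ^ N * (6 ^ N * (2 ^ (2 * N + 3) * perimeter E (ball (j : Euc N) (r j))))
            * ‖h‖ₑ := by
          refine ENNReal.tsum_le_tsum fun j => ?_
          have hrj := (hr j (hJS j.2)).1
          refine (dq_ball (j : Euc N) (by linarith : 0 < 6 * r j) h).trans ?_
          gcongr
          calc volume (ball (j : Euc N) (6 * r j)) / ENNReal.ofReal (6 * r j)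
              ≤ volume (ball (j : Euc N) (6 * r j)) / ENNReal.ofReal (r j) := by
                gcongr; linarith
            _ = 6 ^ N * (volume (ball (j : Euc N) (r j)) / ENNReal.ofReal (r j)) := by
                rw [volume_ball_smul _ (by norm_num), mul_div_assoc, ENNReal.ofReal_ofNat]
            _ ≤ _ := by
                gcongr
                exact isoperimetric hE hrj (h1 j (hJS j.2)) (h2 j (hJS j.2))
      _ = 2 * 2 ^ N * (6 ^ N * (2 ^ (2 * N + 3) * ∑' j : J, perimeter E (ball (j : Euc N) (r j))))
            * ‖h‖ₑ := by
          rw [ENNReal.tsum_mul_right, ENNReal.tsum_mul_left, ENNReal.tsum_mul_left,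
            ENNReal.tsum_mul_left]
      _ ≤ _ := by
          gcongr
          exact sum_perimeter_le hE hJd' hsub

lemma exists_level {v : Euc N → ℝ} (hv : Measurable v) {O : Set (Euc N)} (hO : IsOpen O)
    (hfin : volume O ≠ ⊤) {η : ℝ≥0∞} (hη : η ≠ 0) :
    ∃ T : ℝ, 0 < T ∧ volume ({x | T < |v x|} ∩ O) ≤ η := by
  have hm : ∀ n : ℕ, MeasurableSet ({x | (n : ℝ) + 1 < |v x|} ∩ O) := fun n =>
    (measurableSet_lt measurable_const hv.abs).inter hO.measurableSet
  have ht := tendsto_measure_iInter_atTop (μ := volume)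
    (s := fun n : ℕ => {x | (n : ℝ) + 1 < |v x|} ∩ O) (fun n => (hm n).nullMeasurableSet)
    (by
      intro a b hab x hx
      have h0 : (a : ℝ) ≤ b := Nat.cast_le.2 hab
      have h1 : (b : ℝ) + 1 < |v x| := hx.1
      exact ⟨show (a : ℝ) + 1 < |v x| by linarith, hx.2⟩)
    ⟨0, measure_ne_top_of_subset inter_subset_right hfin⟩
  have hempty : ⋂ n : ℕ, ({x | (n : ℝ) + 1 < |v x|} ∩ O) = ∅ := by
    rw [eq_empty_iff_forall_notMem]
    intro x hx
    obtain ⟨n, hn⟩ := exists_nat_ge |v x|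
    have : (n : ℝ) + 1 < |v x| := (mem_iInter.1 hx n).1
    linarith
  rw [hempty, measure_empty] at ht
  obtain ⟨n, hn⟩ := (ht.eventually (gt_mem_nhds hη.bot_lt)).exists
  exact ⟨n + 1, by positivity, hn.le⟩

lemma exists_half {Ω : Set (Euc N)} (hΩ : IsOpen Ω) {v : Euc N → ℝ} (hv : Measurable v)
    {x : Euc N} (hx : x ∈ Ω) {t : ℝ} (hd : HasDensity {y | y ∈ Ω ∧ |v y| ≤ t} x 0) {r₀ : ℝ}
    (hr₀ : 0 < r₀) :
    ∃ k : ℕ, volume (ball x (r₀ / 2 ^ k)) ≤ 2 * volume (ball x (r₀ / 2 ^ k) ∩ {y | t < |v y|}) := by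
  unfold HasDensity at hd
  rw [ENNReal.ofReal_zero] at hd
  obtain ⟨ρ, hρ, hb⟩ := Metric.isOpen_iff.1 hΩ x hx
  have hseq : Tendsto (fun k : ℕ => r₀ / 2 ^ k) atTop (𝓝[>] 0) := by
    refine tendsto_nhdsWithin_iff.2 ⟨?_, Eventually.of_forall fun k => ?_⟩
    · have := (tendsto_pow_atTop_nhds_zero_of_lt_one (r := (1 / 2 : ℝ)) (by norm_num)
        (by norm_num)).const_mul r₀
      rw [mul_zero] at this
      refine this.congr fun k => ?_
      rw [one_div, inv_pow, div_eq_mul_inv]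
    · exact div_pos hr₀ (by positivity)
  have h1 := hseq.eventually (hd.eventually (gt_mem_nhds (show (0 : ℝ≥0∞) < 2⁻¹ by simp)))
  have h2 := hseq.eventually (Ioo_mem_nhdsGT hρ)
  obtain ⟨k, hk1, hk2⟩ := (h1.and h2).exists
  refine ⟨k, ?_⟩
  set B := ball x (r₀ / 2 ^ k) with hB
  have hBf : volume B ≠ ⊤ := measure_ball_lt_top.ne
  have hB0 : volume B ≠ 0 := (measure_ball_pos _ _ hk2.1).ne'
  have hE : MeasurableSet {y | t < |v y|} := measurableSet_lt measurable_const hv.abs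
  have hsum := measure_inter_add_sdiff (μ := volume) B hE
  have hsub : volume (B \ {y | t < |v y|}) ≤ volume ({y | y ∈ Ω ∧ |v y| ≤ t} ∩ B) := by
    refine measure_mono fun y hy => ⟨⟨hb (ball_subset_ball hk2.2.le hy.1), not_lt.1 hy.2⟩, hy.1⟩
  have hlt : 2 * volume (B \ {y | t < |v y|}) ≤ volume B := by
    have := (ENNReal.div_le_iff hB0 hBf).1 hk1.le
    calc _ ≤ 2 * (2⁻¹ * volume B) := by gcongr; exact hsub.trans this
      _ = volume B := by rw [← mul_assoc, ENNReal.mul_inv_cancel (by simp) (by simp), one_mul]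
  have hfin : volume (B \ {y | t < |v y|}) ≠ ⊤ := measure_ne_top_of_subset sdiff_subset hBf
  rw [← hsum, two_mul] at hlt
  have hle := (ENNReal.add_le_add_iff_right hfin).1 hlt
  rw [← hsum, two_mul]
  gcongr

lemma local_cover {v : Euc N → ℝ} (hv : Measurable v) {Ω C K O : Set (Euc N)} (hΩ : IsOpen Ω)
    (hV : ∀ m : ℝ, 0 < m → ∀ W : Set (Euc N), IsOpen W → IsCompact (closure W) → closure W ⊆ Ω →
      variation (fun x => max (-m) (min (v x) m)) W < ⊤)
    (hC : C ⊆ Ω) (hd : ∀ x ∈ C, ∀ t, HasDensity {y | y ∈ Ω ∧ |v y| ≤ t} x 0)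
    (hK : IsCompact K) (hKO : K ⊆ O)
    (ho : IsOpen O) (hc : IsCompact (closure O)) (hs : closure O ⊆ Ω) {ε : ℝ≥0∞} (hε : ε ≠ 0) :
    ∃ U : Set (Euc N), IsOpen U ∧ U ⊆ O ∧ C ∩ K ⊆ U ∧ volume U ≤ ε ∧
      ∃ c : ℝ≥0∞, c ≠ ⊤ ∧ ∀ h, dq (U.indicator 1) h univ ≤ c * ‖h‖ₑ := by
  obtain ⟨δ, hδ, hδs⟩ := hK.exists_thickening_subset_open ho hKO
  set r₀ : ℝ := δ / 6 with hr₀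
  have hr₀p : 0 < r₀ := by positivity
  set A : ℝ≥0∞ := 6 ^ N * 2 ^ (N + 1) with hA
  have hA0 : A ≠ 0 := by simp [hA]
  have hAf : A ≠ ⊤ := by finiteness
  have hb0 : volume (ball (0 : Euc N) r₀) ≠ 0 := (measure_ball_pos _ _ hr₀p).ne'
  have hη : min (volume (ball (0 : Euc N) r₀) / 2) (ε / A) ≠ 0 := by
    refine (lt_min ?_ ?_).ne'
    · exact ENNReal.div_pos hb0 (by simp)
    · exact ENNReal.div_pos hε hAf
  obtain ⟨T, hT, hTv⟩ := exists_level hv ho (volume_ne_top_of_closure hc) hη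
  obtain ⟨t, ht, hP⟩ := coarea hv hΩ hV ho hc hs hT
  set E : Set (Euc N) := {x | t < |v x|} with hEdef
  have hE : MeasurableSet E := measurableSet_lt measurable_const hv.abs
  have hEsub : E ∩ O ⊆ {x | T < |v x|} ∩ O := by
    intro x hx
    have h1 : t < |v x| := hx.1
    exact ⟨show T < |v x| from ht.trans h1, hx.2⟩
  have hEv : volume (E ∩ O) ≤ min (volume (ball (0 : Euc N) r₀) / 2) (ε / A) :=
    (measure_mono hEsub).trans hTv
  have hball : ∀ x ∈ C ∩ K, ∀ r ≤ r₀, ball x (6 * r) ⊆ O := by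
    intro x hx r hr y hy
    refine hδs (mem_thickening_iff.2 ⟨x, hx.2, ?_⟩)
    have : dist y x < 6 * r := hy
    rw [hr₀] at hr
    linarith
  have hrad : ∀ x, ∃ r, x ∈ C ∩ K → 0 < r ∧ r ≤ r₀ ∧
      volume (ball x r) ≤ 2 ^ (N + 1) * volume (ball x r ∩ E) ∧
      volume (ball x r) ≤ 2 * volume (ball x r \ E) := by
    intro x
    by_cases hx : x ∈ C ∩ K
    · have h0 : 2 * volume (ball x r₀ ∩ E) ≤ volume (ball x r₀) := by
        have h1 : volume (ball x r₀ ∩ E) ≤ volume (ball (0 : Euc N) r₀) / 2 := by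
          refine le_trans (measure_mono ?_) (hEv.trans (min_le_left _ _))
          intro y hy
          exact ⟨hy.2, hball x hx r₀ le_rfl (ball_subset_ball (by linarith) hy.1)⟩
        rw [Measure.addHaar_ball_center volume x r₀]
        calc _ ≤ 2 * (volume (ball (0 : Euc N) r₀) / 2) := by gcongr
          _ = _ := ENNReal.mul_div_cancel (by simp) (by simp)
      obtain ⟨r, hr⟩ := exists_radius hr₀p h0 hE
        (exists_half hΩ hv (hC hx.1) (hd x hx.1 t) hr₀p)
      exact ⟨r, fun _ => hr⟩
    · exact ⟨0, fun h => absurd h hx⟩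
  choose r hr using hrad
  obtain ⟨U, hU1, hU2, hU3, hU4, hU5⟩ := covering hE (S := C ∩ K) (r := r) (r₀ := r₀) (O := O)
    (fun x hx => ⟨(hr x hx).1, (hr x hx).2.1⟩) (fun x hx => hball x hx _ (hr x hx).2.1)
    (fun x hx => (hr x hx).2.2.1) (fun x hx => (hr x hx).2.2.2) hP
  refine ⟨U, hU1, hU2, hU3, hU4.trans ?_, hU5⟩
  calc _ ≤ A * (ε / A) := by gcongr; exact hEv.trans (min_le_right _ _)
    _ = ε := ENNReal.mul_div_cancel hA0 hAf

/-! ### Globalization and the second implication -/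

lemma exists_exhaustion {Ω : Set (Euc N)} (hΩ : IsOpen Ω) :
    ∃ L : ℕ → Set (Euc N), L 0 = ∅ ∧ (∀ n, IsCompact (L n)) ∧ (∀ n, L n ⊆ interior (L (n + 1))) ∧
      (∀ n, L n ⊆ Ω) ∧ (∀ x ∈ Ω, ∃ n, x ∈ L n) := by
  haveI : LocallyCompactSpace Ω := hΩ.locallyCompactSpace
  set K := (CompactExhaustion.choice Ω).shiftr with hK
  refine ⟨fun n => Subtype.val '' (K n), ?_, fun n => (K.isCompact n).image continuous_subtype_val,
    ?_, ?_, ?_⟩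
  · exact image_empty _
  · intro n
    refine (image_mono (K.subset_interior_succ n)).trans ?_
    exact interior_maximal (image_mono interior_subset)
      (hΩ.isOpenMap_subtype_val _ isOpen_interior)
  · rintro n _ ⟨y, -, rfl⟩
    exact y.2
  · intro x hx
    obtain ⟨n, hn⟩ := K.exists_mem ⟨x, hx⟩
    exact ⟨n, ⟨x, hx⟩, hn, rfl⟩

lemma global_cover {v : Euc N → ℝ} (hv : Measurable v) {Ω C : Set (Euc N)} (hΩ : IsOpen Ω)
    (hV : ∀ m : ℝ, 0 < m → ∀ W : Set (Euc N), IsOpen W → IsCompact (closure W) → closure W ⊆ Ω →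
      variation (fun x => max (-m) (min (v x) m)) W < ⊤)
    (hC : C ⊆ Ω) (hd : ∀ x ∈ C, ∀ t, HasDensity {y | y ∈ Ω ∧ |v y| ≤ t} x 0)
    {ε : ℝ≥0∞} (hε : ε ≠ 0) :
    ∃ U : Set (Euc N), (IsOpen U ∧ U ⊆ Ω ∧ C ⊆ U ∧ HasLocFinPerimeter U Ω) ∧ volume U ≤ ε := by
  classical
  obtain ⟨L, hL0, hLc, hLi, hLΩ, hLx⟩ := exists_exhaustion hΩ
  have hLmono : Monotone L := monotone_nat_of_le_succ fun n => (hLi n).trans interior_subset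
  set K : ℕ → Set (Euc N) := fun j => L (j + 1) \ interior (L j) with hK
  set O : ℕ → Set (Euc N) := fun j => interior (L (j + 2)) \ L (j - 1) with hO
  have hOL : ∀ j, closure (O j) ⊆ L (j + 2) := fun j =>
    closure_minimal (sdiff_subset.trans interior_subset) (hLc _).isClosed
  have hKO : ∀ j, K j ⊆ O j := by
    intro j x hx
    refine ⟨hLi _ hx.1, fun h => ?_⟩
    cases j with
    | zero =>
      rw [Nat.zero_sub, hL0] at h
      exact h
    | succ j => exact hx.2 (hLi j h)
  obtain ⟨ε', hε'0, hε'⟩ := ENNReal.exists_pos_sum_of_countable' hε ℕ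
  have hloc := fun j => local_cover hv hΩ hV hC hd (K := K j) (O := O j)
    ((hLc (j + 1)).diff isOpen_interior) (hKO j)
    (isOpen_interior.sdiff (hLc _).isClosed)
    ((hLc _).of_isClosed_subset isClosed_closure (hOL j)) ((hOL j).trans (hLΩ _)) (hε'0 j).ne'
  choose V hVo hVO hVC hVv c hcf hdq using hloc
  refine ⟨⋃ j, V j, ⟨isOpen_iUnion hVo, iUnion_subset fun j => (hVO j).trans
    (subset_closure.trans ((hOL j).trans (hLΩ _))), ?_, ?_⟩, ?_⟩
  · intro x hx
    have hex := hLx x (hC hx)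
    have h1 := Nat.find_spec hex
    have h2 := fun m (hm : m < Nat.find hex) => Nat.find_min hex hm
    generalize Nat.find hex = n at h1 h2
    cases n with
    | zero => rw [hL0] at h1; exact absurd h1 (notMem_empty _)
    | succ n =>
      exact mem_iUnion.2 ⟨n, hVC n ⟨hx, h1, fun h => h2 n (Nat.lt_succ_self n)
        (interior_subset h)⟩⟩
  · intro Ω' ho hc hs
    obtain ⟨W, hW, hWc, hWs, hW', δ, hδ, hδs⟩ := exists_open_between hΩ hc hs
    obtain ⟨n, hn⟩ : ∃ n, closure W ⊆ interior (L n) := by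
      refine hWc.elim_directed_cover (fun n => interior (L n)) (fun _ => isOpen_interior) ?_
        (Monotone.directed_le fun _ _ h => interior_mono (hLmono h))
      intro x hx
      obtain ⟨n, hn⟩ := hLx x (hWs hx)
      exact mem_iUnion.2 ⟨n + 1, hLi n hn⟩
    have hUm : MeasurableSet (⋃ j, V j) := (isOpen_iUnion hVo).measurableSet
    have hmem : ∀ x ∈ W, (x ∈ ⋃ j, V j ↔ x ∈ ⋃ j : Fin (n + 1), V j) := by
      intro x hx
      simp only [mem_iUnion]
      constructor
      · rintro ⟨j, hj⟩
        refine ⟨⟨j, ?_⟩, hj⟩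
        by_contra hlt
        exact (hVO j hj).2 (hLmono (show n ≤ j - 1 by omega)
          (interior_subset (hn (subset_closure hx))))
      · rintro ⟨j, hj⟩
        exact ⟨j, hj⟩
    rw [perimeter_eq hUm]
    refine variation_lt_top_of_dq (measurable_ind hUm) (indicator_abs_le _) hδ
      (c := ∑ j : Fin (n + 1), c j) (ENNReal.sum_ne_top.2 fun j _ => hcf j) ?_
    intro h hh
    calc _ ≤ dq ((⋃ j : Fin (n + 1), V j).indicator 1) h univ := by
          rw [dq_ind hUm, dq_ind (MeasurableSet.iUnion fun j => (hVo _).measurableSet)]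
          refine measure_mono ?_
          rintro x ⟨hx, hxΩ⟩
          refine ⟨fun hcon => hx ?_, mem_univ _⟩
          have h1 : x + h ∈ W := by simpa using hδs h hh x hxΩ 1 (by simp)
          have h0 : x ∈ W := hW' (subset_closure hxΩ)
          rw [hmem _ h1, hmem _ h0]
          exact hcon
      _ ≤ ∑' j : Fin (n + 1), dq ((V j).indicator 1) h univ :=
          dq_iUnion_le (fun j => (hVo _).measurableSet) _ _
      _ = ∑ j : Fin (n + 1), dq ((V j).indicator 1) h univ := tsum_fintype _
      _ ≤ ∑ j : Fin (n + 1), c j * ‖h‖ₑ := Finset.sum_le_sum fun j _ => hdq j h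
      _ = _ := by rw [Finset.sum_mul]
  · exact (measure_iUnion_le _).trans ((ENNReal.tsum_le_tsum hVv).trans hε'.le)

lemma HasDensity.mono_ae {A B : Set (Euc N)} {x : Euc N} (hB : HasDensity B x 0)
    (hAB : ∀ᵐ y, y ∈ A → y ∈ B) : HasDensity A x 0 := by
  unfold HasDensity at *
  rw [ENNReal.ofReal_zero] at *
  refine tendsto_of_tendsto_of_tendsto_of_le_of_le tendsto_const_nhds hB (fun _ => zero_le) ?_
  intro ρ
  refine ENNReal.div_le_div_right (measure_mono_ae ?_) _
  filter_upwards [hAB] with y hy h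
  exact ⟨hy h.1, h.2⟩

lemma open_of_gbvPolar {Ω : Set (Euc N)} (hΩ : IsOpen Ω) {C : Set (Euc N)} (hC : C ⊆ Ω)
    (h : GBVPolar C Ω) : ∃ U : ℕ → Set (Euc N),
        (∀ k, IsOpen (U k) ∧ U k ⊆ Ω ∧ C ⊆ U k ∧ HasLocFinPerimeter (U k) Ω) ∧
        Tendsto (fun k => volume (U k)) atTop (𝓝 0) := by
  obtain ⟨u, ⟨hum, huV⟩, huC⟩ := h
  set v := hum.mk u with hv
  have hvm : Measurable v := hum.measurable_mk
  have hae : ∀ᵐ y ∂(volume.restrict Ω), u y = v y := hum.ae_eq_mk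
  have hae' : ∀ᵐ y, y ∈ Ω → u y = v y := (ae_restrict_iff' hΩ.measurableSet).1 hae
  have hV : ∀ m : ℝ, 0 < m → ∀ W : Set (Euc N), IsOpen W → IsCompact (closure W) →
      closure W ⊆ Ω → variation (fun x => max (-m) (min (v x) m)) W < ⊤ := by
    intro m hm W h1 h2 h3
    have := (huV m hm W h1 h2 h3).2
    convert this using 1
    unfold variation
    refine iSup_congr fun φ => iSup_congr fun _ => ?_
    congr 1
    refine integral_congr_ae ?_
    filter_upwards [ae_restrict_of_ae_restrict_of_subset (subset_closure.trans h3) hae] with y hy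
    rw [hy]
  have hd : ∀ x ∈ C, ∀ t, HasDensity {y | y ∈ Ω ∧ |v y| ≤ t} x 0 := by
    intro x hx t
    rcases (huC hx).2 with ⟨-, hlow⟩ | ⟨hup, -⟩
    · have hlt : (t : EReal) < approxLower u Ω x := by rw [hlow]; exact EReal.coe_lt_top t
      obtain ⟨_, ⟨s, rfl, hs⟩, hts⟩ := lt_sSup_iff.1 hlt
      have hts' : t < s := EReal.coe_lt_coe_iff.1 hts
      refine hs.mono_ae ?_
      filter_upwards [hae'] with y hy hyA
      have h1 : |v y| ≤ t := hyA.2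
      refine ⟨hyA.1, ?_⟩
      show u y < s
      rw [hy hyA.1]
      linarith [le_abs_self (v y)]
    · have hlt : approxUpper u Ω x < ((-t : ℝ) : EReal) := by rw [hup]; exact EReal.bot_lt_coe _
      obtain ⟨_, ⟨s, rfl, hs⟩, hts⟩ := sInf_lt_iff.1 hlt
      have hts' : s < -t := EReal.coe_lt_coe_iff.1 hts
      refine hs.mono_ae ?_
      filter_upwards [hae'] with y hy hyA
      have h1 : |v y| ≤ t := hyA.2
      refine ⟨hyA.1, ?_⟩
      show s < u y
      rw [hy hyA.1]
      linarith [neg_abs_le (v y)]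
  have hex := fun k : ℕ => global_cover hvm hΩ hV hC hd
    (ε := ((k : ℝ≥0∞) + 1)⁻¹) (ENNReal.inv_ne_zero.2 (by finiteness))
  choose U hU hUv using hex
  refine ⟨U, hU, ?_⟩
  refine tendsto_of_tendsto_of_tendsto_of_le_of_le tendsto_const_nhds ?_ (fun _ => zero_le) hUv
  have := (tendsto_add_atTop_iff_nat 1).2 ENNReal.tendsto_inv_nat_nhds_zero
  simpa using this

/-- `C ⊆ Ω` is `GBV`-polar in the open set `Ω` if and only if there is a
sequence `{U_k}` of open subsets of `Ω`, each containing `C` and with locally finite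
perimeter in `Ω`, such that `λ^N(U_k) → 0`. -/
theorem statement8 {N : ℕ} (Ω : Set (Euc N)) (hΩ : IsOpen Ω)
    (C : Set (Euc N)) (hC : C ⊆ Ω) :
    GBVPolar C Ω ↔
      ∃ U : ℕ → Set (Euc N),
        (∀ k, IsOpen (U k) ∧ U k ⊆ Ω ∧ C ⊆ U k ∧ HasLocFinPerimeter (U k) Ω) ∧
        Tendsto (fun k => volume (U k)) atTop (𝓝 0) := by
  exact ⟨open_of_gbvPolar hΩ hC, fun ⟨_, hU, hlim⟩ => gbvPolar_of_open hΩ hC hU hlim⟩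
end
end

section
/- Let {u_k} be a sequence of nonnegative functions in BV(ℝ^N) such that ‖u_k‖_BV := ‖u_k‖_{L^1} + V(u_k,ℝ^N) → 0. Then there exists a subsequence {u_{k_j}} such that the approximate upper limits satisfy u_{k_j}^+(x) → 0 for H^{N-1}-almost every x ∈ ℝ^N. -/
open MeasureTheory Metric Filter Set
open scoped ENNReal Topology symmDiff

noncomputable section

variable {N : ℕ}

/-- Countable cover of `Z` by closed balls with `∑ r^n ≤ M`. -/
def Cov (n : ℕ) {N : ℕ} (Z : Set (Euc N)) (M : ℝ≥0∞) : Prop :=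
  ∃ F : Set (Euc N × ℝ), F.Countable ∧ (∀ p ∈ F, 0 < p.2) ∧
    Z ⊆ ⋃ p ∈ F, closedBall p.1 p.2 ∧ ∑' p : F, ENNReal.ofReal p.1.2 ^ n ≤ M

lemma Cov.mono {n N : ℕ} {Z Z' : Set (Euc N)} {M M' : ℝ≥0∞} (h : Cov n Z M) (hZ : Z' ⊆ Z)
    (hM : M ≤ M') : Cov n Z' M' := by
  obtain ⟨F, h1, h2, h3, h4⟩ := h
  exact ⟨F, h1, h2, hZ.trans h3, h4.trans hM⟩

lemma Cov.iUnion {n N : ℕ} {ι : Type} [Countable ι] {Z : ι → Set (Euc N)} {M : ι → ℝ≥0∞}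
    (h : ∀ i, Cov n (Z i) (M i)) : Cov n (⋃ i, Z i) (∑' i, M i) := by
  choose F h1 h2 h3 h4 using h
  refine ⟨⋃ i, F i, countable_iUnion h1, ?_, ?_, ?_⟩
  · intro p hp
    obtain ⟨i, hi⟩ := mem_iUnion.1 hp
    exact h2 i p hi
  · refine iUnion_subset fun i => (h3 i).trans ?_
    exact biUnion_subset_biUnion_left (subset_iUnion F i)
  · refine (ENNReal.tsum_iUnion_le_tsum (fun p : Euc N × ℝ => ENNReal.ofReal p.2 ^ n) F).trans ?_
    exact ENNReal.tsum_le_tsum h4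

lemma Cov.union {n N : ℕ} {Z Z' : Set (Euc N)} {M M' : ℝ≥0∞} (h : Cov n Z M) (h' : Cov n Z' M') :
    Cov n (Z ∪ Z') (M + M') := by
  have := Cov.iUnion (ι := Bool) (Z := fun b => cond b Z Z') (M := fun b => cond b M M')
    (n := n) (by rintro (_ | _) <;> simpa)
  refine this.mono ?_ ?_
  · rintro x (hx | hx)
    · exact mem_iUnion.2 ⟨true, hx⟩
    · exact mem_iUnion.2 ⟨false, hx⟩
  · simp [tsum_fintype]

lemma cov_of_family {n N : ℕ} (F : Set (Euc N × ℝ)) (hF : F.Countable) (hpos : ∀ p ∈ F, 0 < p.2)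
    (c : ℝ) (hc : 0 < c) (M : ℝ≥0∞) (hM : ∑' p : F, ENNReal.ofReal p.1.2 ^ n ≤ M) :
    Cov n (⋃ p ∈ F, closedBall p.1 (c * p.2)) (ENNReal.ofReal c ^ n * M) := by
  let g : Euc N × ℝ → Euc N × ℝ := fun p => (p.1, c * p.2)
  have hg : Function.Injective g := by
    rintro ⟨a, b⟩ ⟨a', b'⟩ h
    simp only [g, Prod.mk.injEq] at h
    exact Prod.ext h.1 (mul_left_cancel₀ hc.ne' h.2)
  refine ⟨g '' F, hF.image g, ?_, ?_, ?_⟩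
  · rintro _ ⟨p, hp, rfl⟩
    exact mul_pos hc (hpos p hp)
  · rw [biUnion_image]
  · rw [tsum_image (fun p : Euc N × ℝ => ENNReal.ofReal p.2 ^ n) hg.injOn]
    simp only [g, ENNReal.ofReal_mul hc.le, mul_pow]
    rw [ENNReal.tsum_mul_left]
    gcongr

lemma vitali_cov {n N : ℕ} (T : Set (Euc N × ℝ)) (hT : ∀ p ∈ T, 0 < p.2 ∧ p.2 ≤ 2) (M : ℝ≥0∞)
    (hfin : ∀ G : Finset (Euc N × ℝ), (G : Set (Euc N × ℝ)) ⊆ T →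
      (G : Set (Euc N × ℝ)).PairwiseDisjoint (fun p => closedBall p.1 p.2) →
      ∑ p ∈ G, ENNReal.ofReal p.2 ^ n ≤ M) :
    Cov n (⋃ p ∈ T, closedBall p.1 p.2) (5 ^ n * M) := by
  obtain ⟨F, hFT, hdis, hcov⟩ := Vitali.exists_disjoint_subfamily_covering_enlargement_closedBall
    T (fun p => p.1) (fun p => p.2) 2 (fun p hp => (hT p hp).2) 5 (by norm_num)
  have hc : F.Countable := hdis.countable_of_nonempty_interior (by
    intro p hp
    refine ⟨p.1, ?_⟩
    exact ball_subset_interior_closedBall (mem_ball_self (hT p (hFT hp)).1))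
  have := cov_of_family (n := n) F hc (fun p hp => (hT p (hFT hp)).1) 5 (by norm_num) M (by
    rw [ENNReal.tsum_eq_iSup_sum]
    refine iSup_le fun s => ?_
    have := hfin (s.map (Function.Embedding.subtype _)) (by
      intro p hp
      simp at hp
      exact hFT hp.1) (hdis.subset (by intro p hp; simp at hp; exact hp.1))
    simpa using this)
  refine this.mono ?_ (by simp)
  refine iUnion₂_subset fun p hp => ?_
  obtain ⟨q, hq, h⟩ := hcov p hp
  exact h.trans (subset_biUnion_of_mem (u := fun q : Euc N × ℝ => closedBall q.1 (5 * q.2)) hq)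

lemma hausdorff_zero_of_cov {n N : ℕ} (Z : Set (Euc N)) (h : ∀ η : ℝ≥0∞, 0 < η → Cov n Z η) :
    (μH[(n : ℝ)] : Measure (Euc N)) Z = 0 := by
  rcases Nat.eq_zero_or_pos n with rfl | hn
  · obtain ⟨F, h1, h2, h3, h4⟩ := h (1/2) (by simp)
    have hF : F = ∅ := by
      by_contra hne
      obtain ⟨p, hp⟩ := nonempty_iff_ne_empty.2 hne
      have := (ENNReal.le_tsum (f := fun p : F => ENNReal.ofReal p.1.2 ^ 0) ⟨p, hp⟩).trans h4
      simp at this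
    subst hF
    simp at h3
    simp [h3]
  · have hpos : ∀ k : ℕ, (0 : ℝ≥0∞) < (((k : ℝ≥0∞) + 1)⁻¹) ^ n := fun k => by
      apply ENNReal.pow_pos
      simp
    choose F h1 h2 h3 h4 using fun k : ℕ => h _ (hpos k)
    have hcount : ∀ k, Countable (F k) := fun k => (h1 k).to_subtype
    have hr : ∀ k, ∀ p : F k, ENNReal.ofReal p.1.2 ≤ ((k : ℝ≥0∞) + 1)⁻¹ := by
      intro k p
      have := (ENNReal.le_tsum (f := fun p : F k => ENNReal.ofReal p.1.2 ^ n) p).trans (h4 k)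
      exact le_of_not_gt fun hlt => absurd this (not_le.2 (ENNReal.pow_lt_pow_left hn.ne' hlt))
    have ht : Tendsto (fun k : ℕ => ((k : ℝ≥0∞) + 1)⁻¹) atTop (𝓝 0) := by
      have := (tendsto_add_atTop_iff_nat 1).2 ENNReal.tendsto_inv_nat_nhds_zero
      simpa using this
    have hd : ∀ k, ∀ p : F k, ediam (closedBall p.1.1 p.1.2) ≤ 2 * ENNReal.ofReal p.1.2 := by
      intro k p
      rw [← Metric.closedEBall_ofReal (h2 k p.1 p.2).le]
      exact ediam_closedEBall_le
    have key := Measure.hausdorffMeasure_le_liminf_tsum (n : ℝ) Z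
      (fun k : ℕ => 2 * ((k : ℝ≥0∞) + 1)⁻¹) (l := atTop)
      (by simpa using ENNReal.Tendsto.const_mul ht (Or.inr (by simp : (2 : ℝ≥0∞) ≠ ⊤)))
      (fun k (p : F k) => closedBall p.1.1 p.1.2)
      (Eventually.of_forall fun k p => (hd k p).trans (by gcongr; exact hr k p))
      (Eventually.of_forall fun k => (h3 k).trans (by rw [biUnion_eq_iUnion]))
    refine le_antisymm (key.trans ?_) bot_le
    have hlim : Tendsto (fun k : ℕ => 2 ^ n * (((k : ℝ≥0∞) + 1)⁻¹) ^ n) atTop (𝓝 0) := by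
      have h1 := ENNReal.Tendsto.pow (n := n) ht
      rw [zero_pow hn.ne'] at h1
      simpa using ENNReal.Tendsto.const_mul h1 (Or.inr (by simp : (2 ^ n : ℝ≥0∞) ≠ ⊤))
    refine (liminf_le_liminf (Eventually.of_forall fun k => ?_)).trans hlim.liminf_eq.le
    calc _ ≤ ∑' p : F k, 2 ^ n * ENNReal.ofReal p.1.2 ^ n := by
          refine ENNReal.tsum_le_tsum fun p => ?_
          rw [ENNReal.rpow_natCast, ← mul_pow]
          gcongr
          exact hd k p
      _ ≤ _ := by
          rw [ENNReal.tsum_mul_left]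
          gcongr
          exact h4 k

/-- Volume of the unit ball. -/
def omg (n : ℕ) : ℝ≥0∞ := volume (ball (0 : Euc (n+1)) 1)

lemma omg_ne_zero (n : ℕ) : omg n ≠ 0 := (measure_ball_pos _ _ one_pos).ne'
lemma omg_ne_top (n : ℕ) : omg n ≠ ⊤ := measure_ball_lt_top.ne

lemma vol_cB (n : ℕ) (x : Euc (n+1)) {r : ℝ} (hr : 0 ≤ r) :
    volume (closedBall x r) = ENNReal.ofReal r ^ (n+1) * omg n := by
  rw [Measure.addHaar_closedBall _ _ hr, ENNReal.ofReal_pow hr]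
  simp [omg]

lemma vol_ball (n : ℕ) (x : Euc (n+1)) {r : ℝ} (hr : 0 ≤ r) :
    volume (ball x r) = ENNReal.ofReal r ^ (n+1) * omg n := by
  rw [← vol_cB n x hr, Measure.addHaar_closedBall_eq_addHaar_ball]

lemma density_aux (n : ℕ) (A : Set (Euc (n+1))) (F : Set (Euc (n+1) × ℝ)) (hF : F.Countable)
    (hFpos : ∀ p ∈ F, 0 < p.2) (hsum : ∑' p : F, ENNReal.ofReal p.1.2 ^ n ≠ ⊤)
    (hA : volume (A \ ⋃ p ∈ F, closedBall p.1 p.2) = 0) (α : ℝ≥0∞) (hα : α ≠ 0) (hα' : α ≠ ⊤)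
    (η : ℝ≥0∞) (hη : 0 < η) :
    Cov n {x | x ∉ (⋃ p ∈ F, closedBall p.1 p.2) ∧
      ∃ᶠ ρ in 𝓝[>] (0:ℝ), α * volume (ball x ρ) < volume (A ∩ ball x ρ)} η := by
  classical
  set C : ℝ≥0∞ := 3 ^ n + 5 ^ n * (2 ^ n * α⁻¹) with hC
  have hC0 : C ≠ 0 := by simp [hC]
  have hCt : C ≠ ⊤ := by
    simp only [hC, ne_eq, ENNReal.add_eq_top, not_or]
    refine ⟨by simp, ?_⟩
    refine ENNReal.mul_ne_top (by simp) (ENNReal.mul_ne_top (by simp) ?_)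
    simpa using hα
  have hlim := ENNReal.tendsto_tsum_compl_atTop_zero hsum
  obtain ⟨G, hG⟩ := (hlim.eventually_lt_const
    (ENNReal.div_pos hη.ne' hCt)).exists
  set T' : Set (Euc (n+1) × ℝ) := {p | ∃ h : p ∈ F, (⟨p, h⟩ : F) ∉ G} with hT'
  have hT'F : T' ⊆ F := fun p hp => hp.1
  have hT'c : T'.Countable := hF.mono hT'F
  have : Countable T' := hT'c.to_subtype
  set τ := ∑' p : T', ENNReal.ofReal p.1.2 ^ n with hτ
  have hτle : τ ≤ η / C := by
    refine le_trans ?_ hG.le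
    let g : T' → {x : F // x ∉ G} := fun p => ⟨⟨p.1, p.2.1⟩, p.2.2⟩
    have hg : Function.Injective g := by
      intro p q h
      simp only [g, Subtype.mk.injEq] at h
      exact Subtype.ext h
    exact ENNReal.tsum_comp_le_tsum_of_injective hg
      (fun q : {x : F // x ∉ G} => ENNReal.ofReal q.1.1.2 ^ n)
  let ν : Measure (Euc (n+1)) := Measure.sum (fun p : T' =>
    (ENNReal.ofReal p.1.2 ^ n) • Measure.dirac p.1.1)
  have hν : ∀ B : Set (Euc (n+1)), MeasurableSet B → ν B =
      ∑' p : T', ENNReal.ofReal p.1.2 ^ n * B.indicator 1 p.1.1 := by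
    intro B hB
    simp only [ν, Measure.sum_apply _ hB, Measure.smul_apply, smul_eq_mul,
      Measure.dirac_apply' _ hB]
  have hνu : ν univ = τ := by rw [hν _ MeasurableSet.univ]; simp [hτ]
  set T : Set (Euc (n+1) × ℝ) := {q | (0 < q.2 ∧ q.2 ≤ 2) ∧
    ENNReal.ofReal q.2 ^ n ≤ 2 ^ n * α⁻¹ * ν (closedBall q.1 q.2)} with hT
  have cov2 := vitali_cov (n := n) T (fun q hq => hq.1) (2 ^ n * α⁻¹ * τ) (by
    intro S hS hdis
    calc ∑ p ∈ S, ENNReal.ofReal p.2 ^ n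
        ≤ ∑ p ∈ S, 2 ^ n * α⁻¹ * ν (closedBall p.1 p.2) :=
          Finset.sum_le_sum fun p hp => (hS hp).2
      _ = 2 ^ n * α⁻¹ * ν (⋃ p ∈ S, closedBall p.1 p.2) := by
          rw [← Finset.mul_sum, measure_biUnion_finset hdis (fun p _ => measurableSet_closedBall)]
      _ ≤ 2 ^ n * α⁻¹ * τ := by
          gcongr
          rw [← hνu]
          exact measure_mono (subset_univ _))
  have cov1 := cov_of_family (n := n) T' hT'c (fun p hp => hFpos p (hT'F hp)) 3 (by norm_num) τ le_rfl
  refine (cov1.union cov2).mono ?_ ?_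
  swap
  · calc _ = C * τ := by
          rw [hC, add_mul, mul_assoc, mul_assoc]; simp [mul_assoc]
      _ ≤ C * (η / C) := by gcongr
      _ ≤ η := ENNReal.mul_div_le
  rintro x ⟨hxF, hfreq⟩
  by_cases hx3 : x ∈ ⋃ p ∈ T', closedBall p.1 (3 * p.2)
  · exact Or.inl hx3
  right
  have hev : ∀ᶠ ρ in 𝓝[>] (0:ℝ), ρ ≤ 1 ∧ 0 < ρ ∧
      ∀ p ∈ G, Disjoint (closedBall p.1.1 p.1.2) (ball x ρ) := by
    refine (Eventually.filter_mono nhdsWithin_le_nhds (eventually_le_nhds one_pos)).and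
      (eventually_mem_nhdsWithin.and ?_)
    rw [Filter.eventually_all_finset]
    intro p hp
    have hxp : x ∉ closedBall p.1.1 p.1.2 := fun h => hxF (mem_biUnion p.2 h)
    have : 0 < dist x p.1.1 - p.1.2 := by
      rw [mem_closedBall, not_le] at hxp
      linarith
    filter_upwards [Eventually.filter_mono nhdsWithin_le_nhds (eventually_le_nhds this)] with ρ hρ
    refine closedBall_disjoint_ball ?_
    rw [dist_comm]; linarith
  obtain ⟨ρ, hlt, hρ1, hρ0, hdisj⟩ := (hfreq.and_eventually hev).exists
  refine mem_biUnion (x := (x, 2 * ρ)) ?_ (mem_closedBall_self (by positivity))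
  refine ⟨⟨by positivity, by simp; linarith⟩, ?_⟩
  -- main estimate
  have hsub : A ∩ ball x ρ ⊆ (A \ ⋃ p ∈ F, closedBall p.1 p.2) ∪
      ⋃ p : T', (closedBall p.1.1 p.1.2 ∩ ball x ρ) := by
    rintro y ⟨hyA, hyb⟩
    by_cases hy : y ∈ ⋃ p ∈ F, closedBall p.1 p.2
    · right
      obtain ⟨p, hpF, hyp⟩ := mem_iUnion₂.1 hy
      refine mem_iUnion.2 ⟨⟨p, hpF, fun hpG => ?_⟩, hyp, hyb⟩
      exact (disjoint_left.1 (hdisj _ hpG)) hyp hyb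
    · exact Or.inl ⟨hyA, hy⟩
  have hterm : ∀ p : T', volume (closedBall p.1.1 p.1.2 ∩ ball x ρ) ≤
      ENNReal.ofReal ρ * omg n *
        (ENNReal.ofReal p.1.2 ^ n * (closedBall x (2 * ρ)).indicator 1 p.1.1) := by
    intro p
    have hp0 := hFpos p.1 (hT'F p.2)
    rcases (closedBall p.1.1 p.1.2 ∩ ball x ρ).eq_empty_or_nonempty with he | ⟨y, hy1, hy2⟩
    · simp [he]
    have hd : dist x p.1.1 < ρ + p.1.2 := by
      rw [mem_closedBall] at hy1
      rw [mem_ball'] at hy2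
      linarith [dist_triangle x y p.1.1]
    have hpρ : p.1.2 < ρ := by
      by_contra hcon
      push Not at hcon
      refine hx3 (mem_biUnion p.2 ?_)
      rw [mem_closedBall]
      linarith
    have hmem : p.1.1 ∈ closedBall x (2 * ρ) := by
      rw [mem_closedBall']; linarith
    rw [indicator_of_mem hmem]
    refine (measure_mono inter_subset_left).trans ?_
    rw [vol_cB n _ hp0.le, pow_succ]
    calc ENNReal.ofReal p.1.2 ^ n * ENNReal.ofReal p.1.2 * omg n
        ≤ ENNReal.ofReal p.1.2 ^ n * ENNReal.ofReal ρ * omg n := by gcongr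
      _ = _ := by simp; ring
  have hbig : α * (ENNReal.ofReal ρ ^ (n+1) * omg n) ≤
      ENNReal.ofReal ρ * omg n * ν (closedBall x (2 * ρ)) := by
    rw [← vol_ball n x hρ0.le]
    refine hlt.le.trans ((measure_mono hsub).trans ((measure_union_le _ _).trans ?_))
    rw [hA, zero_add]
    refine (measure_iUnion_le _).trans ?_
    rw [hν _ measurableSet_closedBall, ← ENNReal.tsum_mul_left]
    exact ENNReal.tsum_le_tsum hterm
  have hρo : ENNReal.ofReal ρ * omg n ≠ 0 := mul_ne_zero (by simpa using hρ0) (omg_ne_zero n)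
  have hρt : ENNReal.ofReal ρ * omg n ≠ ⊤ := ENNReal.mul_ne_top (by simp) (omg_ne_top n)
  have h2 : α * ENNReal.ofReal ρ ^ n ≤ ν (closedBall x (2 * ρ)) := by
    rw [← ENNReal.mul_le_mul_iff_right hρo hρt]
    refine le_trans (le_of_eq ?_) hbig
    ring
  simp only
  rw [ENNReal.ofReal_mul (by norm_num), mul_pow]
  calc ENNReal.ofReal 2 ^ n * ENNReal.ofReal ρ ^ n
      = 2 ^ n * α⁻¹ * (α * ENNReal.ofReal ρ ^ n) := by
        rw [show 2 ^ n * α⁻¹ * (α * ENNReal.ofReal ρ ^ n) = 2 ^ n * (α⁻¹ * α) * ENNReal.ofReal ρ ^ n by ring,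
          ENNReal.inv_mul_cancel hα hα']
        simp
    _ ≤ _ := by gcongr

lemma density_cov (n : ℕ) (A A' : Set (Euc (n+1))) (M : ℝ≥0∞) (hM : M ≠ ⊤) (hc : Cov n A' M)
    (hA : volume (A \ A') = 0) (η : ℝ≥0∞) (hη : 0 < η) :
    Cov n {x | ¬ HasDensity A x 0} (M + η) := by
  obtain ⟨F, h1, h2, h3, h4⟩ := hc
  have hA2 : volume (A \ ⋃ p ∈ F, closedBall p.1 p.2) = 0 :=
    measure_mono_null (sdiff_subset_sdiff_right h3) hA
  obtain ⟨ε, hε, hsum⟩ := ENNReal.exists_pos_sum_of_countable' hη.ne' ℕ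
  have hZ := Cov.iUnion (fun m : ℕ => density_aux n A F h1 h2 (ne_top_of_le_ne_top hM h4) hA2
    ((m : ℝ≥0∞) + 1)⁻¹ (by simp) (by simp) (ε m) (hε m))
  have hF : Cov n (⋃ p ∈ F, closedBall p.1 p.2) M := ⟨F, h1, h2, Subset.rfl, h4⟩
  refine (hF.union hZ).mono ?_ (by gcongr)
  intro x hx
  by_cases hxF : x ∈ ⋃ p ∈ F, closedBall p.1 p.2
  · exact Or.inl hxF
  right
  by_contra hcon
  apply hx
  simp only [mem_iUnion, not_exists, mem_ofPred_eq, not_and, Filter.not_frequently, not_lt] at hcon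
  simp only [HasDensity, ENNReal.ofReal_zero]
  rw [ENNReal.tendsto_nhds_zero]
  intro δ hδ
  obtain ⟨m, hm⟩ := ENNReal.exists_inv_nat_lt hδ.ne'
  filter_upwards [hcon m (fun p hp h => hxF (mem_biUnion hp h)), self_mem_nhdsWithin] with ρ hρ hρ0
  refine ENNReal.div_le_of_le_mul (hρ.trans ?_)
  gcongr
  refine le_trans ?_ hm.le
  rw [ENNReal.inv_le_inv]
  exact le_self_add

lemma line_bound {N : ℕ} (w : Euc N → ℝ) (hw : ContDiff ℝ 1 w) (x y : Euc N) :
    ‖w x - w y‖ₑ ≤ ‖x - y‖ₑ * ∫⁻ τ in Icc (0:ℝ) 1, ‖fderiv ℝ w ((1-τ) • x + τ • y)‖ₑ := by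
  let γ : ℝ → Euc N := fun τ => (1-τ) • x + τ • y
  have hγ : ∀ τ, HasDerivAt γ (y - x) τ := by
    intro τ
    have h1 : HasDerivAt (fun τ : ℝ => (1 - τ) • x) ((-1 : ℝ) • x) τ := by
      simpa using ((hasDerivAt_id τ).const_sub 1).smul_const x
    have h2 : HasDerivAt (fun τ : ℝ => τ • y) ((1 : ℝ) • y) τ :=
      (hasDerivAt_id τ).smul_const y
    have := h1.add h2
    have e : y - x = (-1 : ℝ) • x + (1 : ℝ) • y := by
      rw [neg_one_smul, one_smul]; abel
    rw [e]
    exact this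
  have hd : ∀ τ, HasDerivAt (fun τ => w (γ τ)) (fderiv ℝ w (γ τ) (y - x)) τ := fun τ =>
    ((hw.differentiable (by simp)) (γ τ)).hasFDerivAt.comp_hasDerivAt τ (hγ τ)
  have hγc : Continuous γ := by fun_prop
  have hdc : Continuous (fun τ => fderiv ℝ w (γ τ)) := (hw.continuous_fderiv (by simp)).comp hγc
  have hcont : Continuous (fun τ => fderiv ℝ w (γ τ) (y - x)) := hdc.clm_apply continuous_const
  have hftc := intervalIntegral.integral_eq_sub_of_hasDerivAt (a := 0) (b := 1)
    (fun τ _ => hd τ) (hcont.intervalIntegrable 0 1)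
  have e : w x - w y = - ∫ τ in Ioc (0:ℝ) 1, fderiv ℝ w (γ τ) (y - x) := by
    rw [← intervalIntegral.integral_of_le zero_le_one, hftc]
    simp [γ]
  rw [e, enorm_neg]
  refine (enorm_integral_le_lintegral_enorm _).trans ?_
  rw [← restrict_Ioc_eq_restrict_Icc, ← lintegral_const_mul' _ _ (by simp)]
  refine lintegral_mono fun τ => ?_
  refine (ContinuousLinearMap.le_opENorm _ _).trans ?_
  rw [mul_comm, enorm_sub_rev]

lemma change_var {N : ℕ} (B : Set (Euc N)) (hB : Convex ℝ B) (hBm : MeasurableSet B)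
    (g : Euc N → ℝ≥0∞) (hg : Measurable g) (τ : ℝ) (hτ : 1/2 ≤ τ) (hτ1 : τ ≤ 1) (y : Euc N)
    (hy : y ∈ B) :
    ∫⁻ x in B, g ((1-τ) • y + τ • x) ≤ 2 ^ N * ∫⁻ z in B, g z := by
  have hτ0 : 0 < τ := by linarith
  have h1 : ∫⁻ x in B, g ((1-τ) • y + τ • x) ≤ ∫⁻ x, B.indicator g ((1-τ) • y + τ • x) := by
    rw [← lintegral_indicator hBm]
    refine lintegral_mono fun x => ?_
    by_cases hx : x ∈ B
    · rw [indicator_of_mem hx, indicator_of_mem]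
      exact hB hy hx (by linarith) hτ0.le (by ring)
    · simp [indicator_of_notMem hx]
  refine h1.trans ?_
  have hm : Measurable (B.indicator g) := hg.indicator hBm
  have h2 : ∫⁻ x, B.indicator g ((1-τ) • y + τ • x) =
      ENNReal.ofReal |(τ ^ Module.finrank ℝ (Euc N))⁻¹| * ∫⁻ z, B.indicator g ((1-τ) • y + z) := by
    have := Measure.map_addHaar_smul (volume : Measure (Euc N)) hτ0.ne'
    have h3 : ∫⁻ z, B.indicator g ((1-τ) • y + z) ∂(Measure.map (τ • ·) (volume : Measure (Euc N)))
      = ∫⁻ x, B.indicator g ((1-τ) • y + τ • x) := by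
      rw [lintegral_map]
      · exact hm.comp (measurable_const_add _)
      · exact measurable_const_smul τ
    rw [← h3, this, lintegral_smul_measure, smul_eq_mul]
  rw [h2, lintegral_add_left_eq_self, lintegral_indicator hBm]
  gcongr
  rw [abs_of_pos (by positivity), finrank_euclideanSpace_fin, ← inv_pow, ENNReal.ofReal_pow (by positivity)]
  gcongr
  rw [show (2 : ℝ≥0∞) = ENNReal.ofReal 2 by simp]
  apply ENNReal.ofReal_le_ofReal
  rw [inv_le_comm₀ hτ0 (by norm_num)]
  linarith

lemma poincare_s11 {N : ℕ} (w : Euc N → ℝ) (hw : ContDiff ℝ 1 w) (c : Euc N) (r : ℝ) (hr : 0 ≤ r) :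
    ∫⁻ x in closedBall c r, ∫⁻ y in closedBall c r, ‖w x - w y‖ₑ ≤
      ENNReal.ofReal (2 * r) * (2 ^ N * volume (closedBall c r) *
        ∫⁻ z in closedBall c r, ‖fderiv ℝ w z‖ₑ) := by
  set B := closedBall c r with hBdef
  have hB : Convex ℝ B := convex_closedBall c r
  have hBm : MeasurableSet B := measurableSet_closedBall
  set g : Euc N → ℝ≥0∞ := fun z => ‖fderiv ℝ w z‖ₑ with hg
  have hgc : Continuous g := (hw.continuous_fderiv (by simp)).enorm
  have hgm : Measurable g := hgc.measurable
  set J := ∫⁻ z in B, g z with hJ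
  have step1 : ∀ x ∈ B, ∀ y ∈ B, ‖w x - w y‖ₑ ≤
      ENNReal.ofReal (2 * r) * ∫⁻ τ in Icc (0:ℝ) 1, g ((1-τ) • x + τ • y) := by
    intro x hx y hy
    refine (line_bound w hw x y).trans ?_
    gcongr
    rw [← ofReal_norm]
    apply ENNReal.ofReal_le_ofReal
    rw [← dist_eq_norm]
    have := dist_triangle_right x y c
    rw [mem_closedBall] at hx hy
    linarith
  calc ∫⁻ x in B, ∫⁻ y in B, ‖w x - w y‖ₑ
      ≤ ∫⁻ x in B, ∫⁻ y in B, ENNReal.ofReal (2 * r) *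
          ∫⁻ τ in Icc (0:ℝ) 1, g ((1-τ) • x + τ • y) :=
        setLIntegral_mono' hBm fun x hx => setLIntegral_mono' hBm fun y hy => step1 x hx y hy
    _ = ENNReal.ofReal (2 * r) * ∫⁻ x in B, ∫⁻ y in B,
          ∫⁻ τ in Icc (0:ℝ) 1, g ((1-τ) • x + τ • y) := by
        rw [← lintegral_const_mul' _ _ ENNReal.ofReal_ne_top]
        congr with x
        rw [← lintegral_const_mul' _ _ ENNReal.ofReal_ne_top]
    _ = ENNReal.ofReal (2 * r) * ∫⁻ τ in Icc (0:ℝ) 1, ∫⁻ x in B, ∫⁻ y in B,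
           g ((1-τ) • x + τ • y) := by
        congr 1
        have : ∀ x, ∫⁻ y in B, ∫⁻ τ in Icc (0:ℝ) 1, g ((1-τ) • x + τ • y) =
            ∫⁻ τ in Icc (0:ℝ) 1, ∫⁻ y in B, g ((1-τ) • x + τ • y) := by
          intro x
          rw [lintegral_lintegral_swap]
          apply Measurable.aemeasurable
          apply hgm.comp
          fun_prop
        simp_rw [this]
        rw [lintegral_lintegral_swap]
        apply Measurable.aemeasurable
        have : Measurable (fun q : (Euc N × ℝ) × Euc N => g ((1-q.1.2) • q.1.1 + q.1.2 • q.2)) := by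
          apply hgm.comp
          fun_prop
        exact this.lintegral_prod_right'
    _ ≤ ENNReal.ofReal (2 * r) * ∫⁻ τ in Icc (0:ℝ) 1, 2 ^ N * volume B * J := by
        gcongr 1
        refine setLIntegral_mono' measurableSet_Icc fun τ hτ => ?_
        rcases le_total (1/2) τ with h | h
        · calc ∫⁻ x in B, ∫⁻ y in B, g ((1-τ) • x + τ • y) ≤ ∫⁻ x in B, 2 ^ N * J :=
              setLIntegral_mono' hBm fun x hx => change_var B hB hBm g hgm τ h hτ.2 x hx
            _ = _ := by rw [setLIntegral_const]; ring
        · rw [lintegral_lintegral_swap]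
          · calc ∫⁻ y in B, ∫⁻ x in B, g ((1-τ) • x + τ • y) ≤ ∫⁻ y in B, 2 ^ N * J :=
                setLIntegral_mono' hBm fun y hy => by
                  have := change_var B hB hBm g hgm (1-τ) (by linarith) (by linarith [hτ.1]) y hy
                  simpa [add_comm] using this
              _ = _ := by rw [setLIntegral_const]; ring
          · apply Measurable.aemeasurable
            apply hgm.comp
            fun_prop
    _ = _ := by simp

lemma smoothTransition_deriv_bound : ∃ K : ℝ, 0 < K ∧
    (∀ t, |deriv Real.smoothTransition t| ≤ K) ∧
    ∀ t, ¬ (0 < t ∧ t < 1) → deriv Real.smoothTransition t = 0 := by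
  have hc : Continuous (deriv Real.smoothTransition) :=
    (Real.smoothTransition.contDiff (n := 1)).continuous_deriv (by simp)
  obtain ⟨K, hK⟩ := (isCompact_Icc (a := (0:ℝ)) (b := 1)).exists_bound_of_continuousOn hc.continuousOn
  have h0 : ∀ t, ¬ (0 < t ∧ t < 1) → deriv Real.smoothTransition t = 0 := by
    intro t ht
    rcases le_or_gt t 0 with h | h
    · have : IsLocalMin Real.smoothTransition t := Eventually.of_forall fun y => by
        rw [Real.smoothTransition.zero_of_nonpos h]
        exact Real.smoothTransition.nonneg y
      exact this.deriv_eq_zero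
    · have h1 : 1 ≤ t := by
        by_contra hh
        exact ht ⟨h, not_le.1 hh⟩
      have : IsLocalMax Real.smoothTransition t := Eventually.of_forall fun y => by
        rw [Real.smoothTransition.one_of_one_le h1]
        exact Real.smoothTransition.le_one y
      exact this.deriv_eq_zero
  refine ⟨|K| + 1, by positivity, fun t => ?_, h0⟩
  by_cases ht : 0 < t ∧ t < 1
  · have := hK t ⟨ht.1.le, ht.2.le⟩
    rw [Real.norm_eq_abs] at this
    linarith [le_abs_self K]
  · rw [h0 t ht]; simp; positivity

/-- Bound for the derivative of the smooth transition. -/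
def Ksm : ℝ := smoothTransition_deriv_bound.choose

lemma Ksm_pos : 0 < Ksm := smoothTransition_deriv_bound.choose_spec.1

lemma level_poincare {N : ℕ} (f : Euc N → ℝ) (hf : ContDiff ℝ 1 f) (c : Euc N) (r : ℝ) (hr : 0 ≤ r)
    (a b : ℝ) (hab : a < b) :
    volume (closedBall c r ∩ {z | f z ≤ a}) * volume (closedBall c r ∩ {z | b ≤ f z}) ≤
      ENNReal.ofReal (2 * r) * (2 ^ N * volume (closedBall c r) *
        (ENNReal.ofReal (Ksm / (b - a)) *
          ∫⁻ z in closedBall c r ∩ {z | a < f z ∧ f z < b}, ‖fderiv ℝ f z‖ₑ)) := by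
  obtain ⟨hK0, hK1, hK2⟩ := smoothTransition_deriv_bound.choose_spec
  change 0 < Ksm at hK0
  change ∀ t, _ ≤ Ksm at hK1
  have hba : 0 < b - a := sub_pos.2 hab
  set B := closedBall c r with hBdef
  have hBm : MeasurableSet B := measurableSet_closedBall
  set w : Euc N → ℝ := fun z => Real.smoothTransition ((f z - a) / (b - a)) with hwdef
  have hin : ContDiff ℝ 1 (fun z => (f z - a) / (b - a)) := (hf.sub contDiff_const).div_const _
  have hw : ContDiff ℝ 1 w := (Real.smoothTransition.contDiff (n := 1)).comp hin
  have hfc := hf.continuous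
  have hmI : MeasurableSet {z | a < f z ∧ f z < b} :=
    ((isOpen_lt continuous_const hfc).inter (isOpen_lt hfc continuous_const)).measurableSet
  have hder : ∀ z, ‖fderiv ℝ w z‖ₑ ≤ ENNReal.ofReal (Ksm / (b - a)) *
      {z | a < f z ∧ f z < b}.indicator (fun z => ‖fderiv ℝ f z‖ₑ) z := by
    intro z
    have h1 : HasFDerivAt (fun z => (f z - a) / (b - a)) ((b - a)⁻¹ • fderiv ℝ f z) z := by
      have h := (((hf.differentiable (by simp)) z).hasFDerivAt.sub_const a).const_mul ((b - a)⁻¹)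
      refine h.congr_of_eventuallyEq (Eventually.of_forall fun y => ?_)
      simp [div_eq_inv_mul]
    have h2 : HasDerivAt Real.smoothTransition (deriv Real.smoothTransition ((f z - a) / (b - a)))
        ((f z - a) / (b - a)) :=
      ((Real.smoothTransition.contDiff (n := 1)).differentiable (by simp) _).hasDerivAt
    have h3 := (h2.comp_hasFDerivAt z h1).fderiv
    have h4 : fderiv ℝ w z = deriv Real.smoothTransition ((f z - a) / (b - a)) •
      (b - a)⁻¹ • fderiv ℝ f z := h3
    by_cases hz : a < f z ∧ f z < b
    · rw [indicator_of_mem (by exact hz), h4, enorm_smul, enorm_smul, ← mul_assoc]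
      gcongr
      rw [div_eq_mul_inv Ksm, ENNReal.ofReal_mul hK0.le]
      gcongr
      · rw [← ofReal_norm, Real.norm_eq_abs]
        exact ENNReal.ofReal_le_ofReal (hK1 _)
      · rw [← ofReal_norm, Real.norm_eq_abs, abs_of_pos (by positivity)]
    · rw [h4, hK2, zero_smul]
      · exact (enorm_zero (E := Euc N →L[ℝ] ℝ)).le.trans bot_le
      · rintro ⟨h5, h6⟩
        rw [lt_div_iff₀ hba] at h5
        rw [div_lt_iff₀ hba] at h6
        exact hz ⟨by linarith, by linarith⟩
  have hp := poincare_s11 w hw c r hr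
  rw [← hBdef] at hp
  calc volume (B ∩ {z | f z ≤ a}) * volume (B ∩ {z | b ≤ f z})
      = ∫⁻ x in B ∩ {z | f z ≤ a}, ∫⁻ y in B ∩ {z | b ≤ f z}, 1 := by simp [mul_comm]
    _ ≤ ∫⁻ x in B ∩ {z | f z ≤ a}, ∫⁻ y in B ∩ {z | b ≤ f z}, ‖w x - w y‖ₑ := by
        refine setLIntegral_mono' (hBm.inter (isClosed_le hfc continuous_const).measurableSet)
          fun x hx => setLIntegral_mono' (hBm.inter (isClosed_le continuous_const hfc).measurableSet)
          fun y hy => ?_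
        have h1 : w x = 0 := Real.smoothTransition.zero_of_nonpos
          (div_nonpos_of_nonpos_of_nonneg (by have := hx.2; simp at this; linarith) hba.le)
        have h2 : w y = 1 := Real.smoothTransition.one_of_one_le (by
          have := hy.2; simp at this
          rw [one_le_div hba]; linarith)
        rw [h1, h2]; simp
    _ ≤ ∫⁻ x in B, ∫⁻ y in B, ‖w x - w y‖ₑ := by
        refine (lintegral_mono_set inter_subset_left).trans ?_
        exact lintegral_mono fun x => lintegral_mono_set inter_subset_left
    _ ≤ _ := hp
    _ ≤ _ := by
        gcongr
        rw [inter_comm, ← setLIntegral_indicator hmI, ← lintegral_const_mul' _ _ ENNReal.ofReal_ne_top]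
        exact lintegral_mono hder

/-- The dimensional constant in the Poincare-type inequality for balls. -/
def Cpo (n : ℕ) : ℝ≥0∞ := 2 ^ (2 * n + 10) * (omg n)⁻¹

lemma ball_bound (n : ℕ) (f : Euc (n+1) → ℝ) (hf : ContDiff ℝ 1 f) (c : Euc (n+1)) (r : ℝ) (hr : 0 < r)
    (a b : ℝ) (hab : a < b)
    (h1 : volume (closedBall c r) ≤ 4 * volume (closedBall c r ∩ {z | f z ≤ a}))
    (h2 : volume (closedBall c r) ≤ 2 ^ (n + 4) * volume (closedBall c r ∩ {z | b ≤ f z})) :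
    ENNReal.ofReal r ^ n ≤ Cpo n * (ENNReal.ofReal (Ksm / (b - a)) *
          ∫⁻ z in closedBall c r ∩ {z | a < f z ∧ f z < b}, ‖fderiv ℝ f z‖ₑ) := by
  have h := level_poincare f hf c r hr.le a b hab
  set X := (ENNReal.ofReal (Ksm / (b - a)) *
          ∫⁻ z in closedBall c r ∩ {z | a < f z ∧ f z < b}, ‖fderiv ℝ f z‖ₑ) with hX
  set v := volume (closedBall c r) with hv
  have hve : v = ENNReal.ofReal r ^ (n+1) * omg n := vol_cB n c hr.le
  have hr0 : ENNReal.ofReal r ≠ 0 := by simpa using hr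
  have hv0 : v ≠ 0 := by rw [hve]; exact mul_ne_zero (pow_ne_zero _ hr0) (omg_ne_zero n)
  have hvt : v ≠ ⊤ := by
    rw [hve]; exact ENNReal.mul_ne_top (by simp) (omg_ne_top n)
  have h3 : v * v ≤ v * (2 ^ (2 * n + 8) * 2 * ENNReal.ofReal r * X) := by
    calc v * v ≤ (4 * volume (closedBall c r ∩ {z | f z ≤ a})) *
          (2 ^ (n + 4) * volume (closedBall c r ∩ {z | b ≤ f z})) := by gcongr
      _ = 4 * 2 ^ (n+4) * (volume (closedBall c r ∩ {z | f z ≤ a}) *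
          volume (closedBall c r ∩ {z | b ≤ f z})) := by ring
      _ ≤ 4 * 2 ^ (n+4) * (ENNReal.ofReal (2 * r) * (2 ^ (n+1) * v * X)) := by gcongr
      _ = v * (2 ^ (2 * n + 8) * ENNReal.ofReal r * X) := by
          rw [ENNReal.ofReal_mul (by norm_num)]
          simp only [ENNReal.ofReal_ofNat]
          ring
      _ ≤ _ := by
          gcongr
          exact le_mul_of_one_le_right' (by norm_num)
  rw [ENNReal.mul_le_mul_iff_right hv0 hvt, hve] at h3
  have hro : ENNReal.ofReal r * omg n ≠ 0 := mul_ne_zero hr0 (omg_ne_zero n)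
  have hrt : ENNReal.ofReal r * omg n ≠ ⊤ := ENNReal.mul_ne_top (by simp) (omg_ne_top n)
  rw [← ENNReal.mul_le_mul_iff_right hro hrt]
  calc ENNReal.ofReal r * omg n * ENNReal.ofReal r ^ n = ENNReal.ofReal r ^ (n+1) * omg n := by ring
    _ ≤ 2 ^ (2 * n + 8) * 2 * ENNReal.ofReal r * X := h3
    _ ≤ 2 ^ (2 * n + 10) * ENNReal.ofReal r * X := by
        gcongr
        rw [← pow_succ]
        exact pow_le_pow_right₀ (by norm_num) (by omega)
    _ = 2 ^ (2 * n + 10) * ENNReal.ofReal r * X * (omg n * (omg n)⁻¹) := by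
        rw [ENNReal.mul_inv_cancel (omg_ne_zero n) (omg_ne_top n), mul_one]
    _ = _ := by rw [Cpo]; ring

/-- Right mollification with a scalar kernel. -/
def moll {N : ℕ} {E : Type} [NormedAddCommGroup E] [NormedSpace ℝ E] (φ : Euc N → E) (η : Euc N → ℝ) :
    Euc N → E :=
  convolution φ η (ContinuousLinearMap.lsmul ℝ ℝ : ℝ →L[ℝ] E →L[ℝ] E).flip volume

lemma moll_fderiv {N : ℕ} {E : Type} [NormedAddCommGroup E] [NormedSpace ℝ E] (φ : Euc N → E)
    (η : Euc N → ℝ) (hφ : LocallyIntegrable φ volume) (hη : ContDiff ℝ 1 η)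
    (hc : HasCompactSupport η) (x v : Euc N) :
    fderiv ℝ (moll φ η) x v = ∫ t, (fderiv ℝ η (x - t) v) • φ t := by
  have h := (hc.hasFDerivAt_convolution_right
    (ContinuousLinearMap.lsmul ℝ ℝ : ℝ →L[ℝ] E →L[ℝ] E).flip hφ hη x).fderiv
  have h' : fderiv ℝ (moll φ η) x = _ := h
  rw [h', convolution_precompR_apply _ hφ (hc.fderiv ℝ) (hη.continuous_fderiv (by simp))]
  rfl

lemma moll_contDiff {N : ℕ} {E : Type} [NormedAddCommGroup E] [NormedSpace ℝ E] (φ : Euc N → E)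
    (η : Euc N → ℝ) (hφ : LocallyIntegrable φ volume) (hη : ContDiff ℝ 1 η)
    (hc : HasCompactSupport η) : ContDiff ℝ 1 (moll φ η) :=
  hc.contDiff_convolution_right (n := 1) _ hφ hη

lemma fderiv_even {N : ℕ} (η : Euc N → ℝ) (heven : ∀ x, η (-x) = η x)
    (hη : ContDiff ℝ 1 η) (x v : Euc N) : fderiv ℝ η (-x) v = - fderiv ℝ η x v := by
  have h1 : HasFDerivAt (fun y => η (-y)) ((fderiv ℝ η (-x)).comp
      (-(ContinuousLinearMap.id ℝ (Euc N)))) x :=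
    HasFDerivAt.comp x ((hη.differentiable (by simp)) (-x)).hasFDerivAt (hasFDerivAt_id x).neg
  have h2 : (fun y => η (-y)) = η := funext heven
  rw [h2] at h1
  rw [h1.fderiv]
  simp

lemma moll_int {N : ℕ} (η : Euc N → ℝ)
    (hη : ContDiff ℝ 1 η) (φ : Euc N → Euc N) (hφ : Continuous φ) (hφc : HasCompactSupport φ)
    (y v : Euc N) : Integrable (fun t => (fderiv ℝ η (y - t) v) • φ t) volume := by
  have hDc : Continuous (fderiv ℝ η) := hη.continuous_fderiv (by simp)
  apply Continuous.integrable_of_hasCompactSupport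
  · exact ((hDc.comp (continuous_const.sub continuous_id)).clm_apply continuous_const).smul hφ
  · refine hφc.mono ?_
    intro t ht
    rw [Function.mem_support] at ht ⊢
    intro h0
    apply ht
    rw [h0, smul_zero]

lemma moll_coord {N : ℕ} (η : Euc N → ℝ)
    (hη : ContDiff ℝ 1 η) (hc : HasCompactSupport η)
    (φ : Euc N → Euc N) (hφ : Continuous φ) (hφc : HasCompactSupport φ) (y : Euc N) (i : Fin N) :
    Integrable (fun t => (fderiv ℝ η (y - t) (EuclideanSpace.single i 1)) * φ t i) volume ∧
    (fderiv ℝ (moll φ η) y (EuclideanSpace.single i 1)) i =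
        ∫ t, (fderiv ℝ η (y - t) (EuclideanSpace.single i 1)) * φ t i := by
  have hφi : Integrable φ volume := hφ.integrable_of_hasCompactSupport hφc
  have hi := moll_int η hη φ hφ hφc y (EuclideanSpace.single i 1)
  have e : ∀ t, (EuclideanSpace.proj (𝕜 := ℝ) i : Euc N →L[ℝ] ℝ)
      ((fderiv ℝ η (y - t) (EuclideanSpace.single i 1)) • φ t) =
      (fderiv ℝ η (y - t) (EuclideanSpace.single i 1)) * φ t i := by
    intro t
    rw [map_smul, smul_eq_mul]
    rfl
  constructor
  · have := (EuclideanSpace.proj (𝕜 := ℝ) i : Euc N →L[ℝ] ℝ).integrable_comp hi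
    exact this.congr (Eventually.of_forall e)
  · rw [moll_fderiv φ η hφi.locallyIntegrable hη hc]
    have := (EuclideanSpace.proj (𝕜 := ℝ) i : Euc N →L[ℝ] ℝ).integral_comp_comm hi
    refine Eq.trans ?_ (this.symm.trans (integral_congr_ae (Eventually.of_forall e)))
    rfl

lemma moll_div {N : ℕ} (η : Euc N → ℝ)
    (hη : ContDiff ℝ 1 η) (hc : HasCompactSupport η)
    (φ : Euc N → Euc N) (hφ : Continuous φ) (hφc : HasCompactSupport φ) (y : Euc N) :
    diverg (moll φ η) y = ∫ t, fderiv ℝ η (y - t) (φ t) := by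
  simp only [diverg]
  have h := fun i => moll_coord η hη hc φ hφ hφc y i
  rw [Finset.sum_congr rfl (fun i _ => (h i).2), ← integral_finsetSum _ (fun i _ => (h i).1)]
  refine integral_congr_ae (Eventually.of_forall fun t => ?_)
  have e : φ t = ∑ i, (φ t i) • (EuclideanSpace.single i (1:ℝ) : Euc N) := by
    have := (EuclideanSpace.basisFun (Fin N) ℝ).sum_repr (φ t)
    simpa using this.symm
  show _ = fderiv ℝ η (y - t) (φ t)
  conv_rhs => rw [e, map_sum]
  refine Finset.sum_congr rfl fun i _ => ?_
  rw [map_smul, smul_eq_mul, mul_comm]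

lemma moll_dual {N : ℕ} (u : Euc N → ℝ) (hu : Integrable u volume) (η : Euc N → ℝ)
    (hη : ContDiff ℝ 1 η) (hc : HasCompactSupport η) (heven : ∀ x, η (-x) = η x)
    (hη0 : ∀ x, 0 ≤ η x) (hη1 : ∫ x, η x = 1)
    (φ : Euc N → Euc N) (hφ : Continuous φ) (hφc : HasCompactSupport φ) (hφ1 : ∀ x, ‖φ x‖ ≤ 1) :
    ENNReal.ofReal (-∫ x, fderiv ℝ (moll u η) x (φ x)) ≤ variation u univ := by
  have hφi : Integrable φ volume := hφ.integrable_of_hasCompactSupport hφc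
  have hDc : Continuous (fderiv ℝ η) := hη.continuous_fderiv (by simp)
  have hΦ : moll φ η ∈ TestVF (univ : Set (Euc N)) := by
    refine ⟨moll_contDiff φ η hφi.locallyIntegrable hη hc, hφc.convolution _ hc, subset_univ _, ?_⟩
    intro x
    have hint : Integrable (fun t => η (x - t)) volume :=
      (hη.continuous.integrable_of_hasCompactSupport hc).comp_sub_left x
    calc ‖moll φ η x‖ = ‖∫ t, η (x - t) • φ t‖ := rfl
      _ ≤ ∫ t, η (x - t) := by
          refine norm_integral_le_of_norm_le hint (Eventually.of_forall fun t => ?_)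
          rw [norm_smul, Real.norm_eq_abs, abs_of_nonneg (hη0 _)]
          exact mul_le_of_le_one_right (hη0 _) (hφ1 t)
      _ = 1 := by rw [integral_sub_left_eq_self (fun t => η t) volume x, hη1]
  have hdiv := moll_div η hη hc φ hφ hφc
  have hfub : ∫ y, u y * diverg (moll φ η) y = -∫ x, fderiv ℝ (moll u η) x (φ x) := by
    obtain ⟨K, hK⟩ := (hc.fderiv ℝ).exists_bound_of_continuous hDc
    have hint : Integrable (Function.uncurry fun y t => u y * fderiv ℝ η (y - t) (φ t))
        (volume.prod volume) := by
      refine Integrable.mono' ((hu.norm.mul_prod hφi.norm).const_mul K) ?_ ?_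
      · refine (hu.aestronglyMeasurable.comp_fst).mul ?_
        apply Continuous.aestronglyMeasurable
        exact (hDc.comp (continuous_fst.sub continuous_snd)).clm_apply (hφ.comp continuous_snd)
      · refine Eventually.of_forall ?_
        rintro ⟨y, t⟩
        simp only [Function.uncurry, norm_mul]
        have := (fderiv ℝ η (y - t)).le_opNorm (φ t)
        have h2 : ‖fderiv ℝ η (y - t) (φ t)‖ ≤ K * ‖φ t‖ :=
          this.trans (by gcongr; exact hK _)
        calc ‖u y‖ * ‖fderiv ℝ η (y - t) (φ t)‖ ≤ ‖u y‖ * (K * ‖φ t‖) := by gcongr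
          _ = _ := by ring
    calc ∫ y, u y * diverg (moll φ η) y = ∫ y, ∫ t, u y * fderiv ℝ η (y - t) (φ t) := by
          congr with y
          rw [hdiv, integral_const_mul]
      _ = ∫ t, ∫ y, u y * fderiv ℝ η (y - t) (φ t) := integral_integral_swap hint
      _ = ∫ t, -fderiv ℝ (moll u η) t (φ t) := by
          congr with t
          rw [moll_fderiv u η hu.locallyIntegrable hη hc, ← integral_neg]
          congr with y
          rw [← neg_sub t y, fderiv_even η heven hη]
          simp [mul_comm]
      _ = _ := integral_neg _
  rw [← hfub]
  have : ∫ y, u y * diverg (moll φ η) y = ∫ y in univ, u y * diverg (moll φ η) y := by simp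
  rw [this]
  exact le_iSup₂ (f := fun φ (_ : φ ∈ TestVF univ) =>
    ENNReal.ofReal (∫ x in univ, u x * diverg φ x)) (moll φ η) hΦ

lemma moll_var {N : ℕ} (u : Euc N → ℝ) (hu : Integrable u volume) (η : Euc N → ℝ)
    (hη : ContDiff ℝ 1 η) (hc : HasCompactSupport η) (heven : ∀ x, η (-x) = η x)
    (hη0 : ∀ x, 0 ≤ η x) (hη1 : ∫ x, η x = 1) (hV : variation u univ ≠ ⊤) :
    ∫⁻ x, ‖fderiv ℝ (moll u η) x‖ₑ ≤ variation u univ := by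
  set f := moll u η with hf
  have hfC : ContDiff ℝ 1 f := moll_contDiff u η hu.locallyIntegrable hη hc
  have hDc : Continuous (fderiv ℝ f) := hfC.continuous_fderiv (by simp)
  let g : Euc N → Euc N := fun x => (InnerProductSpace.toDual ℝ (Euc N)).symm (fderiv ℝ f x)
  have hgc : Continuous g := (InnerProductSpace.toDual ℝ (Euc N)).symm.continuous.comp hDc
  have hgn : ∀ x, ‖g x‖ = ‖fderiv ℝ f x‖ := fun x =>
    (InnerProductSpace.toDual ℝ (Euc N)).symm.norm_map _
  have hgg : ∀ x, fderiv ℝ f x (g x) = ‖g x‖ ^ 2 := by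
    intro x
    rw [← real_inner_self_eq_norm_sq]
    exact (InnerProductSpace.toDual_symm_apply).symm
  have key : ∀ R : ℕ, ∫⁻ x in closedBall (0 : Euc N) R, ‖fderiv ℝ f x‖ₑ ≤ variation u univ := by
    intro R
    let χ : Euc N → ℝ := fun x => max 0 (min 1 (R + 1 - ‖x‖))
    have hχc : Continuous χ := by fun_prop
    have hχ0 : ∀ x, 0 ≤ χ x := fun x => le_max_left _ _
    have hχ1 : ∀ x, χ x ≤ 1 := fun x => max_le zero_le_one (min_le_left _ _)
    have hχR : ∀ x ∈ closedBall (0 : Euc N) R, χ x = 1 := by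
      intro x hx
      rw [mem_closedBall_zero_iff] at hx
      simp only [χ]
      rw [min_eq_left (by linarith), max_eq_right zero_le_one]
    have hχs : HasCompactSupport χ := by
      refine HasCompactSupport.intro (isCompact_closedBall (0 : Euc N) (R + 1)) fun x hx => ?_
      rw [mem_closedBall_zero_iff, not_le] at hx
      exact max_eq_left ((min_le_right _ _).trans (by linarith))
    have hi1 : Integrable (fun x => χ x * ‖g x‖) volume :=
      (hχc.mul hgc.norm).integrable_of_hasCompactSupport hχs.mul_right
    have hi2 : Integrable χ volume := hχc.integrable_of_hasCompactSupport hχs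
    have hδ : ∀ δ : ℝ, 0 < δ → ∫ x, χ x * ‖g x‖ ≤ (variation u univ).toReal + δ * ∫ x, χ x := by
      intro δ hδ
      let φ : Euc N → Euc N := fun x => -((χ x / max ‖g x‖ δ) • g x)
      have hm0 : ∀ x, 0 < max ‖g x‖ δ := fun x => lt_max_of_lt_right hδ
      have hφc : Continuous φ :=
        ((hχc.div (hgc.norm.max continuous_const) (fun x => (hm0 x).ne')).smul hgc).neg
      have hφs : HasCompactSupport φ := by
        refine hχs.mono ?_
        intro x hx
        rw [Function.mem_support] at hx ⊢
        intro h0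
        apply hx
        simp [φ, h0]
      have hφ1 : ∀ x, ‖φ x‖ ≤ 1 := by
        intro x
        simp only [φ, norm_neg, norm_smul, Real.norm_eq_abs]
        rw [abs_of_nonneg (div_nonneg (hχ0 x) (hm0 x).le), div_mul_eq_mul_div, div_le_one (hm0 x)]
        calc χ x * ‖g x‖ ≤ 1 * ‖g x‖ := by gcongr; exact hχ1 x
          _ ≤ _ := by rw [one_mul]; exact le_max_left _ _
      have hd := moll_dual u hu η hη hc heven hη0 hη1 φ hφc hφs hφ1
      have hd2 : -∫ x, fderiv ℝ f x (φ x) ≤ (variation u univ).toReal :=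
        (ENNReal.ofReal_le_iff_le_toReal hV).1 hd
      have hlow : ∫ x, (χ x * ‖g x‖ - δ * χ x) ≤ ∫ x, -fderiv ℝ f x (φ x) := by
        refine integral_mono (hi1.sub (hi2.const_mul δ)) ?_ ?_
        · apply Continuous.integrable_of_hasCompactSupport
          · exact (hDc.clm_apply hφc).neg
          · refine hφs.mono ?_
            intro x hx
            rw [Function.mem_support] at hx ⊢
            intro h0
            apply hx
            simp [h0]
        · intro x
          simp only [φ, map_neg, map_smul, neg_neg, smul_eq_mul, hgg]
          rw [div_mul_eq_mul_div, le_div_iff₀ (hm0 x)]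
          have e : (χ x * ‖g x‖ - δ * χ x) * max ‖g x‖ δ = χ x * ((‖g x‖ - δ) * max ‖g x‖ δ) := by ring
          rw [e]
          apply mul_le_mul_of_nonneg_left _ (hχ0 x)
          rcases le_total ‖g x‖ δ with h | h
          · rw [max_eq_right h]
            nlinarith [norm_nonneg (g x)]
          · rw [max_eq_left h]
            nlinarith [norm_nonneg (g x)]
      rw [integral_sub hi1 (hi2.const_mul δ), integral_const_mul, integral_neg] at hlow
      linarith
    have hfin : ∫ x, χ x * ‖g x‖ ≤ (variation u univ).toReal := by
      have hlim : Tendsto (fun δ : ℝ => (variation u univ).toReal + δ * ∫ x, χ x) (𝓝[>] 0)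
          (𝓝 ((variation u univ).toReal + 0 * ∫ x, χ x)) := by
        apply Tendsto.mono_left _ nhdsWithin_le_nhds
        apply Continuous.tendsto
        fun_prop
      rw [zero_mul, add_zero] at hlim
      exact ge_of_tendsto hlim (by filter_upwards [self_mem_nhdsWithin] with δ h using hδ δ h)
    calc ∫⁻ x in closedBall (0 : Euc N) R, ‖fderiv ℝ f x‖ₑ
        ≤ ∫⁻ x in closedBall (0 : Euc N) R, ENNReal.ofReal (χ x * ‖g x‖) := by
          refine setLIntegral_mono' measurableSet_closedBall fun x hx => ?_
          rw [hχR x hx, one_mul, hgn, ofReal_norm]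
      _ ≤ ∫⁻ x, ENNReal.ofReal (χ x * ‖g x‖) := setLIntegral_le_lintegral _ _
      _ = ENNReal.ofReal (∫ x, χ x * ‖g x‖) := by
          rw [ofReal_integral_eq_lintegral_ofReal hi1]
          exact Eventually.of_forall fun x => mul_nonneg (hχ0 x) (norm_nonneg _)
      _ ≤ _ := ENNReal.ofReal_le_of_le_toReal hfin
  generalize variation u univ = V at key ⊢
  rw [← setLIntegral_univ, ← iUnion_closedBall_nat (0 : Euc N),
    setLIntegral_iUnion_of_directed]
  · exact iSup_le key
  · exact directed_of_isDirected_le fun a b hab => closedBall_subset_closedBall (by exact_mod_cast hab)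

lemma mollify {N : ℕ} (u : Euc N → ℝ) (hu : Integrable u volume) (hV : variation u univ ≠ ⊤) :
    ∃ f : ℕ → Euc N → ℝ, (∀ k, ContDiff ℝ 1 (f k)) ∧
      (∀ᵐ x, Tendsto (fun k => f k x) atTop (𝓝 (u x))) ∧
      ∀ k, ∫⁻ x, ‖fderiv ℝ (f k) x‖ₑ ≤ variation u univ := by
  let b : ℕ → ContDiffBump (0 : Euc N) := fun k =>
    ⟨1 / ((k : ℝ) + 1), 2 * (1 / ((k : ℝ) + 1)), by positivity, by
      have : 0 < 1 / ((k : ℝ) + 1) := by positivity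
      linarith⟩
  refine ⟨fun k => moll u ((b k).normed volume), fun k => ?_, ?_, fun k => ?_⟩
  · exact moll_contDiff u _ hu.locallyIntegrable (b k).contDiff_normed (b k).hasCompactSupport_normed
  · have := ContDiffBump.ae_convolution_tendsto_right_of_locallyIntegrable (φ := b) (l := atTop)
      (K := 2) (μ := (volume : Measure (Euc N))) (g := u) (by
        have := (tendsto_one_div_add_atTop_nhds_zero_nat (𝕜 := ℝ)).const_mul 2
        simp only [mul_zero] at this
        exact this) (Eventually.of_forall fun k => le_rfl) hu.locallyIntegrable
    filter_upwards [this] with x hx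
    simp only [moll, convolution_flip]
    exact hx
  · exact moll_var u hu _ (b k).contDiff_normed (b k).hasCompactSupport_normed
      (b k).normed_neg (b k).nonneg_normed (b k).integral_normed hV

lemma exists_small_deriv (g : ℝ → ℝ) (hg : Monotone g) (M : ℝ) (hM : 0 < M) (hg0 : ∀ x, 0 ≤ g x)
    (hgM : ∀ x, g x ≤ M) (a b : ℝ) (hab : a < b) :
    ∃ s ∈ Ioo a b, ∃ d, d ≤ 2 * M / (b - a) ∧ HasDerivAt g d s := by
  by_contra hcon
  push Not at hcon
  have h1 := (hg.monotoneOn (uIcc a b)).intervalIntegral_deriv_mem_uIcc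
  have h2 := (hg.monotoneOn (uIcc a b)).intervalIntegrable_deriv
  have h3 : ∫ x in a..b, (2 * M / (b - a)) ≤ ∫ x in a..b, deriv g x := by
    apply intervalIntegral.integral_mono_ae_restrict hab.le intervalIntegrable_const h2
    rw [Filter.EventuallyLE, restrict_Ioo_eq_restrict_Icc.symm, ae_restrict_iff' measurableSet_Ioo]
    filter_upwards [hg.ae_differentiableAt] with x hx hxI
    by_contra hlt
    exact hcon x hxI _ (not_le.1 hlt).le hx.hasDerivAt
  rw [intervalIntegral.integral_const, smul_eq_mul] at h3
  have h4 : (b - a) * (2 * M / (b - a)) = 2 * M := by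
    have : b - a ≠ 0 := by linarith
    field_simp
  rw [h4] at h3
  have h5 := h1.2
  have : max 0 (g b - g a) ≤ M := max_le hM.le (by linarith [hg0 a, hgM b])
  have h6 : ∫ x in a..b, deriv g x ≤ M := h5.trans this
  linarith

lemma level_select (F : ℕ → ℝ → ℝ) (hmono : ∀ k, Monotone (F k)) (M : ℝ) (hM : 0 < M)
    (hF0 : ∀ k τ, 0 ≤ F k τ) (hFM : ∀ k τ, F k τ ≤ M) (a b : ℝ) (hab : a < b) :
    ∃ s ∈ Ioo a b, ∀ᶠ h in 𝓝[>] (0 : ℝ), ∃ᶠ k in atTop,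
      F k (s + 2 * h) ≤ F k (s + h) + h * (8 * M / (b - a)) := by
  have hb1 : ∀ τ, IsBoundedUnder (· ≥ ·) atTop (fun k => F k τ) := fun τ =>
    isBoundedUnder_of ⟨0, fun k => hF0 k τ⟩
  have hb2 : ∀ τ, IsCoboundedUnder (· ≥ ·) atTop (fun k => F k τ) := fun τ =>
    (isBoundedUnder_of ⟨M, fun k => hFM k τ⟩ :
      IsBoundedUnder (· ≤ ·) atTop (fun k => F k τ)).isCoboundedUnder_ge
  let g : ℝ → ℝ := fun τ => liminf (fun k => F k τ) atTop
  have hgm : Monotone g := fun x y hxy =>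
    liminf_le_liminf (Eventually.of_forall fun k => hmono k hxy) (hb1 x) (hb2 y)
  have hg0 : ∀ x, 0 ≤ g x := fun x =>
    le_liminf_of_le (hb2 x) (Eventually.of_forall fun k => hF0 k x)
  have hgM : ∀ x, g x ≤ M := fun x => liminf_le_of_le (hb1 x) fun c hc => by
    obtain ⟨k, hk⟩ := hc.exists
    exact hk.trans (hFM k x)
  obtain ⟨s, hs, d, hd, hder⟩ := exists_small_deriv g hgm M hM hg0 hgM a b hab
  refine ⟨s, hs, ?_⟩
  have hpos : 0 < M / (b - a) := div_pos hM (by linarith)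
  have e1 : 2 * M / (b - a) = 2 * (M / (b - a)) := by ring
  have e2 : 8 * M / (b - a) = 8 * (M / (b - a)) := by ring
  rw [e1] at hd
  rw [e2]
  generalize M / (b - a) = Q at *
  have hsl := hder.tendsto_slope_zero_right.eventually_lt_const (show d < 3 * Q by linarith)
  have hsl2 : ∀ᶠ h in 𝓝[>] (0 : ℝ), (2 * h)⁻¹ • (g (s + 2 * h) - g s) < 3 * Q := by
    have ht : Tendsto (fun h : ℝ => 2 * h) (𝓝[>] 0) (𝓝[>] 0) := by
      refine tendsto_nhdsWithin_iff.2 ⟨?_, ?_⟩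
      · have : Tendsto (fun h : ℝ => 2 * h) (𝓝 0) (𝓝 (2 * 0)) := (continuous_const_mul 2).tendsto 0
        rw [mul_zero] at this
        exact this.mono_left nhdsWithin_le_nhds
      · filter_upwards [self_mem_nhdsWithin] with h hh
        have : 0 < h := hh
        simp [this]
    exact ht.eventually hsl
  filter_upwards [hsl2, self_mem_nhdsWithin] with h hh hh0
  have hh0 : 0 < h := hh0
  rw [smul_eq_mul, inv_mul_lt_iff₀ (by linarith)] at hh
  have f1 : ∃ᶠ k in atTop, F k (s + 2 * h) < g (s + 2 * h) + h * Q :=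
    frequently_lt_of_liminf_lt (hb2 _) (by show g _ < _; nlinarith)
  have f2 : ∀ᶠ k in atTop, g (s + h) - h * Q < F k (s + h) :=
    eventually_lt_of_lt_liminf (by show _ < g _; nlinarith) (hb1 _)
  have f3 : g s ≤ g (s + h) := hgm (by linarith)
  refine (f1.and_eventually f2).mono ?_
  rintro k ⟨hk1, hk2⟩
  linarith

lemma ev_meas {α : Type} [MeasurableSpace α] (μ : Measure α) (S : Set α) (T : ℕ → Set α)
    (h : ∀ᵐ x ∂μ, x ∈ S → ∀ᶠ k in atTop, x ∈ T k) (c : ℝ≥0∞) (hc : c < μ S) :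
    ∀ᶠ k in atTop, c < μ (S ∩ T k) := by
  let W : ℕ → Set α := fun m => {x | x ∈ S ∧ ∀ k, m ≤ k → x ∈ T k}
  have hW : Monotone W := fun a b hab x hx => ⟨hx.1, fun k hk => hx.2 k (hab.trans hk)⟩
  have h1 : μ S ≤ μ (⋃ m, W m) := by
    apply measure_mono_ae
    filter_upwards [h] with x hx hxS
    obtain ⟨m, hm⟩ := eventually_atTop.1 (hx hxS)
    exact mem_iUnion.2 ⟨m, hxS, hm⟩
  have h2 := (tendsto_measure_iUnion_atTop (μ := μ) hW).eventually_const_lt (hc.trans_le h1)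
  filter_upwards [h2] with k hk
  exact hk.trans_le (measure_mono fun x hx => ⟨hx.1, hx.2 k le_rfl⟩)

lemma ev_half {V W : ℝ≥0∞} (hV : V ≠ 0) (hW : W ≠ ⊤) (c : ℝ≥0∞) (hc : c ≠ ⊤) (h : V ≤ c * W) :
    V / (2 * c) < W := by
  have hc0 : c ≠ 0 := by
    rintro rfl
    simp at h
    exact hV h
  have hW0 : W ≠ 0 := by
    rintro rfl
    simp at h
    exact hV h
  have h2 : V / (2 * c) ≤ W / 2 := by
    rw [ENNReal.div_le_iff (by simp [hc0]) (ENNReal.mul_ne_top (by simp) hc)]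
    calc V ≤ c * W := h
      _ = c * (W / 2 * 2) := by rw [ENNReal.div_mul_cancel (by simp) (by simp)]
      _ = _ := by ring
  exact h2.trans_lt (ENNReal.half_lt_self hW0 hW)

lemma family_bound (n : ℕ) (v : Euc (n+1) → ℝ) (f : ℕ → Euc (n+1) → ℝ)
    (hf : ∀ k, ContDiff ℝ 1 (f k)) (hconv : ∀ᵐ x, Tendsto (fun k => f k x) atTop (𝓝 (v x)))
    (M : ℝ) (hM : 0 < M) (hfM : ∀ k, ∫⁻ x, ‖fderiv ℝ (f k) x‖ₑ ≤ ENNReal.ofReal M)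
    (a b : ℝ) (hab : a < b) :
    ∃ s ∈ Ioo a b, ∀ G : Finset (Euc (n+1) × ℝ),
      (∀ p ∈ G, 0 < p.2 ∧
        volume (closedBall p.1 p.2) ≤ 2 ^ (n + 2) * volume (closedBall p.1 p.2 ∩ {z | s < v z}) ∧
        volume (closedBall p.1 p.2) ≤ 2 * volume (closedBall p.1 p.2 ∩ {z | v z ≤ s})) →
      ((G : Set (Euc (n+1) × ℝ)).PairwiseDisjoint (fun p => closedBall p.1 p.2)) →
      ∑ p ∈ G, ENNReal.ofReal p.2 ^ n ≤ Cpo n * ENNReal.ofReal (Ksm * (8 * M / (b - a))) := by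
  have hms : ∀ k τ, MeasurableSet {z | f k z < τ} := fun k τ =>
    measurableSet_lt (hf k).continuous.measurable measurable_const
  have hle : ∀ k (S : Set (Euc (n+1))), ∫⁻ x in S, ‖fderiv ℝ (f k) x‖ₑ ≤ ENNReal.ofReal M :=
    fun k S => (setLIntegral_le_lintegral _ _).trans (hfM k)
  have hfin : ∀ k (S : Set (Euc (n+1))), ∫⁻ x in S, ‖fderiv ℝ (f k) x‖ₑ ≠ ⊤ :=
    fun k S => ((hle k S).trans_lt ENNReal.ofReal_lt_top).ne
  obtain ⟨s, hs, hlev⟩ := level_select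
    (fun k τ => (∫⁻ x in {z | f k z < τ}, ‖fderiv ℝ (f k) x‖ₑ).toReal)
    (fun k x y hxy => ENNReal.toReal_mono (hfin _ _)
      (lintegral_mono_set fun z hz => lt_of_lt_of_le hz hxy)) M hM
    (fun k τ => ENNReal.toReal_nonneg)
    (fun k τ => ENNReal.toReal_le_of_le_ofReal hM.le (hle _ _)) a b hab
  refine ⟨s, hs, ?_⟩
  intro G hG hdis
  have hBpos : ∀ p ∈ G, volume (closedBall p.1 p.2) ≠ 0 := fun p hp =>
    (measure_closedBall_pos volume p.1 (hG p hp).1).ne'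
  have hBfin : ∀ (p : Euc (n+1) × ℝ) (S : Set (Euc (n+1))), volume (closedBall p.1 p.2 ∩ S) ≠ ⊤ :=
    fun p S => ((measure_mono inter_subset_left).trans_lt measure_closedBall_lt_top).ne
  -- the level step
  have hstep : ∀ p ∈ G, ∀ᶠ h in 𝓝[>] (0 : ℝ),
      volume (closedBall p.1 p.2) ≤ 2 ^ (n + 3) * volume (closedBall p.1 p.2 ∩ {z | s + 2 * h < v z}) := by
    intro p hp
    have h1 := ev_half (hBpos p hp) (hBfin p _) _ (by finiteness) (hG p hp).2.1
    have h2 := ev_meas volume (closedBall p.1 p.2 ∩ {z | s < v z})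
      (fun k : ℕ => {z | s + 2 * (1 / ((k : ℝ) + 1)) < v z}) (Eventually.of_forall fun x hx => by
        have ht : Tendsto (fun k : ℕ => s + 2 * (1 / ((k : ℝ) + 1))) atTop (𝓝 (s + 2 * 0)) :=
          ((tendsto_one_div_add_atTop_nhds_zero_nat (𝕜 := ℝ)).const_mul 2).const_add s
        rw [mul_zero, add_zero] at ht
        exact ht.eventually_lt_const hx.2) _ h1
    obtain ⟨m, hm⟩ := h2.exists
    have hm0 : (0 : ℝ) < 1 / ((m : ℝ) + 1) := by positivity
    filter_upwards [Ioo_mem_nhdsGT hm0] with h hh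
    have h3 : volume ((closedBall p.1 p.2 ∩ {z | s < v z}) ∩ {z | s + 2 * (1 / ((m : ℝ) + 1)) < v z})
        ≤ volume (closedBall p.1 p.2 ∩ {z | s + 2 * h < v z}) := by
      apply measure_mono
      rintro z ⟨⟨hz1, _⟩, hz2⟩
      refine ⟨hz1, ?_⟩
      have hz2 : s + 2 * (1 / ((m : ℝ) + 1)) < v z := hz2
      show s + 2 * h < v z
      linarith [hh.2]
    have h4 := (hm.trans_le h3).le
    rw [ENNReal.div_le_iff (by simp) (by finiteness)] at h4
    refine h4.trans (le_of_eq ?_)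
    ring
  have hstep' : ∀ᶠ h in 𝓝[>] (0 : ℝ), ∀ p ∈ G,
      volume (closedBall p.1 p.2) ≤ 2 ^ (n + 3) * volume (closedBall p.1 p.2 ∩ {z | s + 2 * h < v z}) :=
    (Filter.eventually_all_finset G).2 hstep
  obtain ⟨h, ⟨hh1, hh2⟩, hh0⟩ := ((hlev.and hstep').and self_mem_nhdsWithin).exists
  have hh0 : 0 < h := hh0
  have hk1 : ∀ p ∈ G, ∀ᶠ k in atTop,
      volume (closedBall p.1 p.2) ≤ 4 * volume (closedBall p.1 p.2 ∩ {z | f k z ≤ s + h}) := by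
    intro p hp
    have h1 := ev_half (hBpos p hp) (hBfin p _) _ (by finiteness) (hG p hp).2.2
    have h2 := ev_meas volume (closedBall p.1 p.2 ∩ {z | v z ≤ s})
      (fun k : ℕ => {z | f k z ≤ s + h}) (by
        filter_upwards [hconv] with x hx hxS
        have : v x < s + h := by
          have : v x ≤ s := hxS.2
          linarith
        exact (hx.eventually_lt_const this).mono fun k hk => hk.le) _ h1
    filter_upwards [h2] with k hk
    have h4 := (hk.trans_le (measure_mono (inter_subset_inter_left _ inter_subset_left))).le
    rw [ENNReal.div_le_iff (by simp) (by finiteness)] at h4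
    refine h4.trans (le_of_eq ?_)
    rw [mul_comm]
    norm_num
  have hk2 : ∀ p ∈ G, ∀ᶠ k in atTop,
      volume (closedBall p.1 p.2) ≤ 2 ^ (n + 4) * volume (closedBall p.1 p.2 ∩ {z | s + 2 * h ≤ f k z}) := by
    intro p hp
    have h1 := ev_half (hBpos p hp) (hBfin p _) _ (by finiteness) (hh2 p hp)
    have h2 := ev_meas volume (closedBall p.1 p.2 ∩ {z | s + 2 * h < v z})
      (fun k : ℕ => {z | s + 2 * h ≤ f k z}) (by
        filter_upwards [hconv] with x hx hxS
        exact (hx.eventually_const_lt hxS.2).mono fun k hk => hk.le) _ h1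
    filter_upwards [h2] with k hk
    have h4 := (hk.trans_le (measure_mono (inter_subset_inter_left _ inter_subset_left))).le
    rw [ENNReal.div_le_iff (by simp) (by finiteness)] at h4
    refine h4.trans (le_of_eq ?_)
    ring
  obtain ⟨k, hk0, hk1, hk2⟩ := (hh1.and_eventually (((Filter.eventually_all_finset G).2 hk1).and
    ((Filter.eventually_all_finset G).2 hk2))).exists
  have hI : ∫⁻ z in {z | s + h < f k z ∧ f k z < s + 2 * h}, ‖fderiv ℝ (f k) z‖ₑ ≤
      ENNReal.ofReal (h * (8 * M / (b - a))) := by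
    have hd : Disjoint {z | s + h < f k z ∧ f k z < s + 2 * h} {z | f k z < s + h} := by
      rw [Set.disjoint_left]
      rintro z ⟨hz, _⟩ hz2
      exact absurd hz2 (not_lt.2 hz.le)
    have h1 : (∫⁻ z in {z | s + h < f k z ∧ f k z < s + 2 * h}, ‖fderiv ℝ (f k) z‖ₑ) +
        ∫⁻ z in {z | f k z < s + h}, ‖fderiv ℝ (f k) z‖ₑ ≤
        ∫⁻ z in {z | f k z < s + 2 * h}, ‖fderiv ℝ (f k) z‖ₑ := by
      rw [← lintegral_union (hms k _) hd]
      apply lintegral_mono_set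
      rintro z (hz | hz)
      · exact hz.2
      · have hz : f k z < s + h := hz
        show f k z < s + 2 * h
        linarith
    have h2 := ENNReal.toReal_mono (hfin _ _) h1
    rw [ENNReal.toReal_add (hfin _ _) (hfin _ _)] at h2
    rw [ENNReal.le_ofReal_iff_toReal_le (hfin _ _)]
    · linarith
    · have : 0 < b - a := by linarith
      positivity
  calc ∑ p ∈ G, ENNReal.ofReal p.2 ^ n
      ≤ ∑ p ∈ G, Cpo n * (ENNReal.ofReal (Ksm / h) *
        ∫⁻ z in closedBall p.1 p.2 ∩ {z | s + h < f k z ∧ f k z < s + 2 * h}, ‖fderiv ℝ (f k) z‖ₑ) := by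
        apply Finset.sum_le_sum
        intro p hp
        have := ball_bound n (f k) (hf k) p.1 p.2 (hG p hp).1 (s + h) (s + 2 * h) (by linarith)
          (hk1 p hp) (hk2 p hp)
        have e : s + 2 * h - (s + h) = h := by ring
        rw [e] at this
        exact this
    _ = Cpo n * (ENNReal.ofReal (Ksm / h) * ∑ p ∈ G,
        ∫⁻ z in closedBall p.1 p.2 ∩ {z | s + h < f k z ∧ f k z < s + 2 * h}, ‖fderiv ℝ (f k) z‖ₑ) := by
        rw [← Finset.mul_sum, ← Finset.mul_sum]
    _ ≤ Cpo n * (ENNReal.ofReal (Ksm / h) * ENNReal.ofReal (h * (8 * M / (b - a)))) := by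
        gcongr
        rw [← lintegral_biUnion_finset]
        · refine (lintegral_mono_set ?_).trans hI
          exact iUnion₂_subset fun p _ => inter_subset_right
        · intro p hp q hq hpq
          exact (hdis hp hq hpq).mono inter_subset_left inter_subset_left
        · intro p _
          refine measurableSet_closedBall.inter ?_
          exact (measurableSet_lt measurable_const (hf k).continuous.measurable).inter (hms k _)
    _ = _ := by
        rw [← ENNReal.ofReal_mul (div_nonneg Ksm_pos.le hh0.le)]
        congr 2
        field_simp

lemma boxing (n : ℕ) (u : Euc (n+1) → ℝ) (hu : Integrable u volume)
    (M : ℝ) (hM : 0 < M) (hV : variation u univ ≤ ENNReal.ofReal M) (t : ℝ) (ht : 0 < t)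
    (hL : ∫⁻ x, ‖u x‖ₑ ≤ ENNReal.ofReal (t / 4) * omg n) :
    ∃ A', Cov n A' (5 ^ n * (Cpo n * ENNReal.ofReal (Ksm * (8 * M / (t - t / 2))))) ∧
      volume ({x | t < u x} \ A') = 0 := by
  obtain ⟨f, hf, hconv, hfV⟩ := mollify u hu (hV.trans_lt ENNReal.ofReal_lt_top).ne
  let v := hu.aestronglyMeasurable.mk u
  have hvm : Measurable v := hu.aestronglyMeasurable.stronglyMeasurable_mk.measurable
  have huv : u =ᵐ[volume] v := hu.aestronglyMeasurable.ae_eq_mk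
  have hconv' : ∀ᵐ x, Tendsto (fun k => f k x) atTop (𝓝 (v x)) := by
    filter_upwards [hconv, huv] with x hx hx2
    rw [← hx2]
    exact hx
  obtain ⟨s, hs, hfam⟩ := family_bound n v f hf hconv' M hM (fun k => (hfV k).trans hV)
    (t / 2) t (by linarith)
  let T : Set (Euc (n+1) × ℝ) := {p | (0 < p.2 ∧ p.2 ≤ 2) ∧
    volume (closedBall p.1 p.2) ≤ 2 ^ (n + 2) * volume (closedBall p.1 p.2 ∩ {z | s < v z}) ∧
    volume (closedBall p.1 p.2) ≤ 2 * volume (closedBall p.1 p.2 ∩ {z | v z ≤ s})}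
  refine ⟨_, vitali_cov T (fun p hp => hp.1) _ (fun G hG hd =>
    hfam G (fun p hp => ⟨(hG hp).1.1, (hG hp).2⟩) hd), ?_⟩
  have hEm : MeasurableSet {z | s < v z} := measurableSet_lt measurable_const hvm
  have hs0 : 0 < s := by linarith [hs.1]
  have hE : 2 * volume {z | s < v z} ≤ omg n := by
    have h1 : ENNReal.ofReal s * volume {z | s < v z} ≤ ENNReal.ofReal (t / 4) * omg n := by
      calc ENNReal.ofReal s * volume {z | s < v z}
          ≤ ENNReal.ofReal s * volume {z | ENNReal.ofReal s ≤ ‖v z‖ₑ} := by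
            refine mul_le_mul' le_rfl (measure_mono ?_)
            intro z hz
            have hz : s < v z := hz
            show ENNReal.ofReal s ≤ ‖v z‖ₑ
            rw [← ofReal_norm, Real.norm_eq_abs]
            exact ENNReal.ofReal_le_ofReal (hz.le.trans (le_abs_self _))
        _ ≤ ∫⁻ z, ‖v z‖ₑ := mul_meas_ge_le_lintegral hvm.enorm _
        _ = ∫⁻ z, ‖u z‖ₑ := by
            apply lintegral_congr_ae
            filter_upwards [huv] with x hx
            rw [hx]
        _ ≤ _ := hL
    have h2 : ENNReal.ofReal (t / 4) * (2 * volume {z | s < v z}) ≤ ENNReal.ofReal (t / 4) * omg n := by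
      refine le_trans ?_ h1
      have : ENNReal.ofReal (t / 4) * 2 ≤ ENNReal.ofReal s := by
        rw [show (2 : ℝ≥0∞) = ENNReal.ofReal 2 by simp, ← ENNReal.ofReal_mul (by linarith)]
        exact ENNReal.ofReal_le_ofReal (by linarith [hs.1])
      rw [← mul_assoc]
      gcongr
    exact (ENNReal.mul_le_mul_iff_right (by simpa using ht) ENNReal.ofReal_ne_top).1 h2
  have hae := Besicovitch.ae_tendsto_measure_inter_div_of_measurableSet
    (volume : Measure (Euc (n+1))) hEm
  have : ∀ᵐ x, x ∉ {x | t < u x} \ (⋃ p ∈ T, closedBall p.1 p.2) := by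
    filter_upwards [hae, huv] with x hx hxv hbad
    obtain ⟨hxt, hxT⟩ := hbad
    apply hxT
    have hxE : x ∈ {z | s < v z} := by
      have hxt : t < u x := hxt
      show s < v x
      rw [← hxv]
      linarith [hs.2]
    rw [indicator_of_mem hxE] at hx
    have htm : Tendsto (fun m : ℕ => ((1 : ℝ) / 2) ^ m) atTop (𝓝[>] 0) := by
      refine tendsto_nhdsWithin_iff.2 ⟨tendsto_pow_atTop_nhds_zero_of_lt_one (by norm_num) (by norm_num),
        Eventually.of_forall fun m => ?_⟩
      show (0 : ℝ) < _
      positivity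
    have hBne : ∀ m : ℕ, volume (closedBall x (((1 : ℝ) / 2) ^ m)) ≠ 0 := fun m =>
      (measure_closedBall_pos volume x (by positivity)).ne'
    have hBt : ∀ m : ℕ, volume (closedBall x (((1 : ℝ) / 2) ^ m)) ≠ ⊤ := fun m =>
      measure_closedBall_lt_top.ne
    have hP : ∃ m : ℕ, volume (closedBall x (((1 : ℝ) / 2) ^ m)) <
        2 * volume ({z | s < v z} ∩ closedBall x (((1 : ℝ) / 2) ^ m)) := by
      have h1 := (hx.comp htm).eventually_const_lt
        (show (2 : ℝ≥0∞)⁻¹ < (1 : Euc (n+1) → ℝ≥0∞) x by simp)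
      obtain ⟨m, hm⟩ := h1.exists
      refine ⟨m, ?_⟩
      have hm : (2 : ℝ≥0∞)⁻¹ < volume ({z | s < v z} ∩ closedBall x (((1 : ℝ) / 2) ^ m)) /
        volume (closedBall x (((1 : ℝ) / 2) ^ m)) := hm
      rw [ENNReal.lt_div_iff_mul_lt (Or.inl (hBne m)) (Or.inl (hBt m))] at hm
      have h2 := (ENNReal.mul_lt_mul_iff_right (a := 2) (by simp) (by simp)).2 hm
      rwa [← mul_assoc, ENNReal.mul_inv_cancel (by simp) (by simp), one_mul] at h2
    classical
    have hm1 := Nat.find_spec hP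
    have hm2 : ∀ j < Nat.find hP, _ := fun j hj => Nat.find_min hP hj
    generalize Nat.find hP = m at hm1 hm2
    rcases m with _ | j
    · exfalso
      rw [pow_zero, vol_cB n x zero_le_one] at hm1
      simp only [ENNReal.ofReal_one, one_pow, one_mul] at hm1
      refine absurd hm1 (not_lt.2 (le_trans ?_ hE))
      gcongr
      exact inter_subset_left
    · have hj := not_lt.1 (hm2 j (Nat.lt_succ_self j))
      have hr1 : ((1 : ℝ) / 2) ^ j ≤ 1 := pow_le_one₀ (by norm_num) (by norm_num)
      have hr0 : (0 : ℝ) < ((1 : ℝ) / 2) ^ j := by positivity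
      refine mem_iUnion₂.2 ⟨(x, ((1 : ℝ) / 2) ^ j), ⟨⟨hr0, by show _ ≤ (2 : ℝ); linarith⟩, ?_, ?_⟩,
        mem_closedBall_self hr0.le⟩
      · have e1 : volume (closedBall x (((1 : ℝ) / 2) ^ j)) =
            2 ^ (n + 1) * volume (closedBall x (((1 : ℝ) / 2) ^ (j + 1))) := by
          rw [vol_cB n x hr0.le, vol_cB n x (by positivity), ← mul_assoc, ← mul_pow]
          congr 2
          rw [show (2 : ℝ≥0∞) = ENNReal.ofReal 2 by simp, ← ENNReal.ofReal_mul (by norm_num)]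
          congr 1
          rw [pow_succ]
          ring
        show volume (closedBall x (((1 : ℝ) / 2) ^ j)) ≤
          2 ^ (n + 2) * volume (closedBall x (((1 : ℝ) / 2) ^ j) ∩ {z | s < v z})
        rw [e1, inter_comm, pow_succ 2 (n + 1), mul_assoc]
        gcongr
        refine hm1.le.trans ?_
        refine mul_le_mul' le_rfl (measure_mono (inter_subset_inter_right _ ?_))
        apply closedBall_subset_closedBall
        exact pow_le_pow_of_le_one (by norm_num) (by norm_num) (Nat.le_succ j)
      · show volume (closedBall x (((1 : ℝ) / 2) ^ j)) ≤
          2 * volume (closedBall x (((1 : ℝ) / 2) ^ j) ∩ {z | v z ≤ s})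
        have hsplit := measure_inter_add_diff (μ := volume) (closedBall x (((1 : ℝ) / 2) ^ j)) hEm
        have e2 : closedBall x (((1 : ℝ) / 2) ^ j) \ {z | s < v z} =
            closedBall x (((1 : ℝ) / 2) ^ j) ∩ {z | v z ≤ s} := by
          ext z
          simp
        rw [e2] at hsplit
        rw [inter_comm] at hj
        have hfin := hBt j
        generalize volume (closedBall x (((1 : ℝ) / 2) ^ j)) = V at *
        generalize volume (closedBall x (((1 : ℝ) / 2) ^ j) ∩ {z | s < v z}) = P at *
        generalize volume (closedBall x (((1 : ℝ) / 2) ^ j) ∩ {z | v z ≤ s}) = Q at *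
        have hP : P ≠ ⊤ := by
          rintro rfl
          simp at hsplit
          exact hfin hsplit.symm
        have h3 : P + P ≤ P + Q := by rw [hsplit, ← two_mul]; exact hj
        have h4 := (ENNReal.add_le_add_iff_left hP).1 h3
        rw [← hsplit, two_mul]
        gcongr
  exact measure_eq_zero_iff_ae_notMem.2 this

lemma approxUpper_nonneg {N : ℕ} (u : Euc N → ℝ) (hu : ∀ x, 0 ≤ u x) (x : Euc N) :
    0 ≤ approxUpper u univ x := by
  refine le_sInf ?_
  rintro _ ⟨s, rfl, hs⟩
  by_contra hneg
  have hs0 : s < 0 := by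
    have := not_le.1 hneg
    exact_mod_cast this
  have e : {y | y ∈ (univ : Set (Euc N)) ∧ s < u y} = univ := by
    ext y
    simp only [mem_univ, true_and, mem_setOf_eq, iff_true]
    exact hs0.trans_le (hu y)
  rw [e] at hs
  have h1 : Tendsto (fun ρ : ℝ => volume (univ ∩ ball x ρ) / volume (ball x ρ)) (𝓝[>] 0) (𝓝 1) := by
    refine tendsto_const_nhds.congr' ?_
    filter_upwards [self_mem_nhdsWithin] with ρ hρ
    rw [univ_inter, ENNReal.div_self (measure_ball_pos volume x hρ).ne' measure_ball_lt_top.ne]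
  have := tendsto_nhds_unique h1 hs
  simp at this

lemma final_zero (u : ℕ → Euc 0 → ℝ)
    (hpos : ∀ k x, 0 ≤ u k x)
    (hconv : Tendsto (fun k => eLpNorm (u k) 1 volume + variation (u k) Set.univ)
      atTop (𝓝 0)) :
    ∃ φ : ℕ → ℕ, StrictMono φ ∧
      ∀ᵐ x ∂(μH[((0 : ℕ) : ℝ) - 1] : Measure (Euc 0)),
        Tendsto (fun j => approxUpper (u (φ j)) Set.univ x) atTop (𝓝 (0 : EReal)) := by
  refine ⟨id, strictMono_id, Eventually.of_forall fun x => ?_⟩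
  have h1 : Tendsto (fun k => eLpNorm (u k) 1 volume) atTop (𝓝 0) :=
    tendsto_of_tendsto_of_tendsto_of_le_of_le tendsto_const_nhds hconv (fun _ => zero_le)
      (fun k => le_self_add)
  have h2 : ∀ k, eLpNorm (u k) 1 volume = ENNReal.ofReal (u k x) := by
    intro k
    rw [eLpNorm_one_eq_lintegral_enorm, volume_euclideanSpace_eq_dirac, lintegral_dirac,
      Subsingleton.elim (0 : Euc 0) x, ← ofReal_norm, Real.norm_eq_abs, abs_of_nonneg (hpos k x)]
  simp_rw [h2] at h1
  have h3 : Tendsto (fun k => u k x) atTop (𝓝 0) := by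
    have := (ENNReal.tendsto_toReal (by simp : (0 : ℝ≥0∞) ≠ ⊤)).comp h1
    simp only [ENNReal.toReal_zero] at this
    refine this.congr fun k => ?_
    simp [hpos k x]
  have h4 : Tendsto (fun k => ((u k x : ℝ) : EReal)) atTop (𝓝 (0 : EReal)) := by
    have := EReal.tendsto_coe.2 h3
    simpa using this
  refine tendsto_of_tendsto_of_tendsto_of_le_of_le tendsto_const_nhds h4
    (fun k => approxUpper_nonneg _ (hpos _) x) (fun k => ?_)
  refine sInf_le ⟨u k x, rfl, ?_⟩
  have e : {y | y ∈ (univ : Set (Euc 0)) ∧ u k x < u k y} = ∅ := by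
    ext y
    simp [Subsingleton.elim y x]
  show HasDensity {y | y ∈ (univ : Set (Euc 0)) ∧ u k x < u k y} x 0
  rw [e]
  simp [HasDensity]

lemma Cpo_ne_top (n : ℕ) : Cpo n ≠ ⊤ := by
  unfold Cpo
  exact ENNReal.mul_ne_top (by finiteness) (ENNReal.inv_ne_top.2 (omg_ne_zero n))

lemma final_succ (n : ℕ) (u : ℕ → Euc (n+1) → ℝ)
    (hpos : ∀ k x, 0 ≤ u k x) (hBV : ∀ k, MemBV (u k) Set.univ)
    (hconv : Tendsto (fun k => eLpNorm (u k) 1 volume + variation (u k) Set.univ)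
      atTop (𝓝 0)) :
    ∃ φ : ℕ → ℕ, StrictMono φ ∧
      ∀ᵐ x ∂(μH[(n : ℝ)] : Measure (Euc (n+1))),
        Tendsto (fun j => approxUpper (u (φ j)) Set.univ x) atTop (𝓝 (0 : EReal)) := by
  have hsmall : ∀ j : ℕ, ∀ᶠ k in atTop,
      eLpNorm (u k) 1 volume + variation (u k) Set.univ ≤
        min (ENNReal.ofReal ((1 / 4) ^ j)) (ENNReal.ofReal ((1 / 2) ^ j / 4) * omg n) := by
    intro j
    apply hconv.eventually_le_const
    apply lt_min
    · rw [ENNReal.ofReal_pos]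
      positivity
    · apply ENNReal.mul_pos
      · rw [Ne, ENNReal.ofReal_eq_zero, not_le]
        positivity
      · exact omg_ne_zero n
  obtain ⟨φ, hφ, hφs⟩ := extraction_forall_of_eventually' (fun j => by
    exact eventually_atTop.1 (hsmall j))
  refine ⟨φ, hφ, ?_⟩
  let S : ℕ → Set (Euc (n+1)) := fun j =>
    {x | ¬ HasDensity {y | y ∈ (univ : Set (Euc (n+1))) ∧ ((1 : ℝ) / 2) ^ j < u (φ j) y} x 0}
  let K : ℝ≥0∞ := 5 ^ n * Cpo n * ENNReal.ofReal (16 * Ksm) + 1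
  have hK : K ≠ ⊤ := by
    refine ENNReal.add_ne_top.2 ⟨?_, ENNReal.one_ne_top⟩
    exact ENNReal.mul_ne_top (ENNReal.mul_ne_top (by finiteness) (Cpo_ne_top n)) ENNReal.ofReal_ne_top
  have hcov : ∀ j, Cov n (S j) (K * ENNReal.ofReal ((1 / 2) ^ j)) := by
    intro j
    have hi : Integrable (u (φ j)) volume := by
      have := (hBV (φ j)).1
      rwa [integrableOn_univ] at this
    have h0 := hφs j
    have hV := (le_add_self.trans h0).trans (min_le_left _ _)
    have hL := (le_self_add.trans h0).trans (min_le_right _ _)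
    rw [eLpNorm_one_eq_lintegral_enorm] at hL
    obtain ⟨A', hA1, hA2⟩ := boxing n (u (φ j)) hi ((1 / 4) ^ j) (by positivity) hV
      ((1 / 2) ^ j) (by positivity) hL
    have e : Ksm * (8 * (1 / 4) ^ j / ((1 / 2) ^ j - (1 / 2) ^ j / 2)) = (16 * Ksm) * (1 / 2) ^ j := by
      have e4 : ((1 : ℝ) / 4) ^ j = (1 / 2) ^ j * (1 / 2) ^ j := by rw [← mul_pow]; norm_num
      have hp : (0 : ℝ) < (1 / 2) ^ j := by positivity
      rw [e4]
      generalize ((1 : ℝ) / 2) ^ j = q at *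
      have : q - q / 2 = q / 2 := by ring
      rw [this]
      field_simp
      ring
    rw [e, ENNReal.ofReal_mul (by linarith [Ksm_pos])] at hA1
    have hd := density_cov n {y | y ∈ (univ : Set (Euc (n+1))) ∧ ((1 : ℝ) / 2) ^ j < u (φ j) y} A' _
      (by
        refine ENNReal.mul_ne_top (by finiteness) (ENNReal.mul_ne_top (Cpo_ne_top n) ?_)
        exact ENNReal.mul_ne_top ENNReal.ofReal_ne_top ENNReal.ofReal_ne_top) hA1
      (by simpa using hA2) (ENNReal.ofReal ((1 / 2) ^ j)) (by rw [ENNReal.ofReal_pos]; positivity)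
    refine hd.mono subset_rfl (le_of_eq ?_)
    simp only [K]
    ring
  have hsum : ∑' j : ℕ, K * ENNReal.ofReal ((1 / 2) ^ j) ≠ ⊤ := by
    rw [ENNReal.tsum_mul_left]
    refine ENNReal.mul_ne_top hK ?_
    rw [← ENNReal.ofReal_tsum_of_nonneg (fun j => by positivity) summable_geometric_two]
    exact ENNReal.ofReal_ne_top
  have hnull : μH[(n : ℝ)] (⋂ i : ℕ, ⋃ k : ℕ, S (k + i)) = 0 := by
    apply hausdorff_zero_of_cov
    intro η hη
    obtain ⟨i, hi⟩ := ((ENNReal.tendsto_sum_nat_add _ hsum).eventually_lt_const hη).exists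
    exact (Cov.iUnion (fun k => hcov (k + i))).mono (iInter_subset _ i) hi.le
  have hnull' := measure_eq_zero_iff_ae_notMem.1 hnull
  filter_upwards [hnull'] with x hx
  simp only [mem_iInter, mem_iUnion, not_forall, not_exists] at hx
  obtain ⟨i, hi⟩ := hx
  have hlim : Tendsto (fun j : ℕ => (((1 / 2 : ℝ) ^ j : ℝ) : EReal)) atTop (𝓝 (0 : EReal)) := by
    have := EReal.tendsto_coe.2 (tendsto_pow_atTop_nhds_zero_of_lt_one (r := (1 / 2 : ℝ))
      (by norm_num) (by norm_num))
    simpa using this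
  refine tendsto_of_tendsto_of_tendsto_of_le_of_le' tendsto_const_nhds hlim
    (Eventually.of_forall fun k => approxUpper_nonneg _ (hpos _) x) ?_
  filter_upwards [eventually_ge_atTop i] with j hj
  refine sInf_le ⟨(1 / 2 : ℝ) ^ j, rfl, ?_⟩
  have := hi (j - i)
  rw [Nat.sub_add_cancel hj] at this
  exact not_not.1 this

/-- if `{u_k}` are nonnegative functions in `BV(ℝ^N)` with
`‖u_k‖_BV = ‖u_k‖_{L¹} + V(u_k, ℝ^N) → 0`, then a subsequence satisfies
`u_{k_j}⁺(x) → 0` for `H^{N-1}`-a.e. `x`. -/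
theorem statement11 {N : ℕ} (u : ℕ → Euc N → ℝ)
    (hpos : ∀ k x, 0 ≤ u k x) (hBV : ∀ k, MemBV (u k) Set.univ)
    (hconv : Tendsto (fun k => eLpNorm (u k) 1 volume + variation (u k) Set.univ)
      atTop (𝓝 0)) :
    ∃ φ : ℕ → ℕ, StrictMono φ ∧
      ∀ᵐ x ∂(μH[(N : ℝ) - 1] : Measure (Euc N)),
        Tendsto (fun j => approxUpper (u (φ j)) Set.univ x) atTop (𝓝 (0 : EReal)) := by
  rcases N with _ | n
  · exact final_zero u hpos hconv
  · have := final_succ n u hpos hBV hconv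
    simpa using this
end
end
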